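/- Suppose Φ is irreducible and not of type G₂, and let Ψ ⊆ Φ⁺ be a biconvex subset. Then 𝔞_Ψ = ⊕_{α∈Ψ} 𝔤_α is a spherical subspace of 𝔫 (i.e. ad(x)⁴ = 0 for all x ∈ 𝔞_Ψ) if and only if ⟨α,β⟩ ≥ 0 for all α, β ∈ Ψ. -/

import Mathlib

/- Background setup: a finite reduced crystallographic root system `Φ` with chosen
positive roots `Φ⁺` in a euclidean space `V`, the Cartan pairing, and the basic
combinatorial notions used in the statement. -/

open scoped RealInnerProductSpace

noncomputable section

variable {V : Type*} [NormedAddCommGroup V] [InnerProductSpace ℝ V]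

/-- The Cartan pairing `⟨α, β⟩ = 2 (α, β) / (β, β)`. -/
def cpair (α β : V) : ℝ := 2 * ⟪α, β⟫ / ⟪β, β⟫

/-- The reflection associated to `β`, as a linear endomorphism of `V`:
`v ↦ v - (2 (β, v)/(β, β)) • β`. -/
def reflEnd (β : V) : Module.End ℝ V :=
  LinearMap.id -
    (LinearMap.toSpanSingleton ℝ V β ∘ₗ ((2 / ⟪β, β⟫) • (innerSL ℝ β).toLinearMap))

/-- A subset of `V` is orthogonal if the Cartan pairing of any two distinct
elements vanishes. -/
def OrthogonalSet (S : Set V) : Prop := ∀ γ ∈ S, ∀ γ' ∈ S, γ ≠ γ' → cpair γ γ' = 0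

/-- A finite reduced crystallographic root system in the euclidean space `V`,
together with a choice of positive roots. -/
structure RootSystemData (V : Type*) [NormedAddCommGroup V] [InnerProductSpace ℝ V] where
  /-- the set of roots Φ -/
  roots : Set V
  /-- the set of positive roots Φ⁺ -/
  pos : Set V
  finite : roots.Finite
  ne_zero : ∀ α ∈ roots, α ≠ 0
  span_eq_top : Submodule.span ℝ roots = ⊤
  reduced : ∀ α ∈ roots, ∀ t : ℝ, t • α ∈ roots → t = 1 ∨ t = -1
  crystallographic : ∀ α ∈ roots, ∀ β ∈ roots, ∃ n : ℤ, cpair α β = (n : ℝ)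
  reflect_mem : ∀ α ∈ roots, ∀ β ∈ roots, reflEnd β α ∈ roots
  pos_subset : pos ⊆ roots
  pos_iff : ∀ α ∈ roots, (α ∈ pos ↔ ¬ (-α ∈ pos))
  pos_add : ∀ α ∈ pos, ∀ β ∈ pos, α + β ∈ roots → α + β ∈ pos

namespace RootSystemData

variable (D : RootSystemData V)

/-- Irreducibility: the roots admit no nontrivial partition into two mutually
orthogonal parts. -/
def IsIrreducible : Prop :=
  D.roots.Nonempty ∧
    ∀ s ⊆ D.roots, (∀ α ∈ s, ∀ β ∈ D.roots \ s, ⟪α, β⟫ = 0) → s = ∅ ∨ s = D.roots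

/-- An irreducible root system is not of type `G₂` iff no Cartan pairing of two
roots equals `±3`. -/
def NotG2 : Prop := ∀ α ∈ D.roots, ∀ β ∈ D.roots, cpair α β ≠ 3 ∧ cpair α β ≠ -3

/-- An irreducible root system is of type `G₂` iff some Cartan pairing of two
roots equals `±3`. -/
def IsG2 : Prop :=
  D.IsIrreducible ∧ ∃ α ∈ D.roots, ∃ β ∈ D.roots, cpair α β = 3 ∨ cpair α β = -3

/-- All roots have the same length (types A, D, E). -/
def SimplyLaced : Prop := ∀ α ∈ D.roots, ∀ β ∈ D.roots, ⟪α, α⟫ = ⟪β, β⟫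

/-- There are exactly two root lengths, with squared-length ratio 2
(types B, C, F₄). -/
def DoublyLaced : Prop :=
  (∃ α ∈ D.roots, ∃ β ∈ D.roots, ⟪β, β⟫ = 2 * ⟪α, α⟫) ∧
    ∀ α ∈ D.roots, ∀ β ∈ D.roots,
      ⟪α, α⟫ = ⟪β, β⟫ ∨ ⟪β, β⟫ = 2 * ⟪α, α⟫ ∨ ⟪α, α⟫ = 2 * ⟪β, β⟫

/-- A root of maximal length. -/
def IsLong (α : V) : Prop := α ∈ D.roots ∧ ∀ β ∈ D.roots, ⟪β, β⟫ ≤ ⟪α, α⟫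

/-- A root of minimal length. -/
def IsShort (α : V) : Prop := α ∈ D.roots ∧ ∀ β ∈ D.roots, ⟪α, α⟫ ≤ ⟪β, β⟫

/-- A set of positive roots is convex if any root which is a linear combination of
two of its elements with positive coefficients lies in it. -/
def ConvexSubset (S : Set V) : Prop :=
  ∀ α ∈ S, ∀ β ∈ S, ∀ a b : ℝ, 0 < a → 0 < b →
    a • α + b • β ∈ D.roots → a • α + b • β ∈ S

/-- A subset `Ψ ⊆ Φ⁺` is biconvex if both `Ψ` and `Φ⁺ \ Ψ` are convex. -/
def Biconvex (S : Set V) : Prop :=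
  S ⊆ D.pos ∧ D.ConvexSubset S ∧ D.ConvexSubset (D.pos \ S)

/-- A subset `Ψ ⊆ Φ⁺` is a combinatorial ideal if `α ∈ Ψ`, `β ∈ Φ⁺`, `α + β ∈ Φ⁺`
imply `α + β ∈ Ψ`. -/
def CombIdeal (S : Set V) : Prop :=
  S ⊆ D.pos ∧ ∀ α ∈ S, ∀ β ∈ D.pos, α + β ∈ D.pos → α + β ∈ S

end RootSystemData

/- The Lie-theoretic setup: a finite-dimensional complex simple Lie algebra `𝔤`
with Cartan subalgebra `𝔱`, whose root space decomposition is indexed by the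
root system `Φ ⊆ V`. -/

/-- A finite-dimensional simple complex Lie algebra `L`, together with a Cartan
subalgebra and its root space decomposition, whose root system is `Φ ⊆ V` with a
choice of positive roots (determining the Borel subalgebra `𝔟 = 𝔱 ⊕ 𝔫`). -/
structure LieRootData (V : Type*) [NormedAddCommGroup V] [InnerProductSpace ℝ V]
    (L : Type*) [LieRing L] [LieAlgebra ℂ L] extends RootSystemData V where
  /-- the Cartan subalgebra 𝔱 -/
  cartan : LieSubalgebra ℂ L
  /-- the root space 𝔤_α attached to each root α -/
  rs : V → Submodule ℂ L
  finiteDim : FiniteDimensional ℂ L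
  isSimple : LieAlgebra.IsSimple ℂ L
  isCartan : cartan.IsCartanSubalgebra
  rs_dim : ∀ α ∈ roots, Module.finrank ℂ (rs α) = 1
  sup_eq_top : cartan.toSubmodule ⊔ (⨆ α ∈ roots, rs α) = ⊤
  indep : ∀ α ∈ roots, rs α ⊓ (cartan.toSubmodule ⊔ ⨆ β ∈ roots \ {α}, rs β) = ⊥
  weight_vec : ∀ α ∈ roots, ∀ h ∈ cartan, ∀ x ∈ rs α, ∃ c : ℂ, ⁅h, x⁆ = c • x
  bracket_mem : ∀ α ∈ roots, ∀ β ∈ roots, α + β ∈ roots →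
    ∀ x ∈ rs α, ∀ y ∈ rs β, ⁅x, y⁆ ∈ rs (α + β)
  bracket_ne_zero : ∀ α ∈ roots, ∀ β ∈ roots, α + β ∈ roots →
    ∀ x ∈ rs α, x ≠ 0 → ∀ y ∈ rs β, y ≠ 0 → ⁅x, y⁆ ≠ 0
  bracket_eq_zero : ∀ α ∈ roots, ∀ β ∈ roots, α + β ∉ roots → α + β ≠ 0 →
    ∀ x ∈ rs α, ∀ y ∈ rs β, ⁅x, y⁆ = 0
  bracket_cartan_mem : ∀ α ∈ roots, ∀ x ∈ rs α, ∀ y ∈ rs (-α), ⁅x, y⁆ ∈ cartan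

namespace LieRootData

variable {L : Type*} [LieRing L] [LieAlgebra ℂ L] (D : LieRootData V L)

/-- The nilradical `𝔫 = ⊕_{α ∈ Φ⁺} 𝔤_α` of the Borel subalgebra, as a submodule. -/
def nilrad : Submodule ℂ L := ⨆ α ∈ D.pos, D.rs α

/-- The Borel subalgebra `𝔟 = 𝔱 ⊕ 𝔫`, as a submodule. -/
def borel : Submodule ℂ L := D.cartan.toSubmodule ⊔ D.nilrad

/-- The subspace `𝔞_Ψ = ⊕_{α ∈ Ψ} 𝔤_α` attached to a subset `Ψ ⊆ Φ⁺`. -/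
def aSubspace (S : Set V) : Submodule ℂ L := ⨆ α ∈ S, D.rs α

end LieRootData

/-- A subspace of `𝔫` is spherical if `ad(x)^4 = 0` for every `x` in it. -/
def IsSphericalSubspace {L : Type*} [LieRing L] [LieAlgebra ℂ L]
    (a : Submodule ℂ L) : Prop :=
  ∀ x ∈ a, (LieAlgebra.ad ℂ L x) ^ 4 = 0

/-- The height of a nilpotent element `x`: `max {n | ad(x)^n ≠ 0}`. -/
noncomputable def heightOf {L : Type*} [LieRing L] [LieAlgebra ℂ L] (x : L) : ℕ :=
  sSup {n : ℕ | (LieAlgebra.ad ℂ L x) ^ n ≠ 0}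


namespace BSP

structure KForm (Φ : Set V) (K : V →ₗ[ℝ] V →ₗ[ℝ] ℝ) : Prop where
  symm : ∀ x y, K x y = K y x
  nonneg : ∀ x, 0 ≤ K x x
  definite : ∀ x, K x x = 0 → x = 0
  norm : ∀ α ∈ Φ, K α α = 2 ∨ K α α = 4
  int : ∀ α ∈ Φ, ∀ β ∈ Φ, ∃ n : ℤ, K α β = n
  even : ∀ α ∈ Φ, ∀ β ∈ Φ, K β β = 4 → ∃ n : ℤ, K α β = 2 * n
  refl : ∀ α ∈ Φ, ∀ β ∈ Φ, α - (2 * K α β / K β β) • β ∈ Φ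

namespace KForm

variable {Φ : Set V} {K : V →ₗ[ℝ] V →ₗ[ℝ] ℝ}

lemma add_add (H : KForm Φ K) (x y : V) : K (x + y) (x + y) = K x x + K y y + 2 * K x y := by
  simp only [map_add, LinearMap.add_apply]; rw [H.symm y x]; ring

lemma sub_sub (H : KForm Φ K) (x y : V) : K (x - y) (x - y) = K x x + K y y - 2 * K x y := by
  simp only [map_sub, LinearMap.sub_apply]; rw [H.symm y x]; ring

lemma eq_of (H : KForm Φ K) (x y : V) (h : K x x + K y y - 2 * K x y = 0) : x = y := by
  rw [← H.sub_sub] at h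
  exact sub_eq_zero.1 (H.definite _ h)

lemma eq_neg_of (H : KForm Φ K) (x y : V) (h : K x x + K y y + 2 * K x y = 0) : x = -y := by
  rw [← H.add_add] at h
  exact eq_neg_of_add_eq_zero_left (H.definite _ h)

lemma neg_mem (H : KForm Φ K) {α : V} (h : α ∈ Φ) : -α ∈ Φ := by
  have h1 := H.refl α h α h
  have : K α α ≠ 0 := by rcases H.norm α h with h | h <;> rw [h] <;> norm_num
  rw [mul_div_assoc, div_self this] at h1
  convert h1 using 1
  rw [mul_one, two_smul]; abel

lemma ne_zero (H : KForm Φ K) {α : V} (h : α ∈ Φ) : α ≠ 0 := by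
  rintro rfl
  rcases H.norm _ h with h | h <;> simp at h

lemma not_mem_of_gt (H : KForm Φ K) {x : V} (h : 4 < K x x) : x ∉ Φ := by
  intro hx
  rcases H.norm _ hx with h' | h' <;> linarith

lemma ne_zero_of_gt (H : KForm Φ K) {x : V} (h : 4 < K x x) : x ≠ 0 := by
  rintro rfl; simp at h; linarith

lemma bounds (H : KForm Φ K) {α β : V} : -(K α α + K β β) ≤ 2 * K α β ∧ 2 * K α β ≤ K α α + K β β := by
  have h1 := H.nonneg (α - β)
  have h2 := H.nonneg (α + β)
  rw [H.sub_sub] at h1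
  rw [H.add_add] at h2
  constructor <;> linarith

lemma kss (H : KForm Φ K) {α β : V} (ha : α ∈ Φ) (hb : β ∈ Φ) (na : K α α = 2) (nb : K β β = 2) :
    ∃ n : ℤ, K α β = n ∧ -2 ≤ n ∧ n ≤ 2 ∧ (n = 2 → α = β) ∧ (n = -2 → α = -β) := by
  obtain ⟨n, hn⟩ := H.int α ha β hb
  obtain ⟨h1, h2⟩ := H.bounds (α := α) (β := β)
  refine ⟨n, hn, ?_, ?_, ?_, ?_⟩
  · have : (-2 : ℝ) ≤ n := by linarith
    exact_mod_cast this
  · have : (n : ℝ) ≤ 2 := by linarith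
    exact_mod_cast this
  · rintro rfl; apply H.eq_of; rw [hn, na, nb]; norm_num
  · rintro rfl; apply H.eq_neg_of; rw [hn, na, nb]; norm_num

lemma ksl (H : KForm Φ K) {α β : V} (ha : α ∈ Φ) (hb : β ∈ Φ) (na : K α α = 2) (nb : K β β = 4) :
    ∃ n : ℤ, K α β = 2 * n ∧ -1 ≤ n ∧ n ≤ 1 := by
  obtain ⟨n, hn⟩ := H.even α ha β hb nb
  obtain ⟨h1, h2⟩ := H.bounds (α := α) (β := β)
  refine ⟨n, hn, ?_, ?_⟩
  · have : (-2 : ℝ) < n := by linarith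
    have : -2 < n := by exact_mod_cast this
    omega
  · have : (n : ℝ) < 2 := by linarith
    have : n < 2 := by exact_mod_cast this
    omega

lemma kls (H : KForm Φ K) {α β : V} (ha : α ∈ Φ) (hb : β ∈ Φ) (na : K α α = 4) (nb : K β β = 2) :
    ∃ n : ℤ, K α β = 2 * n ∧ -1 ≤ n ∧ n ≤ 1 := by
  rw [H.symm]; exact H.ksl hb ha nb na

lemma kll (H : KForm Φ K) {α β : V} (ha : α ∈ Φ) (hb : β ∈ Φ) (na : K α α = 4) (nb : K β β = 4) :
    ∃ n : ℤ, K α β = 2 * n ∧ -2 ≤ n ∧ n ≤ 2 ∧ (n = 2 → α = β) ∧ (n = -2 → α = -β) := by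
  obtain ⟨n, hn⟩ := H.even α ha β hb nb
  obtain ⟨h1, h2⟩ := H.bounds (α := α) (β := β)
  refine ⟨n, hn, ?_, ?_, ?_, ?_⟩
  · have : (-2 : ℝ) ≤ n := by linarith
    exact_mod_cast this
  · have : (n : ℝ) ≤ 2 := by linarith
    exact_mod_cast this
  · rintro rfl; apply H.eq_of; rw [hn, na, nb]; norm_num
  · rintro rfl; apply H.eq_neg_of; rw [hn, na, nb]; norm_num

lemma add_mem (H : KForm Φ K) {α β : V} (ha : α ∈ Φ) (hb : β ∈ Φ) (h : K α β < 0) (h0 : α + β ≠ 0) :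
    α + β ∈ Φ := by
  have hne : α ≠ -β := fun h => h0 (by rw [h]; simp)
  have r1 := H.refl α ha β hb
  have r2 := H.refl β hb α ha
  rw [H.symm β α] at r2
  rcases H.norm α ha with na | na <;> rcases H.norm β hb with nb | nb
  · obtain ⟨n, hn, l, u, e, e'⟩ := H.kss ha hb na nb
    have : n < 0 := by rw [hn] at h; exact_mod_cast h
    have : n ≠ -2 := fun h => hne (e' h)
    obtain rfl : n = -1 := by omega
    rw [hn, nb] at r1
    convert r1 using 1; norm_num
  · obtain ⟨n, hn, l, u⟩ := H.ksl ha hb na nb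
    have : (n : ℝ) < 0 := by rw [hn] at h; linarith
    have : n < 0 := by exact_mod_cast this
    obtain rfl : n = -1 := by omega
    rw [hn, nb] at r1
    convert r1 using 1; norm_num
  · obtain ⟨n, hn, l, u⟩ := H.kls ha hb na nb
    have : (n : ℝ) < 0 := by rw [hn] at h; linarith
    have : n < 0 := by exact_mod_cast this
    obtain rfl : n = -1 := by omega
    rw [hn, na] at r2
    convert r2 using 1; norm_num; abel
  · obtain ⟨n, hn, l, u, e, e'⟩ := H.kll ha hb na nb
    have : (n : ℝ) < 0 := by rw [hn] at h; linarith
    have : n < 0 := by exact_mod_cast this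
    have : n ≠ -2 := fun h => hne (e' h)
    obtain rfl : n = -1 := by omega
    rw [hn, nb] at r1
    convert r1 using 1; norm_num

lemma sub_mem (H : KForm Φ K) {α β : V} (ha : α ∈ Φ) (hb : β ∈ Φ) (h : 0 < K α β) (h0 : α ≠ β) :
    α - β ∈ Φ := by
  rw [sub_eq_add_neg]
  refine H.add_mem ha (H.neg_mem hb) ?_ ?_
  · simpa using h
  · rw [← sub_eq_add_neg]; exact sub_ne_zero.2 h0

/-- reflection of a long root in a short one with positive pairing -/
lemma sub_two_mem (H : KForm Φ K) {α β : V} (ha : α ∈ Φ) (hb : β ∈ Φ) (nb : K β β = 2) (h : K α β = 2) :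
    α - (2:ℝ) • β ∈ Φ := by
  have := H.refl α ha β hb
  rw [h, nb] at this
  convert this using 3; norm_num

lemma add_two_mem (H : KForm Φ K) {α β : V} (ha : α ∈ Φ) (hb : β ∈ Φ) (nb : K β β = 2) (h : K α β = -2) :
    α + (2:ℝ) • β ∈ Φ := by
  have := H.refl α ha β hb
  rw [h, nb] at this
  convert this using 1; norm_num

end KForm

/-- A sign pattern: `Ψ` plays the role of the biconvex set and `C` of its complement. -/
structure Sgn (Φ : Set V) (K : V →ₗ[ℝ] V →ₗ[ℝ] ℝ) (Ψ C : Set V) : Prop where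
  psub : Ψ ⊆ Φ
  cover : ∀ r ∈ Φ, r ∈ Ψ ∨ -r ∈ Ψ ∨ r ∈ C ∨ -r ∈ C
  cc : ∀ x ∈ C, ∀ y ∈ C, x + y ∈ Φ → x + y ∈ C
  pc : ∀ x ∈ Ψ, ∀ y ∈ C, x + y ∈ Φ → x + y ∈ Ψ ∨ x + y ∈ C
  pc' : ∀ x ∈ Ψ, ∀ y, -y ∈ C → x + y ∈ Φ → x + y ∈ Ψ ∨ -(x + y) ∈ C
  d1 : ∀ x ∈ Ψ, x ∉ C
  d2 : ∀ x ∈ Ψ, -x ∉ C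
  d3 : ∀ x ∈ C, -x ∉ C
  nn : ∀ x ∈ Ψ, ∀ y ∈ Ψ, 0 ≤ K x y

namespace Sgn

variable {Φ : Set V} {K : V →ₗ[ℝ] V →ₗ[ℝ] ℝ} {Ψ C : Set V}

lemma dual (H : KForm Φ K) (S : Sgn Φ K Ψ C) : Sgn Φ K Ψ {x | -x ∈ C} where
  psub := S.psub
  cover r hr := by
    rcases S.cover r hr with h | h | h | h
    · exact Or.inl h
    · exact Or.inr (Or.inl h)
    · exact Or.inr (Or.inr (Or.inr (by simpa using h)))
    · exact Or.inr (Or.inr (Or.inl h))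
  cc x hx y hy h := by
    have := S.cc _ hx _ hy (by rw [← neg_add]; exact H.neg_mem h)
    change -(x + y) ∈ C
    rwa [neg_add]
  pc x hx y hy h := S.pc' x hx y hy h
  pc' x hx y hy h := by
    have := S.pc x hx y (by simpa using hy) h
    simpa using this
  d1 x hx := S.d2 x hx
  d2 x hx := by simpa using S.d1 x hx
  d3 x hx h := S.d3 _ hx h
  nn := S.nn

lemma excl1_aux (H : KForm Φ K) (S : Sgn Φ K Ψ C) {ε p l q r : V} (hε : ε ∈ Φ)
    (hp : p ∈ Ψ) (hl : l ∈ Ψ) (hq : q ∈ Ψ) (hr : r ∈ Ψ) (hs : (2:ℝ) • ε = p + l + q + r)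
    (hlp : K l p = 0) (hlq : K l q = 0) (hlr : K l r = 0) (hpq : K p q = 0) (hpr : K p r = 0)
    (hC : l - ε ∈ C) : False := by
  have nε : ∀ x : V, 2 * K ε x = K p x + K l x + K q x + K r x := by
    intro x
    have := congrArg (fun v => K v x) hs
    simpa only [map_smul, LinearMap.smul_apply, map_add, LinearMap.add_apply, smul_eq_mul]
      using this
  have pos : ∀ x ∈ Ψ, 0 < K x x := fun x hx => by
    rcases H.norm x (S.psub hx) with h | h <;> rw [h] <;> norm_num
  have ep := nε p
  have el := nε l
  have eq := nε q
  have er := nε r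
  rw [hlp, H.symm q p, hpq, H.symm r p, hpr] at ep
  rw [H.symm p l, hlp, H.symm q l, hlq, H.symm r l, hlr] at el
  rw [hpq, hlq, H.symm r q] at eq
  rw [hpr, hlr] at er
  have pp := pos p hp
  have pl := pos l hl
  have pq := pos q hq
  have pr := pos r hr
  have qr := S.nn q hq r hr
  have hlε : l ∈ Φ := S.psub hl
  have hlεΦ : l - ε ∈ Φ := by
    refine H.sub_mem hlε hε (by rw [H.symm]; linarith) ?_
    rintro rfl; linarith
  -- μ_x = x + (l - ε)
  have mu : ∀ x ∈ Ψ, 0 < K ε x → K l x = 0 → x + (l - ε) ∈ Φ := by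
    intro x hx h1 h2
    refine H.add_mem (S.psub hx) hlεΦ ?_ ?_
    · rw [H.symm]; simp only [map_sub, LinearMap.sub_apply]; linarith
    · intro h0
      have h3 := congrArg (fun v => K v l) h0
      simp only [map_add, map_sub, LinearMap.add_apply, LinearMap.sub_apply, map_zero,
        LinearMap.zero_apply] at h3
      rw [H.symm x l, h2] at h3
      linarith
  have mup : p + (l - ε) ∈ C := by
    rcases S.pc p hp _ hC (mu p hp (by linarith) hlp) with h | h
    · exfalso
      have := S.nn _ h q hq
      simp only [map_add, map_sub, LinearMap.add_apply, LinearMap.sub_apply] at this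
      linarith
    · exact h
  have mur : r + (l - ε) ∈ C := by
    rcases S.pc r hr _ hC (mu r hr (by linarith) hlr) with h | h
    · exfalso
      have := S.nn _ h p hp
      simp only [map_add, map_sub, LinearMap.add_apply, LinearMap.sub_apply] at this
      rw [H.symm r p] at this
      linarith
    · exact h
  have e1 : q + (r + (l - ε)) = ε - p := by
    have : q + (r + (l - ε)) = (p + l + q + r) - p - ε := by abel
    rw [this, ← hs, two_smul]; abel
  have hβ : ε - p ∈ Φ := H.sub_mem hε (S.psub hp) (by linarith) (by
    rintro rfl; linarith)
  rcases S.pc q hq _ mur (by rw [e1]; exact hβ) with h | h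
  · rw [e1] at h
    have := S.nn _ h p hp
    simp only [map_sub, LinearMap.sub_apply] at this
    linarith
  · rw [e1] at h
    have h2 := S.cc _ mup _ h (by convert hlε using 1; abel)
    have e3 : p + (l - ε) + (ε - p) = l := by abel
    rw [e3] at h2
    exact S.d1 l hl h2

lemma excl1 (H : KForm Φ K) (S : Sgn Φ K Ψ C) {ε p l q r : V} (hε : ε ∈ Φ)
    (hp : p ∈ Ψ) (hl : l ∈ Ψ) (hq : q ∈ Ψ) (hr : r ∈ Ψ) (hs : (2:ℝ) • ε = p + l + q + r)
    (hlp : K l p = 0) (hlq : K l q = 0) (hlr : K l r = 0) (hpq : K p q = 0) (hpr : K p r = 0) :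
    False := by
  have nε : ∀ x : V, 2 * K ε x = K p x + K l x + K q x + K r x := by
    intro x
    have := congrArg (fun v => K v x) hs
    simpa only [map_smul, LinearMap.smul_apply, map_add, LinearMap.add_apply, smul_eq_mul]
      using this
  have pos : ∀ x ∈ Ψ, 0 < K x x := fun x hx => by
    rcases H.norm x (S.psub hx) with h | h <;> rw [h] <;> norm_num
  have ep := nε p
  have el := nε l
  rw [hlp, H.symm q p, hpq, H.symm r p, hpr] at ep
  rw [H.symm p l, hlp, H.symm q l, hlq, H.symm r l, hlr] at el
  have pp := pos p hp
  have pl := pos l hl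
  have hlε : l ∈ Φ := S.psub hl
  have hlεΦ : l - ε ∈ Φ := by
    refine H.sub_mem hlε hε (by rw [H.symm]; linarith) ?_
    rintro rfl; linarith
  rcases S.cover _ hlεΦ with h | h | h | h
  · have := S.nn _ h p hp
    simp only [map_sub, LinearMap.sub_apply] at this
    linarith
  · have := S.nn _ h l hl
    simp only [map_sub, LinearMap.sub_apply, map_neg, LinearMap.neg_apply] at this
    linarith
  · exact excl1_aux H S hε hp hl hq hr hs hlp hlq hlr hpq hpr h
  · exact excl1_aux H (S.dual H) hε hp hl hq hr hs hlp hlq hlr hpq hpr h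

lemma excl3_aux2 (H : KForm Φ K) (S : Sgn Φ K Ψ C) {ε l a b c : V} (hε : ε ∈ Φ)
    (hl : l ∈ Ψ) (ha : a ∈ Ψ) (hb : b ∈ Ψ) (hc : c ∈ Ψ) (hs : (2:ℝ) • ε = a + b + c + l)
    (nl : K l l = 4) (na : K a a = 2) (nb : K b b = 2) (nc : K c c = 2)
    (hla : K l a = 0) (hlb : K l b = 0) (hlc : K l c = 0)
    (hab : K a b = 1) (hac : K a c = 1) (hbc : K b c = 1)
    (hC : l - ε ∈ C) : a - c ∈ C := by
  have nε : ∀ x : V, 2 * K ε x = K a x + K b x + K c x + K l x := by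
    intro x
    have := congrArg (fun v => K v x) hs
    simpa only [map_smul, LinearMap.smul_apply, map_add, LinearMap.add_apply, smul_eq_mul]
      using this
  have hba : K b a = 1 := by rw [H.symm]; exact hab
  have hca : K c a = 1 := by rw [H.symm]; exact hac
  have hcb : K c b = 1 := by rw [H.symm]; exact hbc
  have hal : K a l = 0 := by rw [H.symm]; exact hla
  have hbl : K b l = 0 := by rw [H.symm]; exact hlb
  have hcl : K c l = 0 := by rw [H.symm]; exact hlc
  have ea : K ε a = 2 := by have := nε a; linarith
  have eb : K ε b = 2 := by have := nε b; linarith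
  have ec : K ε c = 2 := by have := nε c; linarith
  have el : K ε l = 2 := by have := nε l; linarith
  have ae : K a ε = 2 := by rw [H.symm]; exact ea
  have be : K b ε = 2 := by rw [H.symm]; exact eb
  have ce : K c ε = 2 := by rw [H.symm]; exact ec
  have le : K l ε = 2 := by rw [H.symm]; exact el
  have ee : K ε ε = 4 := by have := nε ε; linarith
  have haΦ := S.psub ha
  have hbΦ := S.psub hb
  have hcΦ := S.psub hc
  have hlΦ := S.psub hl
  have hlεΦ : l - ε ∈ Φ := by
    refine H.sub_mem hlΦ hε (by linarith) ?_
    rintro rfl; linarith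
  have mu : ∀ x ∈ Ψ, K x x = 2 → K ε x = 2 → K l x = 0 → x + (l - ε) ∈ Φ := by
    intro x hx h0 h1 h2
    refine H.add_mem (S.psub hx) hlεΦ ?_ ?_
    · rw [H.symm]; simp only [map_sub, LinearMap.sub_apply]; linarith
    · intro h0
      have h3 := congrArg (fun v => K v l) h0
      simp only [map_add, map_sub, LinearMap.add_apply, LinearMap.sub_apply, map_zero,
        LinearMap.zero_apply] at h3
      rw [H.symm x l, h2] at h3
      linarith
  have mua : a + (l - ε) ∈ C := by
    rcases S.pc a ha _ hC (mu a ha na ea hla) with h | h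
    · exfalso
      have := S.nn _ h b hb
      simp only [map_add, map_sub, LinearMap.add_apply, LinearMap.sub_apply] at this
      linarith
    · exact h
  have mub : b + (l - ε) ∈ C := by
    rcases S.pc b hb _ hC (mu b hb nb eb hlb) with h | h
    · exfalso
      have := S.nn _ h a ha
      simp only [map_add, map_sub, LinearMap.add_apply, LinearMap.sub_apply] at this
      linarith
    · exact h
  have muc : c + (l - ε) ∈ C := by
    rcases S.pc c hc _ hC (mu c hc nc ec hlc) with h | h
    · exfalso
      have := S.nn _ h a ha
      simp only [map_add, map_sub, LinearMap.add_apply, LinearMap.sub_apply] at this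
      linarith
    · exact h
  have hβΦ : ε - a ∈ Φ := H.sub_mem hε haΦ (by linarith) (by rintro rfl; linarith)
  have hβ : ε - a ∈ Ψ := by
    have e1 : b + (c + (l - ε)) = ε - a := by
      have : b + (c + (l - ε)) = (a + b + c + l) - a - ε := by abel
      rw [this, ← hs, two_smul]; abel
    rcases S.pc b hb _ muc (by rw [e1]; exact hβΦ) with h | h
    · rwa [e1] at h
    · rw [e1] at h
      have h2 := S.cc _ mua _ h (by convert hlΦ using 1; abel)
      have e3 : a + (l - ε) + (ε - a) = l := by abel
      rw [e3] at h2
      exact absurd h2 (S.d1 l hl)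
  have hacΦ : a - c ∈ Φ := H.sub_mem haΦ hcΦ (by linarith) (by rintro rfl; linarith)
  -- the key root `2a + l - ε`
  have hkΦ : a + (a + (l - ε)) ∈ Φ := by
    have := H.add_two_mem hlεΦ haΦ na (by
      simp only [map_sub, LinearMap.sub_apply]; linarith)
    convert this using 1; rw [two_smul]; abel
  rcases S.pc a ha _ mua hkΦ with hk | hk
  · -- it lies in Ψ
    have hρ : l - (2:ℝ) • (ε - a) ∈ Φ := by
      refine H.sub_two_mem hlΦ hβΦ ?_ ?_
      · simp only [map_sub, LinearMap.sub_apply]; linarith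
      · simp only [map_sub]; linarith
    have hρC : l - (2:ℝ) • (ε - a) ∈ C := by
      rcases S.cover _ hρ with h | h | h | h
      · have := S.nn _ h _ hβ
        simp only [map_sub, map_smul, LinearMap.sub_apply, LinearMap.smul_apply,
          smul_eq_mul] at this
        linarith
      · have := S.nn _ h _ hk
        simp only [map_sub, map_smul, LinearMap.sub_apply, LinearMap.smul_apply,
          smul_eq_mul, map_neg, LinearMap.neg_apply, map_add] at this
        linarith
      · exact h
      · exfalso
        have e : -(l - (2:ℝ) • (ε - a)) + (a + (l - ε)) = ε - a := by
          rw [two_smul]; abel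
        have := S.cc _ h _ mua (by rw [e]; exact hβΦ)
        rw [e] at this
        exact S.d1 _ hβ this
    have e : b + (l - (2:ℝ) • (ε - a)) = a - c := by
      rw [smul_sub, hs, two_smul]; abel
    rcases S.pc b hb _ hρC (by rw [e]; exact hacΦ) with h | h
    · rw [e] at h
      have := S.nn _ h c hc
      simp only [map_sub, LinearMap.sub_apply] at this
      linarith
    · rwa [e] at h
  · have hσ : ε - (2:ℝ) • a ∈ Φ := H.sub_two_mem hε haΦ na ea
    have hσC : -(ε - (2:ℝ) • a) ∈ C := by
      rcases S.cover _ hσ with h | h | h | h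
      · have := S.nn _ h _ ha
        simp only [map_sub, map_smul, LinearMap.sub_apply, LinearMap.smul_apply,
          smul_eq_mul] at this
        linarith
      · have := S.nn _ h _ hl
        simp only [map_sub, map_smul, LinearMap.sub_apply, LinearMap.smul_apply,
          smul_eq_mul, map_neg, LinearMap.neg_apply, map_add] at this
        linarith
      · exfalso
        have e : ε - (2:ℝ) • a + (a + (a + (l - ε))) = l := by
          rw [two_smul]; abel
        have := S.cc _ h _ hk (by rw [e]; exact hlΦ)
        rw [e] at this
        exact S.d1 _ hl this
      · exact h
    have e : -(ε - (2:ℝ) • a) + (b + (l - ε)) = a - c := by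
      have : -(ε - (2:ℝ) • a) + (b + (l - ε)) = (2:ℝ) • a + b + l - (2:ℝ) • ε := by
        rw [two_smul, two_smul]; abel
      rw [this, hs, two_smul]; abel
    have := S.cc _ hσC _ mub (by rw [e]; exact hacΦ)
    rwa [e] at this

lemma excl3_aux (H : KForm Φ K) (S : Sgn Φ K Ψ C) {ε l a b c : V} (hε : ε ∈ Φ)
    (hl : l ∈ Ψ) (ha : a ∈ Ψ) (hb : b ∈ Ψ) (hc : c ∈ Ψ) (hs : (2:ℝ) • ε = a + b + c + l)
    (nl : K l l = 4) (na : K a a = 2) (nb : K b b = 2) (nc : K c c = 2)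
    (hla : K l a = 0) (hlb : K l b = 0) (hlc : K l c = 0)
    (hab : K a b = 1) (hac : K a c = 1) (hbc : K b c = 1)
    (hC : l - ε ∈ C) : False := by
  have h1 := excl3_aux2 H S hε hl ha hb hc hs nl na nb nc hla hlb hlc hab hac hbc hC
  have h2 := excl3_aux2 H S hε hl hc hb ha (by rw [hs]; abel) nl nc nb na hlc hlb hla
    (by rw [H.symm]; exact hbc) (by rw [H.symm]; exact hac) (by rw [H.symm]; exact hab) hC
  exact S.d3 _ h1 (by rwa [neg_sub])

lemma excl3 (H : KForm Φ K) (S : Sgn Φ K Ψ C) {ε l a b c : V} (hε : ε ∈ Φ)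
    (hl : l ∈ Ψ) (ha : a ∈ Ψ) (hb : b ∈ Ψ) (hc : c ∈ Ψ) (hs : (2:ℝ) • ε = a + b + c + l)
    (nl : K l l = 4) (na : K a a = 2) (nb : K b b = 2) (nc : K c c = 2)
    (hla : K l a = 0) (hlb : K l b = 0) (hlc : K l c = 0)
    (hab : K a b = 1) (hac : K a c = 1) (hbc : K b c = 1) : False := by
  have nε : ∀ x : V, 2 * K ε x = K a x + K b x + K c x + K l x := by
    intro x
    have := congrArg (fun v => K v x) hs
    simpa only [map_smul, LinearMap.smul_apply, map_add, LinearMap.add_apply, smul_eq_mul]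
      using this
  have hba : K b a = 1 := by rw [H.symm]; exact hab
  have hca : K c a = 1 := by rw [H.symm]; exact hac
  have hal : K a l = 0 := by rw [H.symm]; exact hla
  have hbl : K b l = 0 := by rw [H.symm]; exact hlb
  have hcl : K c l = 0 := by rw [H.symm]; exact hlc
  have ea : K ε a = 2 := by have := nε a; linarith
  have el : K ε l = 2 := by have := nε l; linarith
  have hlεΦ : l - ε ∈ Φ := by
    refine H.sub_mem (S.psub hl) hε (by rw [H.symm]; linarith) ?_
    rintro rfl; linarith
  rcases S.cover _ hlεΦ with h | h | h | h
  · have := S.nn _ h a ha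
    simp only [map_sub, LinearMap.sub_apply] at this
    linarith
  · have := S.nn _ h l hl
    simp only [map_sub, LinearMap.sub_apply, map_neg, LinearMap.neg_apply] at this
    linarith
  · exact excl3_aux H S hε hl ha hb hc hs nl na nb nc hla hlb hlc hab hac hbc h
  · exact excl3_aux H (S.dual H) hε hl ha hb hc hs nl na nb nc hla hlb hlc hab hac hbc h

end Sgn

end BSP

namespace BSP

lemma refl_mem' (D : RootSystemData V) {α β : V} (ha : α ∈ D.roots) (hb : β ∈ D.roots) :
    α - (2 * ⟪α, β⟫ / ⟪β, β⟫) • β ∈ D.roots := by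
  have h := D.reflect_mem α ha β hb
  have e : reflEnd β α = α - (2 * ⟪α, β⟫ / ⟪β, β⟫) • β := by
    simp only [reflEnd, LinearMap.sub_apply, LinearMap.id_apply, LinearMap.comp_apply,
      LinearMap.smul_apply, LinearMap.toSpanSingleton_apply, ContinuousLinearMap.coe_coe,
      innerSL_apply_apply, smul_eq_mul]
    rw [real_inner_comm α β]
    congr 2; ring
  rwa [e] at h

lemma norm_pos (D : RootSystemData V) {α : V} (ha : α ∈ D.roots) : 0 < ⟪α, α⟫ :=
  real_inner_self_pos.2 (D.ne_zero α ha)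

lemma refl_norm (D : RootSystemData V) {α β : V} (hb : β ∈ D.roots) :
    ⟪α - (2 * ⟪α, β⟫ / ⟪β, β⟫) • β, α - (2 * ⟪α, β⟫ / ⟪β, β⟫) • β⟫ = ⟪α, α⟫ := by
  have h := norm_pos D hb
  simp only [inner_sub_left, inner_sub_right, inner_smul_left, inner_smul_right,
    RCLike.conj_to_real]
  rw [real_inner_comm α β]
  field_simp
  ring

lemma exists_nonorth (D : RootSystemData V) (hirr : D.IsIrreducible) {γ₀ : V}
    (h0 : γ₀ ∈ D.roots) {β : V} (hβ : β ∈ D.roots) :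
    ∃ γ ∈ D.roots, ⟪γ, γ⟫ = ⟪γ₀, γ₀⟫ ∧ ⟪γ, β⟫ ≠ 0 := by
  set s : Set V := {γ | γ ∈ D.roots ∧ ⟪γ, γ⟫ = ⟪γ₀, γ₀⟫} with hs
  set U := Submodule.span ℝ s with hU
  have orth : ∀ β : V, (∀ γ ∈ s, ⟪γ, β⟫ = 0) → ∀ u ∈ U, ⟪u, β⟫ = 0 := by
    intro β h u hu
    induction hu using Submodule.span_induction with
    | mem x hx => exact h x hx
    | zero => simp
    | add x y _ _ hx hy => rw [inner_add_left, hx, hy, add_zero]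
    | smul a x _ hx => rw [inner_smul_left, hx, mul_zero]
  have h1 : ∀ β ∈ D.roots, β ∉ U → ∀ γ ∈ s, ⟪γ, β⟫ = 0 := by
    intro β hβ hβU γ hγ
    by_contra hne
    apply hβU
    have hm : γ - (2 * ⟪γ, β⟫ / ⟪β, β⟫) • β ∈ s :=
      ⟨refl_mem' D hγ.1 hβ, by rw [refl_norm D hβ]; exact hγ.2⟩
    have h2 : (2 * ⟪γ, β⟫ / ⟪β, β⟫) • β ∈ U := by
      have := U.sub_mem (Submodule.subset_span hγ) (Submodule.subset_span hm)
      simpa using this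
    have hc : (2 * ⟪γ, β⟫ / ⟪β, β⟫) ≠ 0 :=
      div_ne_zero (mul_ne_zero two_ne_zero hne) (norm_pos D hβ).ne'
    exact (U.smul_mem_iff hc).1 h2
  have hall : {β | β ∈ D.roots ∧ β ∈ U} = D.roots := by
    rcases hirr.2 {β | β ∈ D.roots ∧ β ∈ U} (fun x hx => hx.1) (by
      intro α hα β hβ
      have hβU : β ∉ U := fun h => hβ.2 ⟨hβ.1, h⟩
      exact orth β (h1 β hβ.1 hβU) α hα.2) with h | h
    · exfalso
      have : γ₀ ∈ ({β | β ∈ D.roots ∧ β ∈ U} : Set V) :=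
        ⟨h0, Submodule.subset_span ⟨h0, rfl⟩⟩
      rw [h] at this
      exact this
    · exact h
  have hβU : β ∈ U := by
    have : β ∈ ({β | β ∈ D.roots ∧ β ∈ U} : Set V) := by rw [hall]; exact hβ
    exact this.2
  by_contra hcon
  push Not at hcon
  have := orth β (fun γ hγ => hcon γ hγ.1 hγ.2) β hβU
  exact (norm_pos D hβ).ne' this

lemma norm_cases (D : RootSystemData V) (hG2 : D.NotG2) {γ β : V}
    (hγ : γ ∈ D.roots) (hβ : β ∈ D.roots) (hmin : ⟪γ, γ⟫ ≤ ⟪β, β⟫) (hne : ⟪γ, β⟫ ≠ 0) :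
    ⟪β, β⟫ = ⟪γ, γ⟫ ∨ ⟪β, β⟫ = 2 * ⟪γ, γ⟫ := by
  obtain ⟨m, hm⟩ := D.crystallographic γ hγ β hβ
  obtain ⟨n, hn⟩ := D.crystallographic β hβ γ hγ
  have g1 := hG2 β hβ γ hγ
  rw [hn] at g1
  have g3 : n ≠ 3 := by rintro rfl; exact g1.1 (by norm_num)
  have g3' : n ≠ -3 := by rintro rfl; exact g1.2 (by norm_num)
  have pγ := norm_pos D hγ
  have pβ := norm_pos D hβ
  unfold cpair at hm hn
  rw [real_inner_comm] at hn
  rw [div_eq_iff pβ.ne'] at hm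
  rw [div_eq_iff pγ.ne'] at hn
  have cs := real_inner_mul_inner_self_le γ β
  set N := ⟪γ, γ⟫
  set M := ⟪β, β⟫
  set I := ⟪γ, β⟫
  have e1 : (m * n : ℝ) * (N * M) = 4 * (I * I) := by
    have : (m * n : ℝ) * (N * M) = (m * M) * (n * N) := by ring
    rw [this, ← hm, ← hn]; ring
  have NM : 0 < N * M := mul_pos pγ pβ
  have i1 : (m * n : ℝ) ≤ 4 := by
    by_contra h
    push Not at h
    nlinarith
  have i2 : (0 : ℝ) < m * n := by
    have : 0 < I * I := mul_self_pos.2 hne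
    by_contra h
    push Not at h
    nlinarith
  have i3 : (m * m : ℝ) ≤ m * n := by
    -- m M = n N
    have e : (m : ℝ) * M = n * N := by rw [← hm, ← hn]
    have : (m * m : ℝ) * N ≤ (m * n) * N := by
      have : (m * n : ℝ) * N = m * m * M := by rw [mul_assoc, ← e]; ring
      rw [this]
      exact mul_le_mul_of_nonneg_left hmin (mul_self_nonneg _)
    exact le_of_mul_le_mul_right this pγ
  have j1 : m * n ≤ 4 := by exact_mod_cast i1
  have j2 : 0 < m * n := by exact_mod_cast i2
  have j3 : m * m ≤ m * n := by exact_mod_cast i3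
  have mb : -2 ≤ m ∧ m ≤ 2 := by constructor <;> nlinarith
  have fin : N = M ∨ M = 2 * N ∨ M = 4 * N := by
    have e : (m : ℝ) * M = n * N := by rw [← hm, ← hn]
    obtain ⟨mb1, mb2⟩ := mb
    have nb : -4 ≤ n ∧ n ≤ 4 := by
      interval_cases m <;> omega
    obtain ⟨nb1, nb2⟩ := nb
    interval_cases m <;> interval_cases n <;> first
      | omega
      | (left; push_cast at e; linarith)
      | (right; left; push_cast at e; linarith)
      | (right; right; push_cast at e; linarith)
  rcases fin with h | h | h
  · left; exact h.symm
  · right; exact h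
  · exfalso
    -- I = ± 2 N
    have hI : I * I = N * M := by
      have e : (m : ℝ) * M = n * N := by rw [← hm, ← hn]
      rw [h] at e
      have : (n : ℝ) = 4 * m := by
        have : ((n : ℝ) - 4 * m) * N = 0 := by linarith
        rcases mul_eq_zero.1 this with h | h
        · linarith
        · exact absurd h pγ.ne'
      have hmm : m * m = 1 := by
        have : n = 4 * m := by exact_mod_cast this
        subst this
        nlinarith
      have hmm' : (m * m : ℝ) = 1 := by exact_mod_cast hmm
      rw [this] at e1
      nlinarith
    have hz : ∀ t : ℝ, I = t * N → t * t = 4 → False := by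
      intro t ht htt
      have : ⟪β - t • γ, β - t • γ⟫ = 0 := by
        simp only [inner_sub_left, inner_sub_right, inner_smul_left, inner_smul_right,
          RCLike.conj_to_real]
        rw [real_inner_comm γ β]
        change M - t * I - t * (I - t * N) = 0
        rw [h, ht]
        linear_combination (-N) * htt
      have : β = t • γ := sub_eq_zero.1 (inner_self_eq_zero.1 this)
      rcases D.reduced γ hγ t (this ▸ hβ) with h | h <;> rw [h] at htt <;> norm_num at htt
    have : (I - 2 * N) * (I + 2 * N) = 0 := by rw [h] at hI; linarith
    rcases mul_eq_zero.1 this with h | h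
    · exact hz 2 (by linarith) (by norm_num)
    · exact hz (-2) (by linarith) (by norm_num)

theorem exists_kform (D : RootSystemData V) (hirr : D.IsIrreducible) (hG2 : D.NotG2) :
    ∃ K : V →ₗ[ℝ] V →ₗ[ℝ] ℝ, KForm D.roots K ∧ ∃ c : ℝ, 0 < c ∧ ∀ x y, K x y = c * ⟪x, y⟫ := by
  obtain ⟨γ₀, h0, hmin⟩ := Set.exists_min_image D.roots (fun x => ⟪x, x⟫) D.finite hirr.1
  have pN := norm_pos D h0
  set N := ⟪γ₀, γ₀⟫ with hN
  have hnorm : ∀ β ∈ D.roots, ⟪β, β⟫ = N ∨ ⟪β, β⟫ = 2 * N := by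
    intro β hβ
    obtain ⟨γ, hγ, hγN, hne⟩ := exists_nonorth D hirr h0 hβ
    have := norm_cases D hG2 hγ hβ (by rw [hγN]; exact hmin β hβ) hne
    rwa [hγN] at this
  have hK : ∀ x y, ((2 / N) • innerₗ V) x y = (2 / N) * ⟪x, y⟫ := by
    intro x y; simp
  refine ⟨(2 / N) • innerₗ V, ?_, 2 / N, by positivity, hK⟩
  constructor
  · intro x y; rw [hK, hK, real_inner_comm]
  · intro x; rw [hK]; exact mul_nonneg (by positivity) real_inner_self_nonneg
  · intro x h; rw [hK] at h
    rcases mul_eq_zero.1 h with h | h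
    · exact absurd h (by positivity)
    · exact inner_self_eq_zero.1 h
  · intro α ha
    rw [hK]
    rcases hnorm α ha with h | h <;> rw [h]
    · left; field_simp
    · right; field_simp; norm_num
  · intro α ha β hb
    rw [hK]
    obtain ⟨n, hn⟩ := D.crystallographic α ha β hb
    unfold cpair at hn
    rcases hnorm β hb with h | h <;> rw [h] at hn
    · refine ⟨n, ?_⟩; rw [← hn]; field_simp
    · refine ⟨2 * n, ?_⟩; push_cast; rw [← hn]; field_simp
  · intro α ha β hb h4
    rw [hK] at h4 ⊢
    obtain ⟨n, hn⟩ := D.crystallographic α ha β hb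
    unfold cpair at hn
    rcases hnorm β hb with h | h <;> rw [h] at hn h4
    · exfalso; field_simp at h4; norm_num at h4
    · refine ⟨n, ?_⟩; rw [← hn]; field_simp
  · intro α ha β hb
    rw [hK, hK]
    have := refl_mem' D ha hb
    convert this using 3
    have := norm_pos D hb
    field_simp

lemma sgn_of_biconvex (D : RootSystemData V) {K : V →ₗ[ℝ] V →ₗ[ℝ] ℝ} (H : KForm D.roots K)
    {Ψ : Set V} (hΨ : D.Biconvex Ψ) (nn : ∀ x ∈ Ψ, ∀ y ∈ Ψ, 0 ≤ K x y) :
    Sgn D.roots K Ψ (D.pos \ Ψ) := by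
  obtain ⟨hsub, c1, c2⟩ := hΨ
  have neg_or : ∀ r ∈ D.roots, r ∈ D.pos ∨ -r ∈ D.pos := by
    intro r hr
    by_cases h : r ∈ D.pos
    · exact Or.inl h
    · right; by_contra h'; exact h ((D.pos_iff r hr).2 h')
  have nb : ∀ r ∈ D.pos, -r ∉ D.pos := fun r hr => (D.pos_iff r (D.pos_subset hr)).1 hr
  have conv : ∀ S, D.ConvexSubset S → ∀ x ∈ S, ∀ y ∈ S, x + y ∈ D.roots → x + y ∈ S := by
    intro S hS x hx y hy h
    have := hS x hx y hy 1 1 one_pos one_pos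
    rw [one_smul, one_smul] at this
    exact this h
  refine ⟨hsub.trans D.pos_subset, ?_, conv _ c2, ?_, ?_, ?_, ?_, ?_, nn⟩
  · intro r hr
    by_cases h1 : r ∈ Ψ
    · exact Or.inl h1
    by_cases h2 : -r ∈ Ψ
    · exact Or.inr (Or.inl h2)
    rcases neg_or r hr with h | h
    · exact Or.inr (Or.inr (Or.inl ⟨h, h1⟩))
    · exact Or.inr (Or.inr (Or.inr ⟨h, h2⟩))
  · intro x hx y hy h
    have hp := D.pos_add x (hsub hx) y hy.1 h
    by_cases h1 : x + y ∈ Ψ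
    · exact Or.inl h1
    · exact Or.inr ⟨hp, h1⟩
  · intro x hx y hy h
    have ex : x = (x + y) + -y := by abel
    have ey : -y = x + -(x + y) := by abel
    have hx' := D.pos_subset (hsub hx)
    by_cases h1 : x + y ∈ Ψ
    · exact Or.inl h1
    rcases neg_or _ h with h2 | h2
    · exfalso
      have := conv _ c2 (x + y) ⟨h2, h1⟩ (-y) hy (by rw [← ex]; exact hx')
      rw [← ex] at this
      exact this.2 hx
    · right
      refine ⟨h2, fun h3 => ?_⟩
      have := conv _ c1 x hx _ h3 (by rw [← ey]; exact D.pos_subset hy.1)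
      rw [← ey] at this
      exact hy.2 this
  · intro x hx h; exact h.2 hx
  · intro x hx h; exact nb x (hsub hx) h.1
  · intro x hx h; exact nb x hx.1 h.1

end BSP

namespace BSP

section Lie

variable {L : Type*} [LieRing L] [LieAlgebra ℂ L] (D : LieRootData V L)
  {K : V →ₗ[ℝ] V →ₗ[ℝ] ℝ}

lemma rs_exists {α : V} (h : α ∈ D.roots) : ∃ x ∈ D.rs α, x ≠ 0 := by
  have h1 := D.rs_dim α h
  obtain ⟨v, hv, -⟩ := finrank_eq_one_iff'.1 h1
  exact ⟨v, v.2, fun h => hv (Subtype.ext h)⟩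

lemma rs_mul {α : V} (h : α ∈ D.roots) {x y : L} (hx : x ∈ D.rs α) (hx0 : x ≠ 0)
    (hy : y ∈ D.rs α) : ∃ c : ℂ, y = c • x := by
  have h1 := D.rs_dim α h
  have := (finrank_eq_one_iff_of_nonzero' (⟨x, hx⟩ : D.rs α)
    (fun h => hx0 (congrArg Subtype.val h))).1 h1 ⟨y, hy⟩
  obtain ⟨c, hc⟩ := this
  exact ⟨c, (congrArg Subtype.val hc).symm⟩

lemma bm {a b c : V} (ha : a ∈ D.roots) (hb : b ∈ D.roots) (hc : c ∈ D.roots) (e : a + b = c)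
    {x y : L} (hx : x ∈ D.rs a) (hy : y ∈ D.rs b) : ⁅x, y⁆ ∈ D.rs c := by
  subst e; exact D.bracket_mem a ha b hb hc x hx y hy

lemma bn {a b c : V} (ha : a ∈ D.roots) (hb : b ∈ D.roots) (hc : c ∈ D.roots) (e : a + b = c)
    {x y : L} (hx : x ∈ D.rs a) (hy : y ∈ D.rs b) (hx0 : x ≠ 0) (hy0 : y ≠ 0) : ⁅x, y⁆ ≠ 0 := by
  subst e; exact D.bracket_ne_zero a ha b hb hc x hx hx0 y hy hy0

lemma bz (H : KForm D.roots K) {a b : V} (ha : a ∈ D.roots) (hb : b ∈ D.roots)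
    (h : 4 < K a a + K b b + 2 * K a b)
    {x y : L} (hx : x ∈ D.rs a) (hy : y ∈ D.rs b) : ⁅x, y⁆ = 0 := by
  rw [← H.add_add] at h
  exact D.bracket_eq_zero a ha b hb (H.not_mem_of_gt h) (H.ne_zero_of_gt h) x hx y hy

/-- the sl2-type relation -/
lemma lemSL (H : KForm D.roots K) {a b : V} (ha : a ∈ D.roots) (hb : b ∈ D.roots)
    (hab : a + b ∈ D.roots) (n1 : 4 < K a a + K b b - 2 * K a b)
    (n2 : 4 < K a a + 4 * K b b + 4 * K a b)
    {x y u : L} (hx : x ∈ D.rs a) (hy : y ∈ D.rs b) (hu : u ∈ D.rs (-b))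
    (hx0 : x ≠ 0) (hy0 : y ≠ 0) (hu0 : u ≠ 0) :
    ∃ s : ℂ, s ≠ 0 ∧ ⁅⁅y, u⁆, x⁆ = s • x ∧ ⁅⁅y, u⁆, y⁆ = (-2 * s) • y := by
  have hh : ⁅y, u⁆ ∈ D.cartan := D.bracket_cartan_mem b hb y hy u hu
  have hnb := H.neg_mem hb
  have hq : ⁅y, x⁆ ∈ D.rs (a + b) := bm D hb ha hab (add_comm _ _) hy hx
  have hq0 : ⁅y, x⁆ ≠ 0 := bn D hb ha hab (add_comm _ _) hy hx hy0 hx0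
  have hux : ⁅u, x⁆ = 0 := bz D H hnb ha (by
    simp only [map_neg, LinearMap.neg_apply]; rw [H.symm b a]; linarith) hu hx
  have huq0 : ⁅u, ⁅y, x⁆⁆ ≠ 0 := bn D hnb hab ha (by abel) hu hq hu0 hq0
  have hyq : ⁅y, ⁅y, x⁆⁆ = 0 := bz D H hb hab (by
    simp only [map_add, LinearMap.add_apply]; rw [H.symm b a]; linarith) hy hq
  have e1 : ⁅u, ⁅y, x⁆⁆ = -⁅⁅y, u⁆, x⁆ := by
    rw [leibniz_lie u y x, hux, lie_zero, add_zero, ← lie_skew y u, neg_lie, neg_neg]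
  obtain ⟨s, hs⟩ := D.weight_vec a ha _ hh x hx
  obtain ⟨c, hc⟩ := D.weight_vec b hb _ hh y hy
  have s0 : s ≠ 0 := by
    rintro rfl
    rw [e1, hs, zero_smul, neg_zero] at huq0
    exact huq0 rfl
  have e2 : ⁅⁅y, u⁆, ⁅y, x⁆⁆ = (c + s) • ⁅y, x⁆ := by
    rw [leibniz_lie, hc, hs, smul_lie, lie_smul, add_smul]
  have e3 : (c + s + s) • ⁅y, x⁆ = 0 := by
    have : ⁅u, ⁅y, ⁅y, x⁆⁆⁆ = 0 := by rw [hyq, lie_zero]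
    rw [leibniz_lie, e1, hs, ← lie_skew u y, neg_lie, e2, lie_neg, lie_smul] at this
    rw [add_smul]
    rw [← neg_add, neg_eq_zero] at this
    exact this
  have hcs : c + s + s = 0 := (smul_eq_zero.1 e3).resolve_right hq0
  refine ⟨s, s0, hs, ?_⟩
  rw [hc]; congr 1; linear_combination hcs

lemma lemHH (H : KForm D.roots K) {a b : V} (ha : a ∈ D.roots) (hb : b ∈ D.roots)
    (hab : a + b ∈ D.roots) (n1 : 4 < K a a + K b b - 2 * K a b)
    (n2 : 4 < K a a + 4 * K b b + 4 * K a b)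
    {x y p : L} (hx : x ∈ D.rs a) (hy : y ∈ D.rs b) (hp : p ∈ D.rs (-(a + b)))
    (hx0 : x ≠ 0) (hy0 : y ≠ 0) (hp0 : p ≠ 0) :
    ⁅y, ⁅y, p⁆⁆ = 0 ∧ ∃ s : ℂ, s ≠ 0 ∧ ⁅⁅y, ⁅x, p⁆⁆, x⁆ = s • x ∧
      ⁅⁅y, ⁅x, p⁆⁆, y⁆ = (-2 * s) • y ∧ ⁅⁅x, ⁅y, p⁆⁆, y⁆ = (-s) • y := by
  have hnab := H.neg_mem hab
  have hna := H.neg_mem ha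
  have hnb := H.neg_mem hb
  have hw : ⁅x, p⁆ ∈ D.rs (-b) := bm D ha hnab hnb (by abel) hx hp
  have hw0 : ⁅x, p⁆ ≠ 0 := bn D ha hnab hnb (by abel) hx hp hx0 hp0
  have hv : ⁅y, p⁆ ∈ D.rs (-a) := bm D hb hnab hna (by abel) hy hp
  have hyv : ⁅y, ⁅y, p⁆⁆ = 0 := bz D H hb hna (by
    simp only [map_neg, LinearMap.neg_apply]; rw [H.symm b a]; linarith) hy hv
  have hz : ⁅x, y⁆ ∈ D.rs (a + b) := bm D ha hb hab rfl hx hy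
  have hzy : ⁅⁅x, y⁆, y⁆ = 0 := bz D H hab hb (by
    simp only [map_add, LinearMap.add_apply]; rw [H.symm b a]; linarith) hz hy
  obtain ⟨s, s0, h1, h2⟩ := lemSL D H ha hb hab n1 n2 hx hy hw hx0 hy0 hw0
  refine ⟨hyv, s, s0, h1, h2, ?_⟩
  have e1 : ⁅x, ⁅y, p⁆⁆ = ⁅⁅x, y⁆, p⁆ + ⁅y, ⁅x, p⁆⁆ := leibniz_lie x y p
  have e2 : ⁅⁅⁅x, y⁆, p⁆, y⁆ = -⁅⁅x, ⁅y, p⁆⁆, y⁆ := by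
    have t1 : ⁅⁅⁅x, y⁆, p⁆, y⁆ = ⁅⁅x, y⁆, ⁅p, y⁆⁆ := by
      have := leibniz_lie ⁅x, y⁆ p y
      rw [hzy, lie_zero, add_zero] at this
      exact this.symm
    rw [t1, ← lie_skew p y, lie_neg]
    have := leibniz_lie x y ⁅y, p⁆
    rw [hyv, lie_zero] at this
    rw [← lie_skew ⁅x, ⁅y, p⁆⁆ y, neg_neg]
    rw [eq_comm, add_eq_zero_iff_eq_neg] at this
    rw [this, neg_neg]
  have e3 : ⁅⁅x, ⁅y, p⁆⁆, y⁆ = -⁅⁅x, ⁅y, p⁆⁆, y⁆ + (-2 * s) • y := by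
    conv_lhs => rw [e1]
    rw [add_lie, e2, h2]
  have e4 : (2 : ℂ) • ⁅⁅x, ⁅y, p⁆⁆, y⁆ = (2:ℂ) • ((-s) • y) := by
    rw [two_smul]
    nth_rewrite 1 [e3]
    rw [smul_smul]
    have : -⁅⁅x, ⁅y, p⁆⁆, y⁆ + (-2 * s) • y + ⁅⁅x, ⁅y, p⁆⁆, y⁆ = (-2 * s) • y := by abel
    rw [this]; congr 1; ring
  exact smul_right_injective L (two_ne_zero (α := ℂ)) e4

/-- second mixed component of `(x+y)^4`. -/
lemma w2_zero {x y : L}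
    (h1 : (LieAlgebra.ad ℂ L (x + y)) ^ 4 = 0) (h2 : (LieAlgebra.ad ℂ L (x - y)) ^ 4 = 0)
    (h3 : (LieAlgebra.ad ℂ L x) ^ 4 = 0) (h4 : (LieAlgebra.ad ℂ L y) ^ 4 = 0) (v : L) :
    ⁅x, ⁅x, ⁅y, ⁅y, v⁆⁆⁆⁆ + ⁅x, ⁅y, ⁅x, ⁅y, v⁆⁆⁆⁆ + ⁅x, ⁅y, ⁅y, ⁅x, v⁆⁆⁆⁆ + ⁅y, ⁅x, ⁅x, ⁅y, v⁆⁆⁆⁆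
      + ⁅y, ⁅x, ⁅y, ⁅x, v⁆⁆⁆⁆ + ⁅y, ⁅y, ⁅x, ⁅x, v⁆⁆⁆⁆ = 0 := by
  have g1 := congrArg (fun f => f v) h1
  have g2 := congrArg (fun f => f v) h2
  have g3 := congrArg (fun f => f v) h3
  have g4 := congrArg (fun f => f v) h4
  simp only [pow_succ, pow_zero, one_mul, Module.End.mul_apply, LieAlgebra.ad_apply,
    LinearMap.zero_apply, add_lie, lie_add, sub_lie, lie_sub] at g1 g2 g3 g4
  rw [g3, g4] at g1 g2
  have := congrArg₂ (· + ·) g1 g2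
  apply smul_right_injective L (two_ne_zero (α := ℂ))
  simp only [smul_zero]
  simp only [add_zero] at this
  rw [← this, two_smul]
  abel

lemma forward_same (H : KForm D.roots K) {a b : V} (ha : a ∈ D.roots) (hb : b ∈ D.roots)
    (hab : a + b ∈ D.roots) (n : ℝ) (hn : 2 ≤ n) (na : K a a = n) (nb : K b b = n)
    (nab : 2 * K a b = -n)
    {x y : L} (hx : x ∈ D.rs a) (hy : y ∈ D.rs b) (hx0 : x ≠ 0) (hy0 : y ≠ 0)
    (W : ∀ v : L, ⁅x, ⁅x, ⁅y, ⁅y, v⁆⁆⁆⁆ + ⁅x, ⁅y, ⁅x, ⁅y, v⁆⁆⁆⁆ + ⁅x, ⁅y, ⁅y, ⁅x, v⁆⁆⁆⁆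
      + ⁅y, ⁅x, ⁅x, ⁅y, v⁆⁆⁆⁆ + ⁅y, ⁅x, ⁅y, ⁅x, v⁆⁆⁆⁆ + ⁅y, ⁅y, ⁅x, ⁅x, v⁆⁆⁆⁆ = 0) : False := by
  obtain ⟨p, hp, hp0⟩ := rs_exists D (H.neg_mem hab)
  have nba : 2 * K b a = -n := by rw [H.symm]; exact nab
  obtain ⟨yy, s, s0, h1, h2, h3⟩ := lemHH D H ha hb hab (by linarith) (by linarith)
    hx hy hp hx0 hy0 hp0
  obtain ⟨xx, s', s0', h1', h2', h3'⟩ := lemHH D H hb ha (by rwa [add_comm])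
    (by linarith) (by linarith) hy hx (by rwa [add_comm]) hy0 hx0 hp0
  have hss : s' = -s := by
    rw [h1'] at h3
    exact smul_left_injective ℂ hy0 h3
  subst hss
  have hz0 : ⁅x, y⁆ ≠ 0 := bn D ha hb hab rfl hx hy hx0 hy0
  have := W p
  rw [yy, xx] at this
  rw [← lie_skew x ⁅x, ⁅y, p⁆⁆, ← lie_skew x ⁅y, ⁅x, p⁆⁆, ← lie_skew y ⁅x, ⁅y, p⁆⁆,
    ← lie_skew y ⁅y, ⁅x, p⁆⁆, h1, h2, h1', h2'] at this
  simp only [lie_zero, lie_neg, lie_smul] at this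
  rw [← lie_skew y x] at this
  have h6 : (6 * s) • ⁅x, y⁆ = 0 := by
    rw [← this]; module
  rcases smul_eq_zero.1 h6 with h | h
  · exact s0 (by simpa using h)
  · exact hz0 h

lemma forward_diff (H : KForm D.roots K) {a b : V} (ha : a ∈ D.roots) (hb : b ∈ D.roots)
    (hab : a + b ∈ D.roots) (na : K a a = 2) (nb : K b b = 4)
    (nab : K a b = -2)
    {x y : L} (hx : x ∈ D.rs a) (hy : y ∈ D.rs b) (hx0 : x ≠ 0) (hy0 : y ≠ 0)
    (W : ∀ v : L, ⁅x, ⁅x, ⁅y, ⁅y, v⁆⁆⁆⁆ + ⁅x, ⁅y, ⁅x, ⁅y, v⁆⁆⁆⁆ + ⁅x, ⁅y, ⁅y, ⁅x, v⁆⁆⁆⁆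
      + ⁅y, ⁅x, ⁅x, ⁅y, v⁆⁆⁆⁆ + ⁅y, ⁅x, ⁅y, ⁅x, v⁆⁆⁆⁆ + ⁅y, ⁅y, ⁅x, ⁅x, v⁆⁆⁆⁆ = 0) : False := by
  have nba : K b a = -2 := by rw [H.symm]; exact nab
  have h2ab : b + (2:ℝ) • a ∈ D.roots := H.add_two_mem hb ha na nba
  obtain ⟨q, hq, hq0⟩ := rs_exists D (H.neg_mem h2ab)
  have hp : ⁅x, q⁆ ∈ D.rs (-(a + b)) :=
    bm D ha (H.neg_mem h2ab) (H.neg_mem hab) (by rw [two_smul]; abel) hx hq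
  have hp0 : ⁅x, q⁆ ≠ 0 :=
    bn D ha (H.neg_mem h2ab) (H.neg_mem hab) (by rw [two_smul]; abel) hx hq hx0 hq0
  have hyq : ⁅y, q⁆ = 0 := bz D H hb (H.neg_mem h2ab) (by
    simp only [map_neg, LinearMap.neg_apply, map_add, map_smul, LinearMap.add_apply,
      LinearMap.smul_apply, smul_eq_mul]
    linarith) hy hq
  obtain ⟨yy, s, s0, h1, h2, h3⟩ := lemHH D H ha hb hab (by linarith) (by linarith)
    hx hy hp hx0 hy0 hp0
  have := W q
  rw [hyq, yy, ← lie_skew y ⁅y, ⁅x, ⁅x, q⁆⁆⁆, ← lie_skew y ⁅x, ⁅y, ⁅x, q⁆⁆⁆, h2, h3] at this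
  simp only [lie_zero] at this
  have h6 : (3 * s) • y = 0 := by
    rw [← this]; module
  rcases smul_eq_zero.1 h6 with h | h
  · exact s0 (by simpa using h)
  · exact hy0 h

theorem forward (H : KForm D.roots K) {Ψ : Set V} (hsub : Ψ ⊆ D.pos)
    (hsph : IsSphericalSubspace (D.aSubspace Ψ)) : ∀ α ∈ Ψ, ∀ β ∈ Ψ, 0 ≤ K α β := by
  have le : ∀ a ∈ Ψ, D.rs a ≤ D.aSubspace Ψ := by
    intro a ha
    exact le_iSup₂_of_le a ha le_rfl
  have key : ∀ a ∈ Ψ, ∀ b ∈ Ψ, ∀ x ∈ D.rs a, ∀ y ∈ D.rs b,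
    ∀ v : L, ⁅x, ⁅x, ⁅y, ⁅y, v⁆⁆⁆⁆ + ⁅x, ⁅y, ⁅x, ⁅y, v⁆⁆⁆⁆ + ⁅x, ⁅y, ⁅y, ⁅x, v⁆⁆⁆⁆
      + ⁅y, ⁅x, ⁅x, ⁅y, v⁆⁆⁆⁆ + ⁅y, ⁅x, ⁅y, ⁅x, v⁆⁆⁆⁆ + ⁅y, ⁅y, ⁅x, ⁅x, v⁆⁆⁆⁆ = 0 := by
    intro a ha b hb x hx y hy
    have hx' := le a ha hx
    have hy' := le b hb hy
    exact w2_zero (hsph _ (Submodule.add_mem _ hx' hy')) (hsph _ (Submodule.sub_mem _ hx' hy'))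
      (hsph _ hx') (hsph _ hy')
  intro a ha b hb
  by_contra hneg
  push Not at hneg
  have haΦ := D.pos_subset (hsub ha)
  have hbΦ := D.pos_subset (hsub hb)
  have hne : a + b ≠ 0 := by
    intro h
    have : b = -a := (neg_eq_of_add_eq_zero_right h).symm
    subst this
    exact (D.pos_iff a haΦ).1 (hsub ha) (hsub hb)
  have hab := H.add_mem haΦ hbΦ hneg hne
  have hne' : a ≠ -b := fun h => hne (by rw [h]; simp)
  obtain ⟨x, hx, hx0⟩ := rs_exists D haΦ
  obtain ⟨y, hy, hy0⟩ := rs_exists D hbΦ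
  rcases H.norm a haΦ with na | na <;> rcases H.norm b hbΦ with nb | nb
  · obtain ⟨n, hn, l, u, e, e'⟩ := H.kss haΦ hbΦ na nb
    have : n < 0 := by rw [hn] at hneg; exact_mod_cast hneg
    have : n ≠ -2 := fun h => hne' (e' h)
    obtain rfl : n = -1 := by omega
    exact forward_same D H haΦ hbΦ hab 2 le_rfl na nb (by rw [hn]; norm_num) hx hy hx0 hy0
      (key a ha b hb x hx y hy)
  · obtain ⟨n, hn, l, u⟩ := H.ksl haΦ hbΦ na nb
    have : (n : ℝ) < 0 := by rw [hn] at hneg; linarith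
    have : n < 0 := by exact_mod_cast this
    obtain rfl : n = -1 := by omega
    exact forward_diff D H haΦ hbΦ hab na nb (by rw [hn]; norm_num) hx hy hx0 hy0
      (key a ha b hb x hx y hy)
  · obtain ⟨n, hn, l, u⟩ := H.kls haΦ hbΦ na nb
    have : (n : ℝ) < 0 := by rw [hn] at hneg; linarith
    have : n < 0 := by exact_mod_cast this
    obtain rfl : n = -1 := by omega
    exact forward_diff D H hbΦ haΦ (by rwa [add_comm]) nb na (by rw [H.symm, hn]; norm_num)
      hy hx hy0 hx0 (key b hb a ha y hy x hx)
  · obtain ⟨n, hn, l, u, e, e'⟩ := H.kll haΦ hbΦ na nb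
    have : (n : ℝ) < 0 := by rw [hn] at hneg; linarith
    have : n < 0 := by exact_mod_cast this
    have : n ≠ -2 := fun h => hne' (e' h)
    obtain rfl : n = -1 := by omega
    exact forward_same D H haΦ hbΦ hab 4 (by norm_num) na nb (by rw [hn]; norm_num) hx hy hx0 hy0
      (key a ha b hb x hx y hy)

end Lie

end BSP

namespace BSP

section SymRing

variable {R : Type*} [Ring R]

/-- Symmetrized product of two elements. -/
def sym2 (a b : R) : R := a * b + b * a

/-- Symmetrized product of three elements. -/
def sym3 (a b c : R) : R := a * sym2 b c + b * sym2 a c + c * sym2 a b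

/-- Symmetrized product of four elements. -/
def sym4 (a b c d : R) : R := a * sym3 b c d + b * sym3 a c d + c * sym3 a b d + d * sym3 a b c

lemma sym2_comm (a b : R) : sym2 a b = sym2 b a := by unfold sym2; abel

lemma sym3_12 (a b c : R) : sym3 a b c = sym3 b a c := by
  unfold sym3; rw [sym2_comm a b]; abel

lemma sym3_23 (a b c : R) : sym3 a b c = sym3 a c b := by
  unfold sym3; rw [sym2_comm b c]; abel

lemma sym4_12 (a b c d : R) : sym4 a b c d = sym4 b a c d := by
  unfold sym4; rw [sym3_12 a b d, sym3_12 a b c]; abel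

lemma sym4_23 (a b c d : R) : sym4 a b c d = sym4 a c b d := by
  unfold sym4; rw [sym3_12 b c d, sym3_23 a b c]; abel

lemma sym4_34 (a b c d : R) : sym4 a b c d = sym4 a b d c := by
  unfold sym4; rw [sym3_23 b c d, sym3_23 a c d]; abel

lemma sym2_add (a a' b : R) : sym2 (a + a') b = sym2 a b + sym2 a' b := by
  unfold sym2; rw [add_mul, mul_add]; abel

lemma sym3_add (a a' b c : R) : sym3 (a + a') b c = sym3 a b c + sym3 a' b c := by
  unfold sym3; rw [sym2_add, sym2_add]; simp only [add_mul, mul_add]; abel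

lemma sym4_add (a a' b c d : R) : sym4 (a + a') b c d = sym4 a b c d + sym4 a' b c d := by
  unfold sym4; rw [sym3_add, sym3_add, sym3_add]; simp only [add_mul, mul_add]; abel

/-- The commutator. -/
def cm (z a : R) : R := z * a - a * z

lemma cm_add (z a b : R) : cm z (a + b) = cm z a + cm z b := by
  unfold cm; rw [mul_add, add_mul]; abel

lemma cm_mul (z a b : R) : cm z (a * b) = cm z a * b + a * cm z b := by
  unfold cm; noncomm_ring

lemma sym2_der (z a b : R) : cm z (sym2 a b) = sym2 (cm z a) b + sym2 a (cm z b) := by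
  unfold sym2; rw [cm_add, cm_mul, cm_mul]; abel

lemma sym3_der (z a b c : R) :
    cm z (sym3 a b c) = sym3 (cm z a) b c + sym3 a (cm z b) c + sym3 a b (cm z c) := by
  unfold sym3
  simp only [cm_add, cm_mul, sym2_der, mul_add]; abel

lemma sym4_der (z a b c d : R) :
    cm z (sym4 a b c d) = sym4 (cm z a) b c d + sym4 a (cm z b) c d + sym4 a b (cm z c) d
      + sym4 a b c (cm z d) := by
  unfold sym4
  simp only [cm_add, cm_mul, sym3_der, mul_add]; abel

lemma sym4_self (a : R) : sym4 a a a a = 24 • a ^ 4 := by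
  simp only [sym4, sym3, sym2, pow_succ, pow_zero, one_mul, mul_add, mul_assoc]
  abel

variable [Algebra ℂ R]

lemma sym2_smul (k : ℂ) (a b : R) : sym2 (k • a) b = k • sym2 a b := by
  simp only [sym2, smul_mul_assoc, mul_smul_comm, smul_add]

lemma sym3_smul (k : ℂ) (a b c : R) : sym3 (k • a) b c = k • sym3 a b c := by
  simp only [sym3, sym2_smul, smul_mul_assoc, mul_smul_comm, smul_add]

lemma sym4_smul (k : ℂ) (a b c d : R) : sym4 (k • a) b c d = k • sym4 a b c d := by
  simp only [sym4, sym3_smul, smul_mul_assoc, mul_smul_comm, smul_add]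

end SymRing

section S4

variable {L : Type*} [LieRing L] [LieAlgebra ℂ L]

/-- The symmetrized product of four adjoint operators. -/
def S4 (a b c d : L) : Module.End ℂ L :=
  sym4 (LieAlgebra.ad ℂ L a) (LieAlgebra.ad ℂ L b) (LieAlgebra.ad ℂ L c) (LieAlgebra.ad ℂ L d)

lemma S4_12 (a b c d : L) : S4 a b c d = S4 b a c d := sym4_12 _ _ _ _
lemma S4_23 (a b c d : L) : S4 a b c d = S4 a c b d := sym4_23 _ _ _ _
lemma S4_34 (a b c d : L) : S4 a b c d = S4 a b d c := sym4_34 _ _ _ _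

lemma S4_add (a a' b c d : L) : S4 (a + a') b c d = S4 a b c d + S4 a' b c d := by
  unfold S4; rw [map_add, sym4_add]

lemma S4_smul (k : ℂ) (a b c d : L) : S4 (k • a) b c d = k • S4 a b c d := by
  unfold S4; rw [map_smul, sym4_smul]

lemma S4_zero (b c d : L) : S4 0 b c d = 0 := by
  have := S4_smul 0 0 b c d
  rwa [zero_smul, zero_smul] at this

lemma S4_smul2 (k : ℂ) (a b c d : L) : S4 a (k • b) c d = k • S4 a b c d := by
  rw [S4_12, S4_smul, S4_12]

lemma S4_smul3 (k : ℂ) (a b c d : L) : S4 a b (k • c) d = k • S4 a b c d := by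
  rw [S4_23, S4_smul2, S4_23]

lemma S4_smul4 (k : ℂ) (a b c d : L) : S4 a b c (k • d) = k • S4 a b c d := by
  rw [S4_34, S4_smul3, S4_34]

lemma S4_zero2 (b c d : L) : S4 b 0 c d = 0 := by rw [S4_12, S4_zero]
lemma S4_zero3 (b c d : L) : S4 b c 0 d = 0 := by rw [S4_23, S4_zero2]
lemma S4_zero4 (b c d : L) : S4 b c d 0 = 0 := by rw [S4_34, S4_zero3]

lemma S4_der {a b c d : L} (h : S4 a b c d = 0) (z : L) :
    S4 ⁅z, a⁆ b c d + S4 a ⁅z, b⁆ c d + S4 a b ⁅z, c⁆ d + S4 a b c ⁅z, d⁆ = 0 := by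
  have := sym4_der (LieAlgebra.ad ℂ L z) (LieAlgebra.ad ℂ L a) (LieAlgebra.ad ℂ L b)
    (LieAlgebra.ad ℂ L c) (LieAlgebra.ad ℂ L d)
  change cm _ (S4 a b c d) = _ at this
  have h0 : cm (LieAlgebra.ad ℂ L z) (0 : Module.End ℂ L) = 0 := by simp [cm]
  have e : ∀ x : L, LieAlgebra.ad ℂ L ⁅z, x⁆ = cm (LieAlgebra.ad ℂ L z) (LieAlgebra.ad ℂ L x) := by
    intro x
    ext v
    simp only [cm, LieAlgebra.ad_apply, LinearMap.sub_apply, Module.End.mul_apply, lie_lie]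
  rw [h, h0] at this
  unfold S4
  simp only [e]
  exact this.symm

lemma S4_self (a : L) : S4 a a a a = 24 • (LieAlgebra.ad ℂ L a) ^ 4 := sym4_self _

lemma half {M : Type*} [AddCommGroup M] [Module ℂ M] {x : M} (n : ℕ) (hn : n ≠ 0)
    (h : (n : ℂ) • x = 0) : x = 0 :=
  (smul_eq_zero.1 h).resolve_left (by exact_mod_cast hn)

lemma S4_L1 {b : L} (h : (LieAlgebra.ad ℂ L b) ^ 4 = 0) (z : L) : S4 ⁅z, b⁆ b b b = 0 := by
  have h0 : S4 b b b b = 0 := by rw [S4_self, h, smul_zero]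
  have := S4_der h0 z
  rw [S4_34 b b b, S4_23 b b, S4_12 b] at this
  apply half 4 (by norm_num)
  rw [← this]; push_cast; module

lemma S4_L2 {b : L} (h : (LieAlgebra.ad ℂ L b) ^ 4 = 0) (z w : L) (h1 : ⁅w, ⁅z, b⁆⁆ = 0) :
    S4 ⁅z, b⁆ ⁅w, b⁆ b b = 0 := by
  have := S4_der (S4_L1 h z) w
  rw [h1, S4_zero, S4_34 _ b b, S4_23 _ b] at this
  apply half 3 (by norm_num)
  rw [← this]; push_cast; module

lemma S4_L3 {b : L} (h : (LieAlgebra.ad ℂ L b) ^ 4 = 0) (z w u : L) (h1 : ⁅w, ⁅z, b⁆⁆ = 0)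
    (h2 : ⁅u, ⁅z, b⁆⁆ = 0) (h3 : ⁅u, ⁅w, b⁆⁆ = 0) :
    S4 ⁅z, b⁆ ⁅w, b⁆ ⁅u, b⁆ b = 0 := by
  have := S4_der (S4_L2 h z w h1) u
  rw [h2, h3, S4_zero, S4_zero2, S4_34 _ _ b] at this
  apply half 2 (by norm_num)
  rw [← this]; push_cast; module

end S4

section Grade

variable {L : Type*} [LieRing L] [LieAlgebra ℂ L] (D : LieRootData V L)
  {K : V →ₗ[ℝ] V →ₗ[ℝ] ℝ}

open scoped Classical in
/-- The graded piece attached to a vector. -/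
def Gr (δ : V) : Submodule ℂ L :=
  if δ = 0 then D.cartan.toSubmodule else if δ ∈ D.roots then D.rs δ else ⊥

lemma Gr_zero : Gr D 0 = D.cartan.toSubmodule := by simp [Gr]

lemma Gr_root {δ : V} (h : δ ∈ D.roots) : Gr D δ = D.rs δ := by
  simp [Gr, D.ne_zero δ h, h]

lemma Gr_bot {δ : V} (h : δ ≠ 0) (h' : δ ∉ D.roots) : Gr D δ = ⊥ := by
  simp [Gr, h, h']

lemma Gr_bot' (H : KForm D.roots K) {δ : V} (h : 4 < K δ δ) : Gr D δ = ⊥ :=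
  Gr_bot D (H.ne_zero_of_gt h) (H.not_mem_of_gt h)

lemma Gr_lie {α δ : V} (hα : α ∈ D.roots) {x v : L} (hx : x ∈ D.rs α) (hv : v ∈ Gr D δ) :
    ⁅x, v⁆ ∈ Gr D (α + δ) := by
  by_cases h0 : δ = 0
  · subst h0
    rw [add_zero, Gr_root D hα]
    rw [Gr_zero] at hv
    obtain ⟨c, hc⟩ := D.weight_vec α hα v hv x hx
    rw [← lie_skew, hc]
    exact Submodule.neg_mem _ (Submodule.smul_mem _ _ hx)
  by_cases h1 : δ ∈ D.roots
  · rw [Gr_root D h1] at hv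
    by_cases h2 : α + δ = 0
    · have : δ = -α := (neg_eq_of_add_eq_zero_right h2).symm
      subst this
      rw [h2, Gr_zero]
      exact D.bracket_cartan_mem α hα x hx v hv
    by_cases h3 : α + δ ∈ D.roots
    · rw [Gr_root D h3]
      exact D.bracket_mem α hα δ h1 h3 x hx v hv
    · rw [D.bracket_eq_zero α hα δ h1 h3 h2 x hx v hv]
      exact Submodule.zero_mem _
  · rw [Gr_bot D h0 h1, Submodule.mem_bot] at hv
    rw [hv, lie_zero]
    exact Submodule.zero_mem _

lemma S4_mem_Gr {a b c d δ : V} (ha : a ∈ D.roots) (hb : b ∈ D.roots) (hc : c ∈ D.roots)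
    (hd : d ∈ D.roots) {x1 x2 x3 x4 y : L} (h1 : x1 ∈ D.rs a) (h2 : x2 ∈ D.rs b)
    (h3 : x3 ∈ D.rs c) (h4 : x4 ∈ D.rs d) (hy : y ∈ Gr D δ) :
    S4 x1 x2 x3 x4 y ∈ Gr D (a + b + c + d + δ) := by
  have key : ∀ {α β γ η : V} {p q r s : L}, α ∈ D.roots → β ∈ D.roots → γ ∈ D.roots →
      η ∈ D.roots → p ∈ D.rs α → q ∈ D.rs β → r ∈ D.rs γ → s ∈ D.rs η →
      α + (β + (γ + (η + δ))) = a + b + c + d + δ →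
      ⁅p, ⁅q, ⁅r, ⁅s, y⁆⁆⁆⁆ ∈ Gr D (a + b + c + d + δ) := by
    intro α β γ η p q r s hα hβ hγ hη hp hq hr hs e
    rw [← e]
    exact Gr_lie D hα hp (Gr_lie D hβ hq (Gr_lie D hγ hr (Gr_lie D hη hs hy)))
  simp only [S4, sym4, sym3, sym2, LinearMap.add_apply, Module.End.mul_apply,
    LieAlgebra.ad_apply, lie_add]
  repeat' apply Submodule.add_mem
  all_goals
    apply key
    rotate_left 4
    iterate 4 (first | exact h1 | exact h2 | exact h3 | exact h4)
    all_goals first | assumption | abel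

lemma top_ind {p : L → Prop} (hadd : ∀ x y, p x → p y → p (x + y))
    (hz : p 0) (hsm : ∀ (c : ℂ) x, p x → p (c • x)) (hc : ∀ x ∈ D.cartan, p x)
    (hr : ∀ α ∈ D.roots, ∀ x ∈ D.rs α, p x) (x : L) : p x := by
  let M : Submodule ℂ L :=
    { carrier := {x | p x}, add_mem' := fun {a b} ha hb => hadd a b ha hb, zero_mem' := hz,
      smul_mem' := fun c x hx => hsm c x hx }
  have : (⊤ : Submodule ℂ L) ≤ M := by
    rw [← D.sup_eq_top]
    exact sup_le hc (iSup₂_le hr)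
  exact this (Submodule.mem_top (x := x))

lemma a_ind {p : L → Prop} {Ψ : Set V} (hadd : ∀ x y, p x → p y → p (x + y))
    (hz : p 0) (hsm : ∀ (c : ℂ) x, p x → p (c • x))
    (hr : ∀ α ∈ Ψ, ∀ x ∈ D.rs α, p x) {x : L} (hx : x ∈ D.aSubspace Ψ) : p x := by
  let M : Submodule ℂ L :=
    { carrier := {x | p x}, add_mem' := fun {a b} ha hb => hadd a b ha hb, zero_mem' := hz,
      smul_mem' := fun c x hx => hsm c x hx }
  have : D.aSubspace Ψ ≤ M := iSup₂_le hr
  exact this hx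

lemma op_zero {f : Module.End ℂ L} (hc : ∀ x ∈ D.cartan, f x = 0)
    (hr : ∀ α ∈ D.roots, ∀ x ∈ D.rs α, f x = 0) : f = 0 := by
  ext x
  refine top_ind D (p := fun x => f x = (0 : Module.End ℂ L) x) ?_ ?_ ?_ ?_ ?_ x
  · intro x y hx hy; simp only [map_add, hx, hy]
  · simp
  · intro c x hx; simp only [map_smul, hx]
  · intro x hx; rw [hc x hx]; rfl
  · intro a ha x hx; rw [hr a ha x hx]; rfl

/-- Short root vectors have `ad`-fourth power zero. -/
lemma ad_four (H : KForm D.roots K) {b : V} (hb : b ∈ D.roots)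
    {x : L} (hx : x ∈ D.rs b) : (LieAlgebra.ad ℂ L x) ^ 4 = 0 := by
  have key : ∀ δ : V, 4 < K δ δ + 16 * K b b + 8 * K b δ → ∀ y ∈ Gr D δ,
      ((LieAlgebra.ad ℂ L x) ^ 4) y = 0 := by
    intro δ h y hy
    have h2 := Gr_lie D hb hx (Gr_lie D hb hx (Gr_lie D hb hx (Gr_lie D hb hx hy)))
    rw [Gr_bot' D H, Submodule.mem_bot] at h2
    · simp only [pow_succ, pow_zero, one_mul, Module.End.mul_apply, LieAlgebra.ad_apply]
      exact h2
    · simp only [map_add, LinearMap.add_apply]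
      rw [H.symm δ b]
      linarith
  have nb : 2 ≤ K b b := by rcases H.norm b hb with h | h <;> rw [h]; norm_num
  apply op_zero D
  · intro y hy
    exact key 0 (by simp only [map_zero]; linarith) y (by rw [Gr_zero]; exact hy)
  · intro δ hδ y hy
    have hbd := H.bounds (α := b) (β := δ)
    refine key δ ?_ y (by rw [Gr_root D hδ]; exact hy)
    rcases H.norm b hb with h | h <;> rcases H.norm δ hδ with h' | h' <;> linarith

/-- `x_c` can be reached from a nonzero `x_b` when `c - b` is a root. -/
lemma lift {b c : V} (hb : b ∈ D.roots) (hc : c ∈ D.roots) (hcb : c - b ∈ D.roots)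
    {x y : L} (hx : x ∈ D.rs b) (hx0 : x ≠ 0) (hy : y ∈ D.rs c) :
    ∃ z ∈ D.rs (c - b), ⁅z, x⁆ = y := by
  obtain ⟨z, hz, hz0⟩ := rs_exists D hcb
  have h1 := bm D hcb hb hc (by abel) hz hx
  have h2 := bn D hcb hb hc (by abel) hz hx hz0 hx0
  obtain ⟨k, hk⟩ := rs_mul D hc h1 h2 hy
  exact ⟨k • z, Submodule.smul_mem _ _ hz, by rw [smul_lie, hk]⟩

/-- Vanishing of the symmetrized products at operator level. -/
def Van (a b c d : V) : Prop :=
  ∀ x1 ∈ D.rs a, ∀ x2 ∈ D.rs b, ∀ x3 ∈ D.rs c, ∀ x4 ∈ D.rs d, S4 x1 x2 x3 x4 = 0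

lemma van_L2 (H : KForm D.roots K) {b c1 c2 : V} (hb : b ∈ D.roots)
    (h1 : c1 ∈ D.roots) (h2 : c2 ∈ D.roots) (h1b : c1 - b ∈ D.roots) (h2b : c2 - b ∈ D.roots)
    (hn : 4 < K (c2 - b + c1) (c2 - b + c1)) : Van D c1 c2 b b := by
  intro x1 hx1 x2 hx2 x3 hx3 x4 hx4
  by_cases h0 : x3 = 0
  · rw [h0, S4_zero3]
  obtain ⟨k, rfl⟩ := rs_mul D hb hx3 h0 hx4
  obtain ⟨z, hz, rfl⟩ := lift D hb h1 h1b hx3 h0 hx1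
  obtain ⟨w, hw, rfl⟩ := lift D hb h2 h2b hx3 h0 hx2
  rw [S4_smul4, S4_L2 (ad_four D H hb hx3) z w, smul_zero]
  rw [H.add_add] at hn
  exact bz D H h2b h1 hn hw hx1

lemma van_L3 (H : KForm D.roots K) {b c1 c2 c3 : V} (hb : b ∈ D.roots)
    (h1 : c1 ∈ D.roots) (h2 : c2 ∈ D.roots) (h3 : c3 ∈ D.roots)
    (h1b : c1 - b ∈ D.roots) (h2b : c2 - b ∈ D.roots) (h3b : c3 - b ∈ D.roots)
    (hn : 4 < K (c2 - b + c1) (c2 - b + c1)) (hn' : 4 < K (c3 - b + c1) (c3 - b + c1))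
    (hn'' : 4 < K (c3 - b + c2) (c3 - b + c2)) : Van D c1 c2 c3 b := by
  intro x1 hx1 x2 hx2 x3 hx3 x4 hx4
  by_cases h0 : x4 = 0
  · rw [h0, S4_zero4]
  obtain ⟨z, hz, rfl⟩ := lift D hb h1 h1b hx4 h0 hx1
  obtain ⟨w, hw, rfl⟩ := lift D hb h2 h2b hx4 h0 hx2
  obtain ⟨u, hu, rfl⟩ := lift D hb h3 h3b hx4 h0 hx3
  rw [H.add_add] at hn hn' hn''
  exact S4_L3 (ad_four D H hb hx4) z w u (bz D H h2b h1 hn hw hx1)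
    (bz D H h3b h1 hn' hu hx1) (bz D H h3b h2 hn'' hu hx2)

/-- the four-cycle configuration -/
lemma van_cycle (H : KForm D.roots K) {a b c d : V} (ha : a ∈ D.roots) (hb : b ∈ D.roots)
    (hc : c ∈ D.roots) (hd : d ∈ D.roots) (na : K a a = 2) (nb : K b b = 2)
    (nc : K c c = 2) (nd : K d d = 2) (hab : K a b = 1) (hbc : K b c = 1) (hcd : K c d = 1)
    (had : K a d = 1) (hbd : K b d = 0) (hbdΦ : b + d ∈ D.roots)
    (e : a + c = b + d) : Van D c d a b := by
  have hba : K b a = 1 := by rw [H.symm]; exact hab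
  have hcb : K c b = 1 := by rw [H.symm]; exact hbc
  have hdc : K d c = 1 := by rw [H.symm]; exact hcd
  have hda : K d a = 1 := by rw [H.symm]; exact had
  have hdb : K d b = 0 := by rw [H.symm]; exact hbd
  have hdbΦ : d - b ∈ D.roots := by
    have := H.sub_two_mem hbdΦ hb nb (by simp only [map_add, LinearMap.add_apply]; linarith)
    convert this using 1; rw [two_smul]; abel
  have v1 : Van D d d b b := van_L2 D H hb hd hd hdbΦ hdbΦ (by
    simp only [map_add, LinearMap.add_apply, map_sub, LinearMap.sub_apply]; linarith)
  have habΦ : a - b ∈ D.roots := H.sub_mem ha hb (by linarith) (by rintro rfl; linarith)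
  have hcdΦ : c - d ∈ D.roots := H.sub_mem hc hd (by linarith) (by rintro rfl; linarith)
  have v2 : Van D d d a b := by
    intro x1 hx1 x2 hx2 x3 hx3 x4 hx4
    by_cases h0 : x4 = 0
    · rw [h0, S4_zero4]
    obtain ⟨z, hz, rfl⟩ := lift D hb ha habΦ hx4 h0 hx3
    have h := S4_der (v1 x1 hx1 x2 hx2 x4 hx4 x4 hx4) z
    have hzd : ∀ x ∈ D.rs d, ⁅z, x⁆ = 0 := fun x hx => bz D H habΦ hd (by
      simp only [map_add, LinearMap.add_apply, map_sub, LinearMap.sub_apply]; linarith) hz hx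
    rw [hzd x1 hx1, hzd x2 hx2, S4_zero, S4_zero2, S4_34 _ _ x4] at h
    apply half 2 (by norm_num)
    rw [← h]; push_cast; module
  intro x1 hx1 x2 hx2 x3 hx3 x4 hx4
  by_cases h0 : x2 = 0
  · rw [h0, S4_zero2]
  obtain ⟨z, hz, rfl⟩ := lift D hd hc hcdΦ hx2 h0 hx1
  have h := S4_der (v2 x2 hx2 x2 hx2 x3 hx3 x4 hx4) z
  have hzb : ⁅z, x4⁆ = 0 := bz D H hcdΦ hb (by
      simp only [map_add, LinearMap.add_apply, map_sub, LinearMap.sub_apply]; linarith) hz hx4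
  have hza : ⁅z, x3⁆ ∈ D.rs b := bm D hcdΦ ha hb (by
    have : c - d + a = (a + c) - d := by abel
    rw [this, e]; abel) hz hx3
  rw [hzb, S4_zero4, v1 x2 hx2 x2 hx2 _ hza x4 hx4, S4_12 x2] at h
  apply half 2 (by norm_num)
  rw [← h]; push_cast; module

/-- Vanishing on a given root space. -/
def VanAt (δ a b c d : V) : Prop :=
  ∀ x1 ∈ D.rs a, ∀ x2 ∈ D.rs b, ∀ x3 ∈ D.rs c, ∀ x4 ∈ D.rs d, ∀ y ∈ D.rs δ,
    S4 x1 x2 x3 x4 y = 0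

lemma Van.at {a b c d : V} (h : Van D a b c d) (δ : V) : VanAt D δ a b c d := by
  intro x1 h1 x2 h2 x3 h3 x4 h4 y _
  rw [h x1 h1 x2 h2 x3 h3 x4 h4]; rfl

lemma VanAt.s12 {δ a b c d : V} (h : VanAt D δ a b c d) : VanAt D δ b a c d := by
  intro x1 h1 x2 h2 x3 h3 x4 h4 y hy
  rw [S4_12]; exact h x2 h2 x1 h1 x3 h3 x4 h4 y hy

lemma VanAt.s23 {δ a b c d : V} (h : VanAt D δ a b c d) : VanAt D δ a c b d := by
  intro x1 h1 x2 h2 x3 h3 x4 h4 y hy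
  rw [S4_23]; exact h x1 h1 x3 h3 x2 h2 x4 h4 y hy

lemma VanAt.s34 {δ a b c d : V} (h : VanAt D δ a b c d) : VanAt D δ a b d c := by
  intro x1 h1 x2 h2 x3 h3 x4 h4 y hy
  rw [S4_34]; exact h x1 h1 x2 h2 x4 h4 x3 h3 y hy

lemma plus_trans (H : KForm D.roots K) {x y z : V} (hz : z ∈ D.roots)
    (nx : K x x = 2) (ny : K y y = 2) (nz : K z z = 2) (hxy : K x y = 0) (hyz : K y z = 0)
    (hxz : K x z = 0) (h1 : x + y ∈ D.roots) (h2 : y + z ∈ D.roots) : x + z ∈ D.roots := by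
  have hyx : K y x = 0 := by rw [H.symm]; exact hxy
  have h3 : x - z ∈ D.roots := by
    have := H.sub_mem h1 h2 (by simp only [map_add, LinearMap.add_apply]; linarith) (by
      intro h
      have : x = z := by rw [add_comm] at h; exact add_left_cancel h
      subst this; linarith)
    convert this using 1; abel
  have := H.add_two_mem h3 hz nz (by simp only [map_sub, LinearMap.sub_apply]; linarith)
  convert this using 1; rw [two_smul]; abel

/-- `ε = a + b`, `-δ = c + d`, all mutually orthogonal and short -/
lemma vanAt_split (H : KForm D.roots K) {a b c d δ : V} (ha : a ∈ D.roots) (hb : b ∈ D.roots)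
    (hc : c ∈ D.roots) (hd : d ∈ D.roots) (hδ : δ ∈ D.roots)
    (na : K a a = 2) (nb : K b b = 2)
    (nc : K c c = 2) (nd : K d d = 2) (hab : K a b = 0) (hac : K a c = 0) (had : K a d = 0)
    (hbc : K b c = 0) (hbd : K b d = 0) (hcd : K c d = 0) (eab : a + b ∈ D.roots)
    (ecd : δ = -(c + d)) : VanAt D δ a b c d := by
  have hba : K b a = 0 := by rw [H.symm]; exact hab
  have hca : K c a = 0 := by rw [H.symm]; exact hac
  have hda : K d a = 0 := by rw [H.symm]; exact had
  have hcb : K c b = 0 := by rw [H.symm]; exact hbc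
  have hdb : K d b = 0 := by rw [H.symm]; exact hbd
  have hdc : K d c = 0 := by rw [H.symm]; exact hcd
  have hcdΦ : c + d ∈ D.roots := by
    have := H.neg_mem hδ
    rwa [ecd, neg_neg] at this
  have hbaΦ : b + a ∈ D.roots := by rwa [add_comm]
  have hdcΦ : d + c ∈ D.roots := by rwa [add_comm]
  have minus : ∀ x : V, K x d = 0 → x + d ∈ D.roots → x - d ∈ D.roots := by
    intro x h h1
    have := H.sub_two_mem h1 hd nd (by simp only [map_add, LinearMap.add_apply]; linarith)
    convert this using 1; rw [two_smul]; abel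
  by_cases hall : a + d ∈ D.roots
  · have hbdΦ : b + d ∈ D.roots := plus_trans D H hd nb na nd hba had hbd hbaΦ hall
    refine Van.at D (van_L3 D H hd ha hb hc (minus a had hall) (minus b hbd hbdΦ)
      (minus c hcd hcdΦ) ?_ ?_ ?_) δ
    all_goals
      simp only [map_add, LinearMap.add_apply, map_sub, LinearMap.sub_apply]; linarith
  · have hac' : a + c ∉ D.roots := fun h =>
      hall (plus_trans D H hd na nc nd hac hcd had h hcdΦ)
    have hbd' : b + d ∉ D.roots := fun h =>
      hall (plus_trans D H hd na nb nd hab hbd had eab h)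
    have hbc' : b + c ∉ D.roots := fun h =>
      hac' (plus_trans D H hc na nb nc hab hbc hac eab h)
    have comm : ∀ p q : V, p ∈ D.roots → q ∈ D.roots → K p p = 2 → K q q = 2 → K p q = 0 →
        p + q ∉ D.roots → ∀ x ∈ D.rs p, ∀ y ∈ D.rs q, ∀ v : L, ⁅x, ⁅y, v⁆⁆ = ⁅y, ⁅x, v⁆⁆ := by
      intro p q hp hq np nq hpq hn x hx y hy v
      rw [leibniz_lie, D.bracket_eq_zero p hp q hq hn ?_ x hx y hy, zero_lie, zero_add]
      intro h
      have := H.add_add p q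
      rw [h] at this
      simp only [map_zero] at this
      linarith
    intro x1 h1 x2 h2 x3 h3 x4 h4 y hy
    have c13 := comm a c ha hc na nc hac hac' x1 h1 x3 h3
    have c14 := comm a d ha hd na nd had hall x1 h1 x4 h4
    have c23 := comm b c hb hc nb nc hbc hbc' x2 h2 x3 h3
    have c24 := comm b d hb hd nb nd hbd hbd' x2 h2 x4 h4
    have z1 : ⁅x1, y⁆ = 0 := bz D H ha hδ (by
      rw [ecd]
      simp only [map_add, LinearMap.add_apply, map_neg, LinearMap.neg_apply]; linarith) h1 hy
    have z2 : ⁅x2, y⁆ = 0 := bz D H hb hδ (by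
      rw [ecd]
      simp only [map_add, LinearMap.add_apply, map_neg, LinearMap.neg_apply]; linarith) h2 hy
    simp only [S4, sym4, sym3, sym2, LinearMap.add_apply, Module.End.mul_apply,
      LieAlgebra.ad_apply, lie_add, c13, c14, c23, c24, z1, z2, lie_zero, add_zero]

end Grade

end BSP

namespace BSP

/-- Integrality and bounds of a pairing with prescribed norms. -/
def PR (K : V →ₗ[ℝ] V →ₗ[ℝ] ℝ) (x y : V) (n m k : ℤ) : Prop :=
  K x y = k ∧ K y x = k ∧ -(n + m) ≤ 2 * k ∧ 2 * k ≤ n + m ∧ (n = 4 ∨ m = 4 → k % 2 = 0)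

lemma exists_PR {Φ : Set V} {K : V →ₗ[ℝ] V →ₗ[ℝ] ℝ} (H : KForm Φ K) {x y : V} (hx : x ∈ Φ)
    (hy : y ∈ Φ) {n m : ℤ} (hn : K x x = n) (hm : K y y = m) : ∃ k : ℤ, PR K x y n m k := by
  obtain ⟨k, hk⟩ := H.int x hx y hy
  obtain ⟨h1, h2⟩ := H.bounds (α := x) (β := y)
  rw [hn, hm, hk] at h1 h2
  refine ⟨k, hk, by rw [H.symm]; exact hk, by exact_mod_cast h1, by exact_mod_cast h2, ?_⟩
  have key : (∃ j : ℤ, K x y = 2 * j) → k % 2 = 0 := by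
    rintro ⟨j, hj⟩
    rw [hk] at hj
    have : k = 2 * j := by exact_mod_cast hj
    omega
  rintro (h | h)
  · apply key
    rw [H.symm]
    exact H.even y hy x hx (by rw [hn, h]; norm_num)
  · apply key
    exact H.even x hx y hy (by rw [hm, h]; norm_num)

lemma data {Φ : Set V} {K : V →ₗ[ℝ] V →ₗ[ℝ] ℝ} (H : KForm Φ K) {a b c d δ ε : V}
    (ha : a ∈ Φ) (hb : b ∈ Φ) (hc : c ∈ Φ) (hd : d ∈ Φ) (hδ : δ ∈ Φ) (hε : ε ∈ Φ)
    (e : ε = a + b + c + d + δ) {na nb nc nd nδ nε : ℤ} (na' : K a a = na) (nb' : K b b = nb)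
    (nc' : K c c = nc) (nd' : K d d = nd) (nδ' : K δ δ = nδ) (nε' : K ε ε = nε) :
    ∃ kab kac kad kbc kbd kcd ta tb tc td ea eb ec ed t : ℤ,
      (ea = na + kab + kac + kad + ta ∧ eb = kab + nb + kbc + kbd + tb ∧ ec = kac + kbc + nc + kcd + tc ∧ ed = kad + kbd + kcd + nd + td ∧ t = ta + tb + tc + td + nδ ∧ nε = ea + eb + ec + ed + t) ∧
      PR K a b na nb kab ∧ PR K a c na nc kac ∧ PR K a d na nd kad ∧ PR K b c nb nc kbc ∧ PR K b d nb nd kbd ∧ PR K c d nc nd kcd ∧ PR K δ a nδ na ta ∧ PR K δ b nδ nb tb ∧ PR K δ c nδ nc tc ∧ PR K δ d nδ nd td ∧ PR K ε a nε na ea ∧ PR K ε b nε nb eb ∧ PR K ε c nε nc ec ∧ PR K ε d nε nd ed ∧ PR K ε δ nε nδ t := by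
  obtain ⟨kab, hkab⟩ := exists_PR H ha hb na' nb'
  obtain ⟨kac, hkac⟩ := exists_PR H ha hc na' nc'
  obtain ⟨kad, hkad⟩ := exists_PR H ha hd na' nd'
  obtain ⟨kbc, hkbc⟩ := exists_PR H hb hc nb' nc'
  obtain ⟨kbd, hkbd⟩ := exists_PR H hb hd nb' nd'
  obtain ⟨kcd, hkcd⟩ := exists_PR H hc hd nc' nd'
  obtain ⟨ta, hta⟩ := exists_PR H hδ ha nδ' na'
  obtain ⟨tb, htb⟩ := exists_PR H hδ hb nδ' nb'
  obtain ⟨tc, htc⟩ := exists_PR H hδ hc nδ' nc'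
  obtain ⟨td, htd⟩ := exists_PR H hδ hd nδ' nd'
  obtain ⟨ea, hea⟩ := exists_PR H hε ha nε' na'
  obtain ⟨eb, heb⟩ := exists_PR H hε hb nε' nb'
  obtain ⟨ec, hec⟩ := exists_PR H hε hc nε' nc'
  obtain ⟨ed, hed⟩ := exists_PR H hε hd nε' nd'
  obtain ⟨t, ht⟩ := exists_PR H hε hδ nε' nδ'
  have nε : ∀ x : V, K ε x = K a x + K b x + K c x + K d x + K δ x := by
    intro x
    rw [e]; simp only [map_add, LinearMap.add_apply]
  refine ⟨kab, kac, kad, kbc, kbd, kcd, ta, tb, tc, td, ea, eb, ec, ed, t, ⟨?_, ?_, ?_, ?_, ?_, ?_⟩, hkab, hkac, hkad, hkbc, hkbd, hkcd, hta, htb, htc, htd, hea, heb, hec, hed, ht⟩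
  · have := nε a
    rw [hea.1, na', H.symm b a, hkab.1, H.symm c a, hkac.1, H.symm d a, hkad.1, hta.1] at this
    exact_mod_cast this
  · have := nε b
    rw [heb.1, nb', hkab.1, H.symm c b, hkbc.1, H.symm d b, hkbd.1, htb.1] at this
    exact_mod_cast this
  · have := nε c
    rw [hec.1, nc', hkac.1, hkbc.1, H.symm d c, hkcd.1, htc.1] at this
    exact_mod_cast this
  · have := nε d
    rw [hed.1, nd', hkad.1, hkbd.1, hkcd.1, htd.1] at this
    exact_mod_cast this
  · have := nε δ
    rw [ht.1, nδ', H.symm a δ, hta.1, H.symm b δ, htb.1, H.symm c δ, htc.1, H.symm d δ,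
      htd.1] at this
    exact_mod_cast this
  · have := nε ε
    rw [nε', H.symm a ε, hea.1, H.symm b ε, heb.1, H.symm c ε, hec.1, H.symm d ε, hed.1,
      H.symm δ ε, ht.1] at this
    exact_mod_cast this

lemma cst2 {r : ℝ} (h : r = 2) : r = ((2 : ℤ) : ℝ) := by rw [h]; norm_num

lemma cst4 {r : ℝ} (h : r = 4) : r = ((4 : ℤ) : ℝ) := by rw [h]; norm_num

lemma int_neg {K : V →ₗ[ℝ] V →ₗ[ℝ] ℝ} {x y δ : V} {k t : ℤ} (q : δ = -x) (h1 : K x y = k)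
    (h2 : K δ y = t) : t = -k := by
  rw [q, map_neg, LinearMap.neg_apply, h1] at h2
  exact_mod_cast h2.symm

lemma int_eq {K : V →ₗ[ℝ] V →ₗ[ℝ] ℝ} {x y ε : V} {k t : ℤ} (q : ε = x) (h1 : K x y = k)
    (h2 : K ε y = t) : t = k := by
  rw [q, h1] at h2
  exact_mod_cast h2.symm

lemma two_eps {a b c d δ ε : V} (e : ε = a + b + c + d + δ) (q : ε = -δ) :
    (2:ℝ) • ε = a + b + c + d := by
  rw [two_smul]; nth_rewrite 1 [e]; rw [q]; abel

lemma cdata {Φ Ψ C : Set V} {K : V →ₗ[ℝ] V →ₗ[ℝ] ℝ} (H : KForm Φ K) (S : Sgn Φ K Ψ C)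
    {a b c d δ ε : V} (ha : a ∈ Ψ) (hb : b ∈ Ψ) (hc : c ∈ Ψ) (hd : d ∈ Ψ) (hδ : δ ∈ Φ) (hε : ε ∈ Φ)
    (e : ε = a + b + c + d + δ) {na nb nc nd nδ nε : ℤ} (na' : K a a = na) (nb' : K b b = nb)
    (nc' : K c c = nc) (nd' : K d d = nd) (nδ' : K δ δ = nδ) (nε' : K ε ε = nε) :
    ∃ kab kac kad kbc kbd kcd ta tb tc td ea eb ec ed t : ℤ,
      (ea = na + kab + kac + kad + ta ∧ eb = kab + nb + kbc + kbd + tb ∧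
        ec = kac + kbc + nc + kcd + tc ∧ ed = kad + kbd + kcd + nd + td ∧
        t = ta + tb + tc + td + nδ ∧ nε = ea + eb + ec + ed + t) ∧
      nε + nδ = na + nb + nc + nd + 2 * (kab + kac + kad + kbc + kbd + kcd) + 2 * t ∧
      (0 ≤ kab ∧ 0 ≤ kac ∧ 0 ≤ kad ∧ 0 ≤ kbc ∧ 0 ≤ kbd ∧ 0 ≤ kcd) ∧
      PR K a b na nb kab ∧ PR K a c na nc kac ∧ PR K a d na nd kad ∧ PR K b c nb nc kbc ∧ PR K b d nb nd kbd ∧ PR K c d nc nd kcd ∧ PR K δ a nδ na ta ∧ PR K δ b nδ nb tb ∧ PR K δ c nδ nc tc ∧ PR K δ d nδ nd td ∧ PR K ε a nε na ea ∧ PR K ε b nε nb eb ∧ PR K ε c nε nc ec ∧ PR K ε d nε nd ed ∧ PR K ε δ nε nδ t := by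
  obtain ⟨kab, kac, kad, kbc, kbd, kcd, ta, tb, tc, td, ea, eb, ec, ed, t, q, hab, hac, had, hbc,
    hbd, hcd, hr⟩ := data H (S.psub ha) (S.psub hb) (S.psub hc) (S.psub hd) hδ hε e
      na' nb' nc' nd' nδ' nε'
  have key : ∀ x ∈ Ψ, ∀ y ∈ Ψ, ∀ k : ℤ, K x y = k → 0 ≤ k := by
    intro x hx y hy k hk
    have := S.nn x hx y hy
    rw [hk] at this
    exact_mod_cast this
  refine ⟨kab, kac, kad, kbc, kbd, kcd, ta, tb, tc, td, ea, eb, ec, ed, t, q, ?_,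
    ⟨key _ ha _ hb _ hab.1, key _ ha _ hc _ hac.1, key _ ha _ hd _ had.1, key _ hb _ hc _ hbc.1,
      key _ hb _ hd _ hbd.1, key _ hc _ hd _ hcd.1⟩, hab, hac, had, hbc, hbd, hcd, hr⟩
  obtain ⟨q1, q2, q3, q4, q5, q6⟩ := q
  clear hab hac had hbc hbd hcd hr
  omega

end BSP

namespace BSP

section Fin

variable {L : Type*} [LieRing L] [LieAlgebra ℂ L] (D : LieRootData V L)
variable {K : V →ₗ[ℝ] V →ₗ[ℝ] ℝ}

lemma KForm.eq_all {Φ : Set V} (H : KForm Φ K) {x y : V} {n : ℝ} (hx : K x x = n) (hy : K y y = n)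
    (hxy : K x y = n) : x = y := by
  apply H.eq_of; rw [hx, hy, hxy]; ring

lemma KForm.neg_all {Φ : Set V} (H : KForm Φ K) {x y : V} {n : ℝ} (hx : K x x = n) (hy : K y y = n)
    (hxy : K x y = -n) : x = -y := by
  apply H.eq_neg_of; rw [hx, hy, hxy]; ring

lemma KForm.eq_sum {Φ : Set V} (H : KForm Φ K) {ε x y : V} (nε : K ε ε = 4) (nx : K x x = 2)
    (ny : K y y = 2) (hxy : K x y = 0) (h1 : K ε x = 2) (h2 : K ε y = 2) : ε = x + y := by
  apply H.eq_of
  rw [H.add_add, map_add, nε, nx, ny, hxy, h1, h2]; ring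

lemma KForm.eq_neg_sum {Φ : Set V} (H : KForm Φ K) {ε x y : V} (nε : K ε ε = 4) (nx : K x x = 2)
    (ny : K y y = 2) (hxy : K x y = 0) (h1 : K ε x = -2) (h2 : K ε y = -2) : ε = -(x + y) := by
  apply H.eq_neg_of
  rw [H.add_add, map_add, nε, nx, ny, hxy, h1, h2]; ring

lemma KForm.sub_of_sum {Φ : Set V} (H : KForm Φ K) {x y : V} (hy : y ∈ Φ) (ny : K y y = 2)
    (hxy : K x y = 0) (h : x + y ∈ Φ) : x - y ∈ Φ := by
  have := H.sub_two_mem h hy ny (by simp only [map_add, LinearMap.add_apply]; linarith)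
  convert this using 1; rw [two_smul]; abel

lemma fin_split (H : KForm D.roots K) {x y z w δ ε : V} (hx : x ∈ D.roots) (hy : y ∈ D.roots)
    (hz : z ∈ D.roots) (hw : w ∈ D.roots) (hδ : δ ∈ D.roots) (hε : ε ∈ D.roots)
    (nx : K x x = 2) (ny : K y y = 2) (nz : K z z = 2) (nw : K w w = 2) (nδ : K δ δ = 4)
    (nε : K ε ε = 4) (hxy : K x y = 0) (hxz : K x z = 0) (hxw : K x w = 0) (hyz : K y z = 0)
    (hyw : K y w = 0) (hzw : K z w = 0) (ex : K ε x = 2) (ey : K ε y = 2) (tz : K δ z = -2)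
    (tw : K δ w = -2) : VanAt D δ x y z w :=
  vanAt_split D H hx hy hz hw hδ nx ny nz nw hxy hxz hxw hyz hyw hzw
    (by rw [← H.eq_sum nε nx ny hxy ex ey]; exact hε) (H.eq_neg_sum nδ nz nw hzw tz tw)

lemma fin_z3 (H : KForm D.roots K) {x y z w δ ε : V} (hx : x ∈ D.roots)
    (hz : z ∈ D.roots) (hw : w ∈ D.roots) (hδ : δ ∈ D.roots) (hε : ε ∈ D.roots)
    (nx : K x x = 2) (ny : K y y = 2) (nz : K z z = 2) (nw : K w w = 2) (nδ : K δ δ = 4)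
    (nε : K ε ε = 4) (hxy : K x y = 2) (hxz : K x z = 0) (hxw : K x w = 0)
    (hzw : K z w = 0) (ex : K ε x = 2) (tx : K δ x = -2)
    (h : (K ε z = 2 ∧ K δ w = -2) ∨ (K ε w = 2 ∧ K δ z = -2)) : VanAt D δ x y z w := by
  obtain rfl : x = y := H.eq_all nx ny hxy
  have hzx : K z x = 0 := by rw [H.symm]; exact hxz
  have hwx : K w x = 0 := by rw [H.symm]; exact hxw
  have hwz : K w z = 0 := by rw [H.symm]; exact hzw
  have h1 : z + x ∈ D.roots ∧ w + x ∈ D.roots := by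
    rcases h with ⟨h1, h2⟩ | ⟨h1, h2⟩
    · constructor
      · rw [← H.eq_sum nε nz nx hzx h1 ex]; exact hε
      · have := H.neg_mem hδ
        rwa [H.eq_neg_sum nδ nw nx hwx h2 tx, neg_neg] at this
    · constructor
      · have := H.neg_mem hδ
        rwa [H.eq_neg_sum nδ nz nx hzx h2 tx, neg_neg] at this
      · rw [← H.eq_sum nε nw nx hwx h1 ex]; exact hε
  have v := van_L2 D H hx hz hw (H.sub_of_sum hx nx hzx h1.1) (H.sub_of_sum hx nx hwx h1.2) (by
    simp only [map_add, map_sub, LinearMap.add_apply, LinearMap.sub_apply]; linarith)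
  have v := Van.at D v δ
  exact (v.s23.s12.s34.s23)

lemma fin_z1 (H : KForm D.roots K) {x y z w δ ε : V} (hx : x ∈ D.roots)
    (hz : z ∈ D.roots) (hε : ε ∈ D.roots)
    (nx : K x x = 2) (ny : K y y = 2) (nz : K z z = 2) (nw : K w w = 2)
    (nε : K ε ε = 4) (hxy : K x y = 2) (hxz : K x z = 0)
    (hzw : K z w = 2) (ex : K ε x = 2) (ez : K ε z = 2) : VanAt D δ x y z w := by
  obtain rfl : x = y := H.eq_all nx ny hxy
  obtain rfl : z = w := H.eq_all nz nw hzw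
  have hzx : K z x = 0 := by rw [H.symm]; exact hxz
  have h1 : x - z ∈ D.roots := H.sub_of_sum hz nz hxz (by
    rw [← H.eq_sum nε nx nz hxz ex ez]; exact hε)
  exact Van.at D (van_L2 D H hz hx hx h1 h1 (by
    simp only [map_add, map_sub, LinearMap.add_apply, LinearMap.sub_apply]; linarith)) δ

lemma fin_cycle (H : KForm D.roots K) {x y z w δ ε : V} (hx : x ∈ D.roots) (hy : y ∈ D.roots)
    (hz : z ∈ D.roots) (hw : w ∈ D.roots) (hε : ε ∈ D.roots)
    (nx : K x x = 2) (ny : K y y = 2) (nz : K z z = 2) (nw : K w w = 2)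
    (nε : K ε ε = 4) (hxy : K x y = 1) (hxz : K x z = 0) (hxw : K x w = 1) (hyz : K y z = 1)
    (hyw : K y w = 0) (hzw : K z w = 1) (ex : K ε x = 2) (ey : K ε y = 2) (ez : K ε z = 2)
    (ew : K ε w = 2) : VanAt D δ x y z w := by
  have e1 := H.eq_sum nε nx nz hxz ex ez
  have e2 := H.eq_sum nε ny nw hyw ey ew
  have v := Van.at D (van_cycle D H hx hy hz hw nx ny nz nw hxy hyz hzw hxw hyw
    (by rw [← e2]; exact hε) (e1.symm.trans e2)) δ
  exact v.s23.s12.s34.s23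

end Fin

end BSP

namespace BSP

section Core

variable {L : Type*} [LieRing L] [LieAlgebra ℂ L] (D : LieRootData V L)
variable {K : V →ₗ[ℝ] V →ₗ[ℝ] ℝ} {Ψ C : Set V}

set_option maxHeartbeats 4000000 in
lemma core_ssss (H : KForm D.roots K) (S : Sgn D.roots K Ψ C) {a b c d δ ε : V}
    (ha : a ∈ Ψ) (hb : b ∈ Ψ) (hc : c ∈ Ψ) (hd : d ∈ Ψ) (hδ : δ ∈ D.roots) (hε : ε ∈ D.roots)
    (e : ε = a + b + c + d + δ) (na : K a a = 2) (nb : K b b = 2) (nc : K c c = 2) (nd : K d d = 2) :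
    VanAt D δ a b c d := by
  have na' := cst2 na
  have nb' := cst2 nb
  have nc' := cst2 nc
  have nd' := cst2 nd
  rcases H.norm δ hδ with nδ | nδ <;> rcases H.norm ε hε with nε | nε
  · obtain ⟨kab, kac, kad, kbc, kbd, kcd, ta, tb, tc, td, ea, eb, ec, ed, t, ⟨q1, q2, q3, q4, q5, q6⟩, qs,
      ⟨pab, pac, pad, pbc, pbd, pcd⟩, hkab, hkac, hkad, hkbc, hkbd, hkcd, hta, htb, htc, htd, hea, heb, hec, hed, ht⟩ :=
      cdata H S ha hb hc hd hδ hε e na' nb' nc' nd' (cst2 nδ) (cst2 nε)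
    norm_num [PR] at qs hkab hkac hkad hkbc hkbd hkcd hta htb htc htd hea heb hec hed ht
    have h : t = -2 := by
      clear hkab hkac hkad hkbc hkbd hkcd hta htb htc htd hea heb hec hed q1 q2 q3 q4 q5 q6
      omega
    obtain ⟨k1, k2, k3, k4, k5, k6⟩ : kab = 0 ∧ kac = 0 ∧ kad = 0 ∧ kbc = 0 ∧ kbd = 0 ∧ kcd = 0 := by
      clear hkab hkac hkad hkbc hkbd hkcd hta htb htc htd hea heb hec hed ht q1 q2 q3 q4 q5 q6
      omega
    have q := H.neg_all nε nδ (by rw [ht.1, h]; norm_num)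
    have ra := int_neg q hta.1 hea.1
    have rb := int_neg q htb.1 heb.1
    have rc := int_neg q htc.1 hec.1
    have rd := int_neg q htd.1 hed.1
    have hs := two_eps e q
    exfalso
    refine S.excl1 H hε ha hb hc hd hs ?_ ?_ ?_ ?_ ?_ <;>
      (simp only [hkab.1, hkac.1, hkad.1, hkbc.1, hkbd.1, hkcd.1, hta.1, htb.1, htc.1, htd.1, hea.1, heb.1, hec.1, hed.1, hkab.2.1, hkac.2.1, hkad.2.1, hkbc.2.1, hkbd.2.1, hkcd.2.1]; norm_cast)
  · obtain ⟨kab, kac, kad, kbc, kbd, kcd, ta, tb, tc, td, ea, eb, ec, ed, t, ⟨q1, q2, q3, q4, q5, q6⟩, qs,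
      ⟨pab, pac, pad, pbc, pbd, pcd⟩, hkab, hkac, hkad, hkbc, hkbd, hkcd, hta, htb, htc, htd, hea, heb, hec, hed, ht⟩ :=
      cdata H S ha hb hc hd hδ hε e na' nb' nc' nd' (cst2 nδ) (cst4 nε)
    norm_num [PR] at qs hkab hkac hkad hkbc hkbd hkcd hta htb htc htd hea heb hec hed ht
    exfalso
    have u1 : t = -2 := by
      clear hkab hkac hkad hkbc hkbd hkcd hta htb htc htd hea heb hec hed q1 q2 q3 q4 q5 q6
      omega
    have sk : kab + kac + kad + kbc + kbd + kcd = 1 := by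
      clear hkab hkac hkad hkbc hkbd hkcd hta htb htc htd hea heb hec hed ht pab pac pad pbc pbd pcd q1 q2 q3 q4 q5 q6
      omega
    have u : ta = -2 ∨ tb = -2 ∨ tc = -2 ∨ td = -2 := by
      by_contra hn
      push Not at hn
      obtain ⟨n1, n2, n3, n4⟩ := hn
      have ma : ta ≥ -1 := by
        clear hkab hkac hkad hkbc hkbd hkcd htb htc htd hea heb hec hed ht pab pac pad pbc pbd pcd q1 q2 q3 q4 q5 q6 qs
        omega
      have mb : tb ≥ -1 := by
        clear hkab hkac hkad hkbc hkbd hkcd hta htc htd hea heb hec hed ht pab pac pad pbc pbd pcd q1 q2 q3 q4 q5 q6 qs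
        omega
      have mc : tc ≥ -1 := by
        clear hkab hkac hkad hkbc hkbd hkcd hta htb htd hea heb hec hed ht pab pac pad pbc pbd pcd q1 q2 q3 q4 q5 q6 qs
        omega
      have md : td ≥ -1 := by
        clear hkab hkac hkad hkbc hkbd hkcd hta htb htc hea heb hec hed ht pab pac pad pbc pbd pcd q1 q2 q3 q4 q5 q6 qs
        omega
      have wa : ta = -1 := by
        clear hkab hkac hkad hkbc hkbd hkcd hta htb htc htd hea heb hec hed ht pab pac pad pbc pbd pcd q1 q2 q3 q4 q6 qs
        omega
      have wb : tb = -1 := by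
        clear hkab hkac hkad hkbc hkbd hkcd hta htb htc htd hea heb hec hed ht pab pac pad pbc pbd pcd q1 q2 q3 q4 q6 qs
        omega
      have wc : tc = -1 := by
        clear hkab hkac hkad hkbc hkbd hkcd hta htb htc htd hea heb hec hed ht pab pac pad pbc pbd pcd q1 q2 q3 q4 q6 qs
        omega
      have wd : td = -1 := by
        clear hkab hkac hkad hkbc hkbd hkcd hta htb htc htd hea heb hec hed ht pab pac pad pbc pbd pcd q1 q2 q3 q4 q6 qs
        omega
      have za : 1 ≤ kab + kac + kad := by
        clear hkab hkac hkad hkbc hkbd hkcd hta htb htc htd heb hec hed ht q2 q3 q4 q5 q6 qs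
        omega
      have zb : 1 ≤ kab + kbc + kbd := by
        clear hkab hkac hkad hkbc hkbd hkcd hta htb htc htd hea hec hed ht q1 q3 q4 q5 q6 qs
        omega
      have zc : 1 ≤ kac + kbc + kcd := by
        clear hkab hkac hkad hkbc hkbd hkcd hta htb htc htd hea heb hed ht q1 q2 q4 q5 q6 qs
        omega
      have zd : 1 ≤ kad + kbd + kcd := by
        clear hkab hkac hkad hkbc hkbd hkcd hta htb htc htd hea heb hec ht q1 q2 q3 q5 q6 qs
        omega
      clear hkab hkac hkad hkbc hkbd hkcd hta htb htc htd hea heb hec hed ht pab pac pad pbc pbd pcd q1 q2 q3 q4 q5 q6 qs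
      omega
    rcases u with h | h | h | h
    · have q := H.neg_all nδ na (by rw [hta.1, h]; norm_num)
      have rb := int_neg q hkab.1 htb.1
      have rc := int_neg q hkac.1 htc.1
      have rd := int_neg q hkad.1 htd.1
      clear hkab hkac hkad hkbc hkbd hkcd hta htb htc htd hea heb hec hed ht q1 q2 q3 q4 q6 qs
      omega
    · have q := H.neg_all nδ nb (by rw [htb.1, h]; norm_num)
      have ra := int_neg q hkab.2.1 hta.1
      have rc := int_neg q hkbc.1 htc.1
      have rd := int_neg q hkbd.1 htd.1
      clear hkab hkac hkad hkbc hkbd hkcd hta htb htc htd hea heb hec hed ht q1 q2 q3 q4 q6 qs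
      omega
    · have q := H.neg_all nδ nc (by rw [htc.1, h]; norm_num)
      have ra := int_neg q hkac.2.1 hta.1
      have rb := int_neg q hkbc.2.1 htb.1
      have rd := int_neg q hkcd.1 htd.1
      clear hkab hkac hkad hkbc hkbd hkcd hta htb htc htd hea heb hec hed ht q1 q2 q3 q4 q6 qs
      omega
    · have q := H.neg_all nδ nd (by rw [htd.1, h]; norm_num)
      have ra := int_neg q hkad.2.1 hta.1
      have rb := int_neg q hkbd.2.1 htb.1
      have rc := int_neg q hkcd.2.1 htc.1
      clear hkab hkac hkad hkbc hkbd hkcd hta htb htc htd hea heb hec hed ht q1 q2 q3 q4 q6 qs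
      omega
  · obtain ⟨kab, kac, kad, kbc, kbd, kcd, ta, tb, tc, td, ea, eb, ec, ed, t, ⟨q1, q2, q3, q4, q5, q6⟩, qs,
      ⟨pab, pac, pad, pbc, pbd, pcd⟩, hkab, hkac, hkad, hkbc, hkbd, hkcd, hta, htb, htc, htd, hea, heb, hec, hed, ht⟩ :=
      cdata H S ha hb hc hd hδ hε e na' nb' nc' nd' (cst4 nδ) (cst2 nε)
    norm_num [PR] at qs hkab hkac hkad hkbc hkbd hkcd hta htb htc htd hea heb hec hed ht
    exfalso
    have u1 : t = -2 := by
      clear hkab hkac hkad hkbc hkbd hkcd hta htb htc htd hea heb hec hed q1 q2 q3 q4 q5 q6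
      omega
    have sk : kab + kac + kad + kbc + kbd + kcd = 1 := by
      clear hkab hkac hkad hkbc hkbd hkcd hta htb htc htd hea heb hec hed ht pab pac pad pbc pbd pcd q1 q2 q3 q4 q5 q6
      omega
    have u : ea = 2 ∨ eb = 2 ∨ ec = 2 ∨ ed = 2 := by
      by_contra hn
      push Not at hn
      obtain ⟨n1, n2, n3, n4⟩ := hn
      have ma : ea ≤ 1 := by
        clear hkab hkac hkad hkbc hkbd hkcd hta htb htc htd heb hec hed ht pab pac pad pbc pbd pcd q1 q2 q3 q4 q5 q6 qs
        omega
      have mb : eb ≤ 1 := by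
        clear hkab hkac hkad hkbc hkbd hkcd hta htb htc htd hea hec hed ht pab pac pad pbc pbd pcd q1 q2 q3 q4 q5 q6 qs
        omega
      have mc : ec ≤ 1 := by
        clear hkab hkac hkad hkbc hkbd hkcd hta htb htc htd hea heb hed ht pab pac pad pbc pbd pcd q1 q2 q3 q4 q5 q6 qs
        omega
      have md : ed ≤ 1 := by
        clear hkab hkac hkad hkbc hkbd hkcd hta htb htc htd hea heb hec ht pab pac pad pbc pbd pcd q1 q2 q3 q4 q5 q6 qs
        omega
      have wa : ea = 1 := by
        clear hkab hkac hkad hkbc hkbd hkcd hta htb htc htd hea heb hec hed ht pab pac pad pbc pbd pcd q1 q2 q3 q4 q5 qs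
        omega
      have wb : eb = 1 := by
        clear hkab hkac hkad hkbc hkbd hkcd hta htb htc htd hea heb hec hed ht pab pac pad pbc pbd pcd q1 q2 q3 q4 q5 qs
        omega
      have wc : ec = 1 := by
        clear hkab hkac hkad hkbc hkbd hkcd hta htb htc htd hea heb hec hed ht pab pac pad pbc pbd pcd q1 q2 q3 q4 q5 qs
        omega
      have wd : ed = 1 := by
        clear hkab hkac hkad hkbc hkbd hkcd hta htb htc htd hea heb hec hed ht pab pac pad pbc pbd pcd q1 q2 q3 q4 q5 qs
        omega
      have za : 1 ≤ kab + kac + kad := by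
        clear hkab hkac hkad hkbc hkbd hkcd htb htc htd hea heb hec hed ht q2 q3 q4 q5 q6 qs
        omega
      have zb : 1 ≤ kab + kbc + kbd := by
        clear hkab hkac hkad hkbc hkbd hkcd hta htc htd hea heb hec hed ht q1 q3 q4 q5 q6 qs
        omega
      have zc : 1 ≤ kac + kbc + kcd := by
        clear hkab hkac hkad hkbc hkbd hkcd hta htb htd hea heb hec hed ht q1 q2 q4 q5 q6 qs
        omega
      have zd : 1 ≤ kad + kbd + kcd := by
        clear hkab hkac hkad hkbc hkbd hkcd hta htb htc hea heb hec hed ht q1 q2 q3 q5 q6 qs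
        omega
      clear hkab hkac hkad hkbc hkbd hkcd hta htb htc htd hea heb hec hed ht pab pac pad pbc pbd pcd q1 q2 q3 q4 q5 q6 qs
      omega
    rcases u with h | h | h | h
    · have q := H.eq_all nε na (by rw [hea.1, h]; norm_num)
      have rb := int_eq q hkab.1 heb.1
      have rc := int_eq q hkac.1 hec.1
      have rd := int_eq q hkad.1 hed.1
      clear hkab hkac hkad hkbc hkbd hkcd hta htb htc htd hea heb hec hed ht q1 q2 q3 q4 q5 qs
      omega
    · have q := H.eq_all nε nb (by rw [heb.1, h]; norm_num)
      have ra := int_eq q hkab.2.1 hea.1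
      have rc := int_eq q hkbc.1 hec.1
      have rd := int_eq q hkbd.1 hed.1
      clear hkab hkac hkad hkbc hkbd hkcd hta htb htc htd hea heb hec hed ht q1 q2 q3 q4 q5 qs
      omega
    · have q := H.eq_all nε nc (by rw [hec.1, h]; norm_num)
      have ra := int_eq q hkac.2.1 hea.1
      have rb := int_eq q hkbc.2.1 heb.1
      have rd := int_eq q hkcd.1 hed.1
      clear hkab hkac hkad hkbc hkbd hkcd hta htb htc htd hea heb hec hed ht q1 q2 q3 q4 q5 qs
      omega
    · have q := H.eq_all nε nd (by rw [hed.1, h]; norm_num)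
      have ra := int_eq q hkad.2.1 hea.1
      have rb := int_eq q hkbd.2.1 heb.1
      have rc := int_eq q hkcd.2.1 hec.1
      clear hkab hkac hkad hkbc hkbd hkcd hta htb htc htd hea heb hec hed ht q1 q2 q3 q4 q5 qs
      omega
  · obtain ⟨kab, kac, kad, kbc, kbd, kcd, ta, tb, tc, td, ea, eb, ec, ed, t, ⟨q1, q2, q3, q4, q5, q6⟩, qs,
      ⟨pab, pac, pad, pbc, pbd, pcd⟩, hkab, hkac, hkad, hkbc, hkbd, hkcd, hta, htb, htc, htd, hea, heb, hec, hed, ht⟩ :=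
      cdata H S ha hb hc hd hδ hε e na' nb' nc' nd' (cst4 nδ) (cst4 nε)
    norm_num [PR] at qs hkab hkac hkad hkbc hkbd hkcd hta htb htc htd hea heb hec hed ht
    have u : t = 0 ∨ t = -2 ∨ t = -4 := by
      clear hkab hkac hkad hkbc hkbd hkcd hta htb htc htd hea heb hec hed q1 q2 q3 q4 q5 q6
      omega
    rcases u with h | h | h
    · obtain ⟨k1, k2, k3, k4, k5, k6⟩ : kab = 0 ∧ kac = 0 ∧ kad = 0 ∧ kbc = 0 ∧ kbd = 0 ∧ kcd = 0 := by
        clear hkab hkac hkad hkbc hkbd hkcd hta htb htc htd hea heb hec hed ht q1 q2 q3 q4 q5 q6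
        omega
      have va : ea = 0 ∨ ea = 2 := by
        clear hkab hkac hkad hkbc hkbd hkcd htb htc htd heb hec hed ht pab pac pad pbc pbd pcd q2 q3 q4 q5 q6 qs
        omega
      have vb : eb = 0 ∨ eb = 2 := by
        clear hkab hkac hkad hkbc hkbd hkcd hta htc htd hea hec hed ht pab pac pad pbc pbd pcd q1 q3 q4 q5 q6 qs
        omega
      have vc : ec = 0 ∨ ec = 2 := by
        clear hkab hkac hkad hkbc hkbd hkcd hta htb htd hea heb hed ht pab pac pad pbc pbd pcd q1 q2 q4 q5 q6 qs
        omega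
      have vd : ed = 0 ∨ ed = 2 := by
        clear hkab hkac hkad hkbc hkbd hkcd hta htb htc hea heb hec ht pab pac pad pbc pbd pcd q1 q2 q3 q5 q6 qs
        omega
      have wa : ta = ea - 2 := by
        clear hkab hkac hkad hkbc hkbd hkcd hta htb htc htd hea heb hec hed ht pab pac pad pbc pbd pcd q2 q3 q4 q5 q6 qs
        omega
      have wb : tb = eb - 2 := by
        clear hkab hkac hkad hkbc hkbd hkcd hta htb htc htd hea heb hec hed ht pab pac pad pbc pbd pcd q1 q3 q4 q5 q6 qs
        omega
      have wc : tc = ec - 2 := by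
        clear hkab hkac hkad hkbc hkbd hkcd hta htb htc htd hea heb hec hed ht pab pac pad pbc pbd pcd q1 q2 q4 q5 q6 qs
        omega
      have wd : td = ed - 2 := by
        clear hkab hkac hkad hkbc hkbd hkcd hta htb htc htd hea heb hec hed ht pab pac pad pbc pbd pcd q1 q2 q3 q5 q6 qs
        omega
      rcases va with va | va <;> rcases vb with vb | vb <;> rcases vc with vc | vc <;> rcases vd with vd | vd
      · exfalso
        clear hkab hkac hkad hkbc hkbd hkcd hta htb htc htd hea heb hec hed ht pab pac pad pbc pbd pcd q1 q2 q3 q4 q5 qs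
        omega
      · exfalso
        clear hkab hkac hkad hkbc hkbd hkcd hta htb htc htd hea heb hec hed ht pab pac pad pbc pbd pcd q1 q2 q3 q4 q5 qs
        omega
      · exfalso
        clear hkab hkac hkad hkbc hkbd hkcd hta htb htc htd hea heb hec hed ht pab pac pad pbc pbd pcd q1 q2 q3 q4 q5 qs
        omega
      · have ya : ta = -2 := by
          clear hkab hkac hkad hkbc hkbd hkcd hta htb htc htd hea heb hec hed ht pab pac pad pbc pbd pcd q1 q2 q3 q4 q5 q6 qs
          omega
        have yb : tb = -2 := by
          clear hkab hkac hkad hkbc hkbd hkcd hta htb htc htd hea heb hec hed ht pab pac pad pbc pbd pcd q1 q2 q3 q4 q5 q6 qs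
          omega
        have v : VanAt D δ c d a b := by
          refine fin_split D H (S.psub hc) (S.psub hd) (S.psub ha) (S.psub hb) hδ hε nc nd na nb nδ nε ?_ ?_ ?_ ?_ ?_ ?_ ?_ ?_ ?_ ?_ <;>
            (simp only [hkab.1, hkac.1, hkad.1, hkbc.1, hkbd.1, hkcd.1, hta.1, htb.1, htc.1, htd.1, hea.1, heb.1, hec.1, hed.1, hkab.2.1, hkac.2.1, hkad.2.1, hkbc.2.1, hkbd.2.1, hkcd.2.1]; norm_cast)
        exact v.s23.s12.s34.s23
      · exfalso
        clear hkab hkac hkad hkbc hkbd hkcd hta htb htc htd hea heb hec hed ht pab pac pad pbc pbd pcd q1 q2 q3 q4 q5 qs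
        omega
      · have ya : ta = -2 := by
          clear hkab hkac hkad hkbc hkbd hkcd hta htb htc htd hea heb hec hed ht pab pac pad pbc pbd pcd q1 q2 q3 q4 q5 q6 qs
          omega
        have yc : tc = -2 := by
          clear hkab hkac hkad hkbc hkbd hkcd hta htb htc htd hea heb hec hed ht pab pac pad pbc pbd pcd q1 q2 q3 q4 q5 q6 qs
          omega
        have v : VanAt D δ b d a c := by
          refine fin_split D H (S.psub hb) (S.psub hd) (S.psub ha) (S.psub hc) hδ hε nb nd na nc nδ nε ?_ ?_ ?_ ?_ ?_ ?_ ?_ ?_ ?_ ?_ <;>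
            (simp only [hkab.1, hkac.1, hkad.1, hkbc.1, hkbd.1, hkcd.1, hta.1, htb.1, htc.1, htd.1, hea.1, heb.1, hec.1, hed.1, hkab.2.1, hkac.2.1, hkad.2.1, hkbc.2.1, hkbd.2.1, hkcd.2.1]; norm_cast)
        exact v.s23.s12.s34
      · have ya : ta = -2 := by
          clear hkab hkac hkad hkbc hkbd hkcd hta htb htc htd hea heb hec hed ht pab pac pad pbc pbd pcd q1 q2 q3 q4 q5 q6 qs
          omega
        have yd : td = -2 := by
          clear hkab hkac hkad hkbc hkbd hkcd hta htb htc htd hea heb hec hed ht pab pac pad pbc pbd pcd q1 q2 q3 q4 q5 q6 qs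
          omega
        have v : VanAt D δ b c a d := by
          refine fin_split D H (S.psub hb) (S.psub hc) (S.psub ha) (S.psub hd) hδ hε nb nc na nd nδ nε ?_ ?_ ?_ ?_ ?_ ?_ ?_ ?_ ?_ ?_ <;>
            (simp only [hkab.1, hkac.1, hkad.1, hkbc.1, hkbd.1, hkcd.1, hta.1, htb.1, htc.1, htd.1, hea.1, heb.1, hec.1, hed.1, hkab.2.1, hkac.2.1, hkad.2.1, hkbc.2.1, hkbd.2.1, hkcd.2.1]; norm_cast)
        exact v.s23.s12
      · exfalso
        clear hkab hkac hkad hkbc hkbd hkcd hta htb htc htd hea heb hec hed ht pab pac pad pbc pbd pcd q1 q2 q3 q4 q5 qs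
        omega
      · exfalso
        clear hkab hkac hkad hkbc hkbd hkcd hta htb htc htd hea heb hec hed ht pab pac pad pbc pbd pcd q1 q2 q3 q4 q5 qs
        omega
      · have yb : tb = -2 := by
          clear hkab hkac hkad hkbc hkbd hkcd hta htb htc htd hea heb hec hed ht pab pac pad pbc pbd pcd q1 q2 q3 q4 q5 q6 qs
          omega
        have yc : tc = -2 := by
          clear hkab hkac hkad hkbc hkbd hkcd hta htb htc htd hea heb hec hed ht pab pac pad pbc pbd pcd q1 q2 q3 q4 q5 q6 qs
          omega
        have v : VanAt D δ a d b c := by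
          refine fin_split D H (S.psub ha) (S.psub hd) (S.psub hb) (S.psub hc) hδ hε na nd nb nc nδ nε ?_ ?_ ?_ ?_ ?_ ?_ ?_ ?_ ?_ ?_ <;>
            (simp only [hkab.1, hkac.1, hkad.1, hkbc.1, hkbd.1, hkcd.1, hta.1, htb.1, htc.1, htd.1, hea.1, heb.1, hec.1, hed.1, hkab.2.1, hkac.2.1, hkad.2.1, hkbc.2.1, hkbd.2.1, hkcd.2.1]; norm_cast)
        exact v.s23.s34
      · have yb : tb = -2 := by
          clear hkab hkac hkad hkbc hkbd hkcd hta htb htc htd hea heb hec hed ht pab pac pad pbc pbd pcd q1 q2 q3 q4 q5 q6 qs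
          omega
        have yd : td = -2 := by
          clear hkab hkac hkad hkbc hkbd hkcd hta htb htc htd hea heb hec hed ht pab pac pad pbc pbd pcd q1 q2 q3 q4 q5 q6 qs
          omega
        have v : VanAt D δ a c b d := by
          refine fin_split D H (S.psub ha) (S.psub hc) (S.psub hb) (S.psub hd) hδ hε na nc nb nd nδ nε ?_ ?_ ?_ ?_ ?_ ?_ ?_ ?_ ?_ ?_ <;>
            (simp only [hkab.1, hkac.1, hkad.1, hkbc.1, hkbd.1, hkcd.1, hta.1, htb.1, htc.1, htd.1, hea.1, heb.1, hec.1, hed.1, hkab.2.1, hkac.2.1, hkad.2.1, hkbc.2.1, hkbd.2.1, hkcd.2.1]; norm_cast)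
        exact v.s23
      · exfalso
        clear hkab hkac hkad hkbc hkbd hkcd hta htb htc htd hea heb hec hed ht pab pac pad pbc pbd pcd q1 q2 q3 q4 q5 qs
        omega
      · have yc : tc = -2 := by
          clear hkab hkac hkad hkbc hkbd hkcd hta htb htc htd hea heb hec hed ht pab pac pad pbc pbd pcd q1 q2 q3 q4 q5 q6 qs
          omega
        have yd : td = -2 := by
          clear hkab hkac hkad hkbc hkbd hkcd hta htb htc htd hea heb hec hed ht pab pac pad pbc pbd pcd q1 q2 q3 q4 q5 q6 qs
          omega
        have v : VanAt D δ a b c d := by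
          refine fin_split D H (S.psub ha) (S.psub hb) (S.psub hc) (S.psub hd) hδ hε na nb nc nd nδ nε ?_ ?_ ?_ ?_ ?_ ?_ ?_ ?_ ?_ ?_ <;>
            (simp only [hkab.1, hkac.1, hkad.1, hkbc.1, hkbd.1, hkcd.1, hta.1, htb.1, htc.1, htd.1, hea.1, heb.1, hec.1, hed.1, hkab.2.1, hkac.2.1, hkad.2.1, hkbc.2.1, hkbd.2.1, hkcd.2.1]; norm_cast)
        exact v
      · exfalso
        clear hkab hkac hkad hkbc hkbd hkcd hta htb htc htd hea heb hec hed ht pab pac pad pbc pbd pcd q1 q2 q3 q4 q5 qs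
        omega
      · exfalso
        clear hkab hkac hkad hkbc hkbd hkcd hta htb htc htd hea heb hec hed ht pab pac pad pbc pbd pcd q1 q2 q3 q4 q5 qs
        omega
      · exfalso
        clear hkab hkac hkad hkbc hkbd hkcd hta htb htc htd hea heb hec hed ht pab pac pad pbc pbd pcd q1 q2 q3 q4 q5 qs
        omega
    · have sk : kab + kac + kad + kbc + kbd + kcd = 2 := by
        clear hkab hkac hkad hkbc hkbd hkcd hta htb htc htd hea heb hec hed ht pab pac pad pbc pbd pcd q1 q2 q3 q4 q5 q6
        omega
      have wa : (kab + kac + kad) % 2 = 0 := by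
        clear hkab hkac hkad hkbc hkbd hkcd htb htc htd heb hec hed ht pab pac pad pbc pbd pcd q2 q3 q4 q5 q6 qs
        omega
      have wb : (kab + kbc + kbd) % 2 = 0 := by
        clear hkab hkac hkad hkbc hkbd hkcd hta htc htd hea hec hed ht pab pac pad pbc pbd pcd q1 q3 q4 q5 q6 qs
        omega
      have wc : (kac + kbc + kcd) % 2 = 0 := by
        clear hkab hkac hkad hkbc hkbd hkcd hta htb htd hea heb hed ht pab pac pad pbc pbd pcd q1 q2 q4 q5 q6 qs
        omega
      have wd : (kad + kbd + kcd) % 2 = 0 := by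
        clear hkab hkac hkad hkbc hkbd hkcd hta htb htc hea heb hec ht pab pac pad pbc pbd pcd q1 q2 q3 q5 q6 qs
        omega
      have u : kab = 2 ∨ kac = 2 ∨ kad = 2 ∨ kbc = 2 ∨ kbd = 2 ∨ kcd = 2 := by
        clear hkab hkac hkad hkbc hkbd hkcd hta htb htc htd hea heb hec hed ht q1 q2 q3 q4 q5 q6 qs
        omega
      rcases u with u | u | u | u | u | u
      · obtain ⟨k1, k2, k3, k4, k5⟩ : kac = 0 ∧ kad = 0 ∧ kbc = 0 ∧ kbd = 0 ∧ kcd = 0 := by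
          clear hkab hkac hkad hkbc hkbd hkcd hta htb htc htd hea heb hec hed ht q1 q2 q3 q4 q5 q6 qs
          omega
        have e0a : ea = 2 := by
          clear hkab hkac hkad hkbc hkbd hkcd htb htc htd heb hec hed ht pab pac pad pbc pbd pcd q2 q3 q4 q5 q6 qs
          omega
        have t0a : ta = -2 := by
          clear hkab hkac hkad hkbc hkbd hkcd hta htb htc htd hea heb hec hed ht pab pac pad pbc pbd pcd q2 q3 q4 q5 q6 qs
          omega
        have e0b : eb = 2 := by
          clear hkab hkac hkad hkbc hkbd hkcd hta htc htd hea hec hed ht pab pac pad pbc pbd pcd q1 q3 q4 q5 q6 qs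
          omega
        have t0b : tb = -2 := by
          clear hkab hkac hkad hkbc hkbd hkcd hta htb htc htd hea heb hec hed ht pab pac pad pbc pbd pcd q1 q3 q4 q5 q6 qs
          omega
        have f1 : ec + ed = 2 := by
          clear hkab hkac hkad hkbc hkbd hkcd hta htb htc htd hea heb hec hed ht pab pac pad pbc pbd pcd q1 q2 q3 q4 q5 qs
          omega
        have e0c : tc = ec - 2 := by
          clear hkab hkac hkad hkbc hkbd hkcd hta htb htc htd hea heb hec hed ht pab pac pad pbc pbd pcd q1 q2 q4 q5 q6 qs
          omega
        have f0c : ec = 0 ∨ ec = 2 := by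
          clear hkab hkac hkad hkbc hkbd hkcd hta htb htd hea heb hed ht pab pac pad pbc pbd pcd q1 q2 q3 q4 q5 q6 qs
          omega
        have e0d : td = ed - 2 := by
          clear hkab hkac hkad hkbc hkbd hkcd hta htb htc htd hea heb hec hed ht pab pac pad pbc pbd pcd q1 q2 q3 q5 q6 qs
          omega
        have f0d : ed = 0 ∨ ed = 2 := by
          clear hkab hkac hkad hkbc hkbd hkcd hta htb htc hea heb hec ht pab pac pad pbc pbd pcd q1 q2 q3 q4 q5 q6 qs
          omega
        have f2 : ec = 2 ∧ td = -2 ∨ ed = 2 ∧ tc = -2 := by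
          clear hkab hkac hkad hkbc hkbd hkcd hta htb htc htd hea heb hec hed ht pab pac pad pbc pbd pcd q1 q2 q3 q4 q5 q6 qs
          omega
        have v : VanAt D δ a b c d := by
          refine fin_z3 D H (S.psub ha) (S.psub hc) (S.psub hd) hδ hε na nb nc nd nδ nε ?_ ?_ ?_ ?_ ?_ ?_ ?_
          on_goal 7 =>
            simp only [hec.1, hed.1, htc.1, htd.1]
            norm_cast
          all_goals (simp only [hkab.1, hkac.1, hkad.1, hkbc.1, hkbd.1, hkcd.1, hta.1, htb.1, htc.1, htd.1, hea.1, heb.1, hec.1, hed.1, hkab.2.1, hkac.2.1, hkad.2.1, hkbc.2.1, hkbd.2.1, hkcd.2.1]; norm_cast)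
        exact v
      · obtain ⟨k1, k2, k3, k4, k5⟩ : kab = 0 ∧ kad = 0 ∧ kbc = 0 ∧ kbd = 0 ∧ kcd = 0 := by
          clear hkab hkac hkad hkbc hkbd hkcd hta htb htc htd hea heb hec hed ht q1 q2 q3 q4 q5 q6 qs
          omega
        have e0a : ea = 2 := by
          clear hkab hkac hkad hkbc hkbd hkcd htb htc htd heb hec hed ht pab pac pad pbc pbd pcd q2 q3 q4 q5 q6 qs
          omega
        have t0a : ta = -2 := by
          clear hkab hkac hkad hkbc hkbd hkcd hta htb htc htd hea heb hec hed ht pab pac pad pbc pbd pcd q2 q3 q4 q5 q6 qs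
          omega
        have e0c : ec = 2 := by
          clear hkab hkac hkad hkbc hkbd hkcd hta htb htd hea heb hed ht pab pac pad pbc pbd pcd q1 q2 q4 q5 q6 qs
          omega
        have t0c : tc = -2 := by
          clear hkab hkac hkad hkbc hkbd hkcd hta htb htc htd hea heb hec hed ht pab pac pad pbc pbd pcd q1 q2 q4 q5 q6 qs
          omega
        have f1 : eb + ed = 2 := by
          clear hkab hkac hkad hkbc hkbd hkcd hta htb htc htd hea heb hec hed ht pab pac pad pbc pbd pcd q1 q2 q3 q4 q5 qs
          omega
        have e0b : tb = eb - 2 := by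
          clear hkab hkac hkad hkbc hkbd hkcd hta htb htc htd hea heb hec hed ht pab pac pad pbc pbd pcd q1 q3 q4 q5 q6 qs
          omega
        have f0b : eb = 0 ∨ eb = 2 := by
          clear hkab hkac hkad hkbc hkbd hkcd hta htc htd hea hec hed ht pab pac pad pbc pbd pcd q1 q2 q3 q4 q5 q6 qs
          omega
        have e0d : td = ed - 2 := by
          clear hkab hkac hkad hkbc hkbd hkcd hta htb htc htd hea heb hec hed ht pab pac pad pbc pbd pcd q1 q2 q3 q5 q6 qs
          omega
        have f0d : ed = 0 ∨ ed = 2 := by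
          clear hkab hkac hkad hkbc hkbd hkcd hta htb htc hea heb hec ht pab pac pad pbc pbd pcd q1 q2 q3 q4 q5 q6 qs
          omega
        have f2 : eb = 2 ∧ td = -2 ∨ ed = 2 ∧ tb = -2 := by
          clear hkab hkac hkad hkbc hkbd hkcd hta htb htc htd hea heb hec hed ht pab pac pad pbc pbd pcd q1 q2 q3 q4 q5 q6 qs
          omega
        have v : VanAt D δ a c b d := by
          refine fin_z3 D H (S.psub ha) (S.psub hb) (S.psub hd) hδ hε na nc nb nd nδ nε ?_ ?_ ?_ ?_ ?_ ?_ ?_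
          on_goal 7 =>
            simp only [heb.1, hed.1, htb.1, htd.1]
            norm_cast
          all_goals (simp only [hkab.1, hkac.1, hkad.1, hkbc.1, hkbd.1, hkcd.1, hta.1, htb.1, htc.1, htd.1, hea.1, heb.1, hec.1, hed.1, hkab.2.1, hkac.2.1, hkad.2.1, hkbc.2.1, hkbd.2.1, hkcd.2.1]; norm_cast)
        exact v.s23
      · obtain ⟨k1, k2, k3, k4, k5⟩ : kab = 0 ∧ kac = 0 ∧ kbc = 0 ∧ kbd = 0 ∧ kcd = 0 := by
          clear hkab hkac hkad hkbc hkbd hkcd hta htb htc htd hea heb hec hed ht q1 q2 q3 q4 q5 q6 qs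
          omega
        have e0a : ea = 2 := by
          clear hkab hkac hkad hkbc hkbd hkcd htb htc htd heb hec hed ht pab pac pad pbc pbd pcd q2 q3 q4 q5 q6 qs
          omega
        have t0a : ta = -2 := by
          clear hkab hkac hkad hkbc hkbd hkcd hta htb htc htd hea heb hec hed ht pab pac pad pbc pbd pcd q2 q3 q4 q5 q6 qs
          omega
        have e0d : ed = 2 := by
          clear hkab hkac hkad hkbc hkbd hkcd hta htb htc hea heb hec ht pab pac pad pbc pbd pcd q1 q2 q3 q5 q6 qs
          omega
        have t0d : td = -2 := by
          clear hkab hkac hkad hkbc hkbd hkcd hta htb htc htd hea heb hec hed ht pab pac pad pbc pbd pcd q1 q2 q3 q5 q6 qs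
          omega
        have f1 : eb + ec = 2 := by
          clear hkab hkac hkad hkbc hkbd hkcd hta htb htc htd hea heb hec hed ht pab pac pad pbc pbd pcd q1 q2 q3 q4 q5 qs
          omega
        have e0b : tb = eb - 2 := by
          clear hkab hkac hkad hkbc hkbd hkcd hta htb htc htd hea heb hec hed ht pab pac pad pbc pbd pcd q1 q3 q4 q5 q6 qs
          omega
        have f0b : eb = 0 ∨ eb = 2 := by
          clear hkab hkac hkad hkbc hkbd hkcd hta htc htd hea hec hed ht pab pac pad pbc pbd pcd q1 q2 q3 q4 q5 q6 qs
          omega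
        have e0c : tc = ec - 2 := by
          clear hkab hkac hkad hkbc hkbd hkcd hta htb htc htd hea heb hec hed ht pab pac pad pbc pbd pcd q1 q2 q4 q5 q6 qs
          omega
        have f0c : ec = 0 ∨ ec = 2 := by
          clear hkab hkac hkad hkbc hkbd hkcd hta htb htd hea heb hed ht pab pac pad pbc pbd pcd q1 q2 q3 q4 q5 q6 qs
          omega
        have f2 : eb = 2 ∧ tc = -2 ∨ ec = 2 ∧ tb = -2 := by
          clear hkab hkac hkad hkbc hkbd hkcd hta htb htc htd hea heb hec hed ht pab pac pad pbc pbd pcd q1 q2 q3 q4 q5 q6 qs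
          omega
        have v : VanAt D δ a d b c := by
          refine fin_z3 D H (S.psub ha) (S.psub hb) (S.psub hc) hδ hε na nd nb nc nδ nε ?_ ?_ ?_ ?_ ?_ ?_ ?_
          on_goal 7 =>
            simp only [heb.1, hec.1, htb.1, htc.1]
            norm_cast
          all_goals (simp only [hkab.1, hkac.1, hkad.1, hkbc.1, hkbd.1, hkcd.1, hta.1, htb.1, htc.1, htd.1, hea.1, heb.1, hec.1, hed.1, hkab.2.1, hkac.2.1, hkad.2.1, hkbc.2.1, hkbd.2.1, hkcd.2.1]; norm_cast)
        exact v.s23.s34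
      · obtain ⟨k1, k2, k3, k4, k5⟩ : kab = 0 ∧ kac = 0 ∧ kad = 0 ∧ kbd = 0 ∧ kcd = 0 := by
          clear hkab hkac hkad hkbc hkbd hkcd hta htb htc htd hea heb hec hed ht q1 q2 q3 q4 q5 q6 qs
          omega
        have e0b : eb = 2 := by
          clear hkab hkac hkad hkbc hkbd hkcd hta htc htd hea hec hed ht pab pac pad pbc pbd pcd q1 q3 q4 q5 q6 qs
          omega
        have t0b : tb = -2 := by
          clear hkab hkac hkad hkbc hkbd hkcd hta htb htc htd hea heb hec hed ht pab pac pad pbc pbd pcd q1 q3 q4 q5 q6 qs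
          omega
        have e0c : ec = 2 := by
          clear hkab hkac hkad hkbc hkbd hkcd hta htb htd hea heb hed ht pab pac pad pbc pbd pcd q1 q2 q4 q5 q6 qs
          omega
        have t0c : tc = -2 := by
          clear hkab hkac hkad hkbc hkbd hkcd hta htb htc htd hea heb hec hed ht pab pac pad pbc pbd pcd q1 q2 q4 q5 q6 qs
          omega
        have f1 : ea + ed = 2 := by
          clear hkab hkac hkad hkbc hkbd hkcd hta htb htc htd hea heb hec hed ht pab pac pad pbc pbd pcd q1 q2 q3 q4 q5 qs
          omega
        have e0a : ta = ea - 2 := by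
          clear hkab hkac hkad hkbc hkbd hkcd hta htb htc htd hea heb hec hed ht pab pac pad pbc pbd pcd q2 q3 q4 q5 q6 qs
          omega
        have f0a : ea = 0 ∨ ea = 2 := by
          clear hkab hkac hkad hkbc hkbd hkcd htb htc htd heb hec hed ht pab pac pad pbc pbd pcd q1 q2 q3 q4 q5 q6 qs
          omega
        have e0d : td = ed - 2 := by
          clear hkab hkac hkad hkbc hkbd hkcd hta htb htc htd hea heb hec hed ht pab pac pad pbc pbd pcd q1 q2 q3 q5 q6 qs
          omega
        have f0d : ed = 0 ∨ ed = 2 := by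
          clear hkab hkac hkad hkbc hkbd hkcd hta htb htc hea heb hec ht pab pac pad pbc pbd pcd q1 q2 q3 q4 q5 q6 qs
          omega
        have f2 : ea = 2 ∧ td = -2 ∨ ed = 2 ∧ ta = -2 := by
          clear hkab hkac hkad hkbc hkbd hkcd hta htb htc htd hea heb hec hed ht pab pac pad pbc pbd pcd q1 q2 q3 q4 q5 q6 qs
          omega
        have v : VanAt D δ b c a d := by
          refine fin_z3 D H (S.psub hb) (S.psub ha) (S.psub hd) hδ hε nb nc na nd nδ nε ?_ ?_ ?_ ?_ ?_ ?_ ?_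
          on_goal 7 =>
            simp only [hea.1, hed.1, hta.1, htd.1]
            norm_cast
          all_goals (simp only [hkab.1, hkac.1, hkad.1, hkbc.1, hkbd.1, hkcd.1, hta.1, htb.1, htc.1, htd.1, hea.1, heb.1, hec.1, hed.1, hkab.2.1, hkac.2.1, hkad.2.1, hkbc.2.1, hkbd.2.1, hkcd.2.1]; norm_cast)
        exact v.s23.s12
      · obtain ⟨k1, k2, k3, k4, k5⟩ : kab = 0 ∧ kac = 0 ∧ kad = 0 ∧ kbc = 0 ∧ kcd = 0 := by
          clear hkab hkac hkad hkbc hkbd hkcd hta htb htc htd hea heb hec hed ht q1 q2 q3 q4 q5 q6 qs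
          omega
        have e0b : eb = 2 := by
          clear hkab hkac hkad hkbc hkbd hkcd hta htc htd hea hec hed ht pab pac pad pbc pbd pcd q1 q3 q4 q5 q6 qs
          omega
        have t0b : tb = -2 := by
          clear hkab hkac hkad hkbc hkbd hkcd hta htb htc htd hea heb hec hed ht pab pac pad pbc pbd pcd q1 q3 q4 q5 q6 qs
          omega
        have e0d : ed = 2 := by
          clear hkab hkac hkad hkbc hkbd hkcd hta htb htc hea heb hec ht pab pac pad pbc pbd pcd q1 q2 q3 q5 q6 qs
          omega
        have t0d : td = -2 := by
          clear hkab hkac hkad hkbc hkbd hkcd hta htb htc htd hea heb hec hed ht pab pac pad pbc pbd pcd q1 q2 q3 q5 q6 qs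
          omega
        have f1 : ea + ec = 2 := by
          clear hkab hkac hkad hkbc hkbd hkcd hta htb htc htd hea heb hec hed ht pab pac pad pbc pbd pcd q1 q2 q3 q4 q5 qs
          omega
        have e0a : ta = ea - 2 := by
          clear hkab hkac hkad hkbc hkbd hkcd hta htb htc htd hea heb hec hed ht pab pac pad pbc pbd pcd q2 q3 q4 q5 q6 qs
          omega
        have f0a : ea = 0 ∨ ea = 2 := by
          clear hkab hkac hkad hkbc hkbd hkcd htb htc htd heb hec hed ht pab pac pad pbc pbd pcd q1 q2 q3 q4 q5 q6 qs
          omega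
        have e0c : tc = ec - 2 := by
          clear hkab hkac hkad hkbc hkbd hkcd hta htb htc htd hea heb hec hed ht pab pac pad pbc pbd pcd q1 q2 q4 q5 q6 qs
          omega
        have f0c : ec = 0 ∨ ec = 2 := by
          clear hkab hkac hkad hkbc hkbd hkcd hta htb htd hea heb hed ht pab pac pad pbc pbd pcd q1 q2 q3 q4 q5 q6 qs
          omega
        have f2 : ea = 2 ∧ tc = -2 ∨ ec = 2 ∧ ta = -2 := by
          clear hkab hkac hkad hkbc hkbd hkcd hta htb htc htd hea heb hec hed ht pab pac pad pbc pbd pcd q1 q2 q3 q4 q5 q6 qs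
          omega
        have v : VanAt D δ b d a c := by
          refine fin_z3 D H (S.psub hb) (S.psub ha) (S.psub hc) hδ hε nb nd na nc nδ nε ?_ ?_ ?_ ?_ ?_ ?_ ?_
          on_goal 7 =>
            simp only [hea.1, hec.1, hta.1, htc.1]
            norm_cast
          all_goals (simp only [hkab.1, hkac.1, hkad.1, hkbc.1, hkbd.1, hkcd.1, hta.1, htb.1, htc.1, htd.1, hea.1, heb.1, hec.1, hed.1, hkab.2.1, hkac.2.1, hkad.2.1, hkbc.2.1, hkbd.2.1, hkcd.2.1]; norm_cast)
        exact v.s23.s12.s34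
      · obtain ⟨k1, k2, k3, k4, k5⟩ : kab = 0 ∧ kac = 0 ∧ kad = 0 ∧ kbc = 0 ∧ kbd = 0 := by
          clear hkab hkac hkad hkbc hkbd hkcd hta htb htc htd hea heb hec hed ht q1 q2 q3 q4 q5 q6 qs
          omega
        have e0c : ec = 2 := by
          clear hkab hkac hkad hkbc hkbd hkcd hta htb htd hea heb hed ht pab pac pad pbc pbd pcd q1 q2 q4 q5 q6 qs
          omega
        have t0c : tc = -2 := by
          clear hkab hkac hkad hkbc hkbd hkcd hta htb htc htd hea heb hec hed ht pab pac pad pbc pbd pcd q1 q2 q4 q5 q6 qs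
          omega
        have e0d : ed = 2 := by
          clear hkab hkac hkad hkbc hkbd hkcd hta htb htc hea heb hec ht pab pac pad pbc pbd pcd q1 q2 q3 q5 q6 qs
          omega
        have t0d : td = -2 := by
          clear hkab hkac hkad hkbc hkbd hkcd hta htb htc htd hea heb hec hed ht pab pac pad pbc pbd pcd q1 q2 q3 q5 q6 qs
          omega
        have f1 : ea + eb = 2 := by
          clear hkab hkac hkad hkbc hkbd hkcd hta htb htc htd hea heb hec hed ht pab pac pad pbc pbd pcd q1 q2 q3 q4 q5 qs
          omega
        have e0a : ta = ea - 2 := by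
          clear hkab hkac hkad hkbc hkbd hkcd hta htb htc htd hea heb hec hed ht pab pac pad pbc pbd pcd q2 q3 q4 q5 q6 qs
          omega
        have f0a : ea = 0 ∨ ea = 2 := by
          clear hkab hkac hkad hkbc hkbd hkcd htb htc htd heb hec hed ht pab pac pad pbc pbd pcd q1 q2 q3 q4 q5 q6 qs
          omega
        have e0b : tb = eb - 2 := by
          clear hkab hkac hkad hkbc hkbd hkcd hta htb htc htd hea heb hec hed ht pab pac pad pbc pbd pcd q1 q3 q4 q5 q6 qs
          omega
        have f0b : eb = 0 ∨ eb = 2 := by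
          clear hkab hkac hkad hkbc hkbd hkcd hta htc htd hea hec hed ht pab pac pad pbc pbd pcd q1 q2 q3 q4 q5 q6 qs
          omega
        have f2 : ea = 2 ∧ tb = -2 ∨ eb = 2 ∧ ta = -2 := by
          clear hkab hkac hkad hkbc hkbd hkcd hta htb htc htd hea heb hec hed ht pab pac pad pbc pbd pcd q1 q2 q3 q4 q5 q6 qs
          omega
        have v : VanAt D δ c d a b := by
          refine fin_z3 D H (S.psub hc) (S.psub ha) (S.psub hb) hδ hε nc nd na nb nδ nε ?_ ?_ ?_ ?_ ?_ ?_ ?_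
          on_goal 7 =>
            simp only [hea.1, heb.1, hta.1, htb.1]
            norm_cast
          all_goals (simp only [hkab.1, hkac.1, hkad.1, hkbc.1, hkbd.1, hkcd.1, hta.1, htb.1, htc.1, htd.1, hea.1, heb.1, hec.1, hed.1, hkab.2.1, hkac.2.1, hkad.2.1, hkbc.2.1, hkbd.2.1, hkcd.2.1]; norm_cast)
        exact v.s23.s12.s34.s23
    · have q := H.neg_all nε nδ (by rw [ht.1, h]; norm_num)
      have ra := int_neg q hta.1 hea.1
      have rb := int_neg q htb.1 heb.1
      have rc := int_neg q htc.1 hec.1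
      have rd := int_neg q htd.1 hed.1
      have hs := two_eps e q
      have ba : ea ≤ 2 := by
        clear hkab hkac hkad hkbc hkbd hkcd hta htb htc htd heb hec hed ht pab pac pad pbc pbd pcd q1 q2 q3 q4 q5 q6 qs
        omega
      have bb : eb ≤ 2 := by
        clear hkab hkac hkad hkbc hkbd hkcd hta htb htc htd hea hec hed ht pab pac pad pbc pbd pcd q1 q2 q3 q4 q5 q6 qs
        omega
      have bc : ec ≤ 2 := by
        clear hkab hkac hkad hkbc hkbd hkcd hta htb htc htd hea heb hed ht pab pac pad pbc pbd pcd q1 q2 q3 q4 q5 q6 qs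
        omega
      have bd : ed ≤ 2 := by
        clear hkab hkac hkad hkbc hkbd hkcd hta htb htc htd hea heb hec ht pab pac pad pbc pbd pcd q1 q2 q3 q4 q5 q6 qs
        omega
      have va : ea = 2 := by
        clear hkab hkac hkad hkbc hkbd hkcd hta htb htc htd hea heb hec hed ht pab pac pad pbc pbd pcd q1 q2 q3 q4 q5 qs
        omega
      have vb : eb = 2 := by
        clear hkab hkac hkad hkbc hkbd hkcd hta htb htc htd hea heb hec hed ht pab pac pad pbc pbd pcd q1 q2 q3 q4 q5 qs
        omega
      have vc : ec = 2 := by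
        clear hkab hkac hkad hkbc hkbd hkcd hta htb htc htd hea heb hec hed ht pab pac pad pbc pbd pcd q1 q2 q3 q4 q5 qs
        omega
      have vd : ed = 2 := by
        clear hkab hkac hkad hkbc hkbd hkcd hta htb htc htd hea heb hec hed ht pab pac pad pbc pbd pcd q1 q2 q3 q4 q5 qs
        omega
      have wa : kab + kac + kad = 2 := by
        clear hkab hkac hkad hkbc hkbd hkcd hta htb htc htd hea heb hec hed ht pab pac pad pbc pbd pcd q2 q3 q4 q5 q6 qs
        omega
      have wb : kab + kbc + kbd = 2 := by
        clear hkab hkac hkad hkbc hkbd hkcd hta htb htc htd hea heb hec hed ht pab pac pad pbc pbd pcd q1 q3 q4 q5 q6 qs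
        omega
      have wc : kac + kbc + kcd = 2 := by
        clear hkab hkac hkad hkbc hkbd hkcd hta htb htc htd hea heb hec hed ht pab pac pad pbc pbd pcd q1 q2 q4 q5 q6 qs
        omega
      have wd : kad + kbd + kcd = 2 := by
        clear hkab hkac hkad hkbc hkbd hkcd hta htb htc htd hea heb hec hed ht pab pac pad pbc pbd pcd q1 q2 q3 q5 q6 qs
        omega
      obtain ⟨c1, c2, c3⟩ : kcd = kab ∧ kbd = kac ∧ kbc = kad := by
        clear hkab hkac hkad hkbc hkbd hkcd hta htb htc htd hea heb hec hed ht pab pac pad pbc pbd pcd q1 q2 q3 q4 q5 q6 qs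
        omega
      have u : (kab = 2 ∧ kac = 0 ∧ kad = 0) ∨ (kab = 0 ∧ kac = 2 ∧ kad = 0) ∨
        (kab = 0 ∧ kac = 0 ∧ kad = 2) ∨ (kab = 1 ∧ kac = 0 ∧ kad = 1) ∨
        (kab = 0 ∧ kac = 1 ∧ kad = 1) ∨ (kab = 1 ∧ kac = 1 ∧ kad = 0) := by
        clear hkab hkac hkad hkbc hkbd hkcd hta htb htc htd hea heb hec hed ht q1 q2 q3 q4 q5 q6 qs
        omega
      rcases u with ⟨u1, u2, u3⟩ | ⟨u1, u2, u3⟩ | ⟨u1, u2, u3⟩ | ⟨u1, u2, u3⟩ | ⟨u1, u2, u3⟩ | ⟨u1, u2, u3⟩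
      · rw [u1] at c1
        rw [u2] at c2
        rw [u3] at c3
        have v : VanAt D δ a b c d := by
          refine fin_z1 D H (S.psub ha) (S.psub hc) hε na nb nc nd nε ?_ ?_ ?_ ?_ ?_ <;>
            (simp only [hkab.1, hkac.1, hkad.1, hkbc.1, hkbd.1, hkcd.1, hta.1, htb.1, htc.1, htd.1, hea.1, heb.1, hec.1, hed.1, hkab.2.1, hkac.2.1, hkad.2.1, hkbc.2.1, hkbd.2.1, hkcd.2.1]; norm_cast)
        exact v
      · rw [u1] at c1
        rw [u2] at c2
        rw [u3] at c3
        have v : VanAt D δ a c b d := by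
          refine fin_z1 D H (S.psub ha) (S.psub hb) hε na nc nb nd nε ?_ ?_ ?_ ?_ ?_ <;>
            (simp only [hkab.1, hkac.1, hkad.1, hkbc.1, hkbd.1, hkcd.1, hta.1, htb.1, htc.1, htd.1, hea.1, heb.1, hec.1, hed.1, hkab.2.1, hkac.2.1, hkad.2.1, hkbc.2.1, hkbd.2.1, hkcd.2.1]; norm_cast)
        exact v.s23
      · rw [u1] at c1
        rw [u2] at c2
        rw [u3] at c3
        have v : VanAt D δ a d b c := by
          refine fin_z1 D H (S.psub ha) (S.psub hb) hε na nd nb nc nε ?_ ?_ ?_ ?_ ?_ <;>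
            (simp only [hkab.1, hkac.1, hkad.1, hkbc.1, hkbd.1, hkcd.1, hta.1, htb.1, htc.1, htd.1, hea.1, heb.1, hec.1, hed.1, hkab.2.1, hkac.2.1, hkad.2.1, hkbc.2.1, hkbd.2.1, hkcd.2.1]; norm_cast)
        exact v.s23.s34
      · rw [u1] at c1
        rw [u2] at c2
        rw [u3] at c3
        have v : VanAt D δ a b c d := by
          refine fin_cycle D H (S.psub ha) (S.psub hb) (S.psub hc) (S.psub hd) hε na nb nc nd nε ?_ ?_ ?_ ?_ ?_ ?_ ?_ ?_ ?_ ?_ <;>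
            (simp only [hkab.1, hkac.1, hkad.1, hkbc.1, hkbd.1, hkcd.1, hta.1, htb.1, htc.1, htd.1, hea.1, heb.1, hec.1, hed.1, hkab.2.1, hkac.2.1, hkad.2.1, hkbc.2.1, hkbd.2.1, hkcd.2.1]; norm_cast)
        exact v
      · rw [u1] at c1
        rw [u2] at c2
        rw [u3] at c3
        have v : VanAt D δ a c b d := by
          refine fin_cycle D H (S.psub ha) (S.psub hc) (S.psub hb) (S.psub hd) hε na nc nb nd nε ?_ ?_ ?_ ?_ ?_ ?_ ?_ ?_ ?_ ?_ <;>
            (simp only [hkab.1, hkac.1, hkad.1, hkbc.1, hkbd.1, hkcd.1, hta.1, htb.1, htc.1, htd.1, hea.1, heb.1, hec.1, hed.1, hkab.2.1, hkac.2.1, hkad.2.1, hkbc.2.1, hkbd.2.1, hkcd.2.1]; norm_cast)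
        exact v.s23
      · rw [u1] at c1
        rw [u2] at c2
        rw [u3] at c3
        have v : VanAt D δ a b d c := by
          refine fin_cycle D H (S.psub ha) (S.psub hb) (S.psub hd) (S.psub hc) hε na nb nd nc nε ?_ ?_ ?_ ?_ ?_ ?_ ?_ ?_ ?_ ?_ <;>
            (simp only [hkab.1, hkac.1, hkad.1, hkbc.1, hkbd.1, hkcd.1, hta.1, htb.1, htc.1, htd.1, hea.1, heb.1, hec.1, hed.1, hkab.2.1, hkac.2.1, hkad.2.1, hkbc.2.1, hkbd.2.1, hkcd.2.1]; norm_cast)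
        exact v.s34

lemma core_sssl (H : KForm D.roots K) (S : Sgn D.roots K Ψ C) {a b c d δ ε : V}
    (ha : a ∈ Ψ) (hb : b ∈ Ψ) (hc : c ∈ Ψ) (hd : d ∈ Ψ) (hδ : δ ∈ D.roots) (hε : ε ∈ D.roots)
    (e : ε = a + b + c + d + δ) (na : K a a = 2) (nb : K b b = 2) (nc : K c c = 2) (nd : K d d = 4) :
    False := by
  have na' := cst2 na
  have nb' := cst2 nb
  have nc' := cst2 nc
  have nd' := cst4 nd
  rcases H.norm δ hδ with nδ | nδ <;> rcases H.norm ε hε with nε | nε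
  · obtain ⟨kab, kac, kad, kbc, kbd, kcd, ta, tb, tc, td, ea, eb, ec, ed, t, ⟨q1, q2, q3, q4, q5, q6⟩, qs,
      ⟨pab, pac, pad, pbc, pbd, pcd⟩, hkab, hkac, hkad, hkbc, hkbd, hkcd, hta, htb, htc, htd, hea, heb, hec, hed, ht⟩ :=
      cdata H S ha hb hc hd hδ hε e na' nb' nc' nd' (cst2 nδ) (cst2 nε)
    norm_num [PR] at qs hkab hkac hkad hkbc hkbd hkcd hta htb htc htd hea heb hec hed ht
    clear hkab hkac hkad hkbc hkbd hkcd hta htb htc htd hea heb hec hed q1 q2 q3 q4 q5 q6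
    omega
  · obtain ⟨kab, kac, kad, kbc, kbd, kcd, ta, tb, tc, td, ea, eb, ec, ed, t, ⟨q1, q2, q3, q4, q5, q6⟩, qs,
      ⟨pab, pac, pad, pbc, pbd, pcd⟩, hkab, hkac, hkad, hkbc, hkbd, hkcd, hta, htb, htc, htd, hea, heb, hec, hed, ht⟩ :=
      cdata H S ha hb hc hd hδ hε e na' nb' nc' nd' (cst2 nδ) (cst4 nε)
    norm_num [PR] at qs hkab hkac hkad hkbc hkbd hkcd hta htb htc htd hea heb hec hed ht
    have u1 : t = -2 := by
      clear hkab hkac hkad hkbc hkbd hkcd hta htb htc htd hea heb hec hed q1 q2 q3 q4 q5 q6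
      omega
    obtain ⟨k1, k2, k3, k4, k5, k6⟩ : kab = 0 ∧ kac = 0 ∧ kad = 0 ∧ kbc = 0 ∧ kbd = 0 ∧ kcd = 0 := by
      clear hkab hkac hkad hkbc hkbd hkcd hta htb htc htd hea heb hec hed ht q1 q2 q3 q4 q5 q6
      omega
    have va : ea = 2 + ta := by
      clear hkab hkac hkad hkbc hkbd hkcd hta htb htc htd hea heb hec hed ht pab pac pad pbc pbd pcd q2 q3 q4 q5 q6 qs
      omega
    have wa : ta = -2 ∨ ta = 0 := by
      clear hkab hkac hkad hkbc hkbd hkcd htb htc htd heb hec hed ht pab pac pad pbc pbd pcd q1 q2 q3 q4 q5 q6 qs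
      omega
    have vb : eb = 2 + tb := by
      clear hkab hkac hkad hkbc hkbd hkcd hta htb htc htd hea heb hec hed ht pab pac pad pbc pbd pcd q1 q3 q4 q5 q6 qs
      omega
    have wb : tb = -2 ∨ tb = 0 := by
      clear hkab hkac hkad hkbc hkbd hkcd hta htc htd hea hec hed ht pab pac pad pbc pbd pcd q1 q2 q3 q4 q5 q6 qs
      omega
    have vc : ec = 2 + tc := by
      clear hkab hkac hkad hkbc hkbd hkcd hta htb htc htd hea heb hec hed ht pab pac pad pbc pbd pcd q1 q2 q4 q5 q6 qs
      omega
    have wc : tc = -2 ∨ tc = 0 := by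
      clear hkab hkac hkad hkbc hkbd hkcd hta htb htd hea heb hed ht pab pac pad pbc pbd pcd q1 q2 q3 q4 q5 q6 qs
      omega
    have vd : ed = 4 + td := by
      clear hkab hkac hkad hkbc hkbd hkcd hta htb htc htd hea heb hec hed ht pab pac pad pbc pbd pcd q1 q2 q3 q5 q6 qs
      omega
    have wd : td = -2 ∨ td = 0 := by
      clear hkab hkac hkad hkbc hkbd hkcd hta htb htc hea heb hec ht pab pac pad pbc pbd pcd q1 q2 q3 q4 q5 q6 qs
      omega
    have u : ed = 4 ∨ (td = -2 ∧ ta = -2) ∨ (td = -2 ∧ tb = -2) ∨ (td = -2 ∧ tc = -2) := by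
      clear hkab hkac hkad hkbc hkbd hkcd hta htb htc htd hea heb hec hed ht pab pac pad pbc pbd pcd q1 q2 q3 q4 q5 qs
      omega
    rcases u with h | ⟨h', h⟩ | ⟨h', h⟩ | ⟨h', h⟩
    · have q := H.eq_all nε nd (by rw [hed.1, h]; norm_num)
      have ra := int_eq q hkad.2.1 hea.1
      have rb := int_eq q hkbd.2.1 heb.1
      have rc := int_eq q hkcd.2.1 hec.1
      clear hkab hkac hkad hkbc hkbd hkcd hta htb htc htd hea heb hec hed ht pab pac pad pbc pbd pcd q1 q2 q3 q4 q5 qs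
      omega
    · have q := H.neg_all nδ na (by rw [hta.1, h]; norm_num)
      have rb := int_neg q hkab.1 htb.1
      have rc := int_neg q hkac.1 htc.1
      have rd := int_neg q hkad.1 htd.1
      clear hkab hkac hkad hkbc hkbd hkcd hta htb htc htd hea heb hec hed ht pab pac pad pbc pbd pcd q1 q2 q3 q4 q5 q6 qs
      omega
    · have q := H.neg_all nδ nb (by rw [htb.1, h]; norm_num)
      have ra := int_neg q hkab.2.1 hta.1
      have rc := int_neg q hkbc.1 htc.1
      have rd := int_neg q hkbd.1 htd.1
      clear hkab hkac hkad hkbc hkbd hkcd hta htb htc htd hea heb hec hed ht pab pac pad pbc pbd pcd q1 q2 q3 q4 q5 q6 qs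
      omega
    · have q := H.neg_all nδ nc (by rw [htc.1, h]; norm_num)
      have ra := int_neg q hkac.2.1 hta.1
      have rb := int_neg q hkbc.2.1 htb.1
      have rd := int_neg q hkcd.1 htd.1
      clear hkab hkac hkad hkbc hkbd hkcd hta htb htc htd hea heb hec hed ht pab pac pad pbc pbd pcd q1 q2 q3 q4 q5 q6 qs
      omega
  · obtain ⟨kab, kac, kad, kbc, kbd, kcd, ta, tb, tc, td, ea, eb, ec, ed, t, ⟨q1, q2, q3, q4, q5, q6⟩, qs,
      ⟨pab, pac, pad, pbc, pbd, pcd⟩, hkab, hkac, hkad, hkbc, hkbd, hkcd, hta, htb, htc, htd, hea, heb, hec, hed, ht⟩ :=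
      cdata H S ha hb hc hd hδ hε e na' nb' nc' nd' (cst4 nδ) (cst2 nε)
    norm_num [PR] at qs hkab hkac hkad hkbc hkbd hkcd hta htb htc htd hea heb hec hed ht
    have u1 : t = -2 := by
      clear hkab hkac hkad hkbc hkbd hkcd hta htb htc htd hea heb hec hed q1 q2 q3 q4 q5 q6
      omega
    obtain ⟨k1, k2, k3, k4, k5, k6⟩ : kab = 0 ∧ kac = 0 ∧ kad = 0 ∧ kbc = 0 ∧ kbd = 0 ∧ kcd = 0 := by
      clear hkab hkac hkad hkbc hkbd hkcd hta htb htc htd hea heb hec hed ht q1 q2 q3 q4 q5 q6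
      omega
    have va : ea = 2 + ta := by
      clear hkab hkac hkad hkbc hkbd hkcd hta htb htc htd hea heb hec hed ht pab pac pad pbc pbd pcd q2 q3 q4 q5 q6 qs
      omega
    have wa : ta = -2 ∨ ta = 0 := by
      clear hkab hkac hkad hkbc hkbd hkcd htb htc htd heb hec hed ht pab pac pad pbc pbd pcd q1 q2 q3 q4 q5 q6 qs
      omega
    have vb : eb = 2 + tb := by
      clear hkab hkac hkad hkbc hkbd hkcd hta htb htc htd hea heb hec hed ht pab pac pad pbc pbd pcd q1 q3 q4 q5 q6 qs
      omega
    have wb : tb = -2 ∨ tb = 0 := by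
      clear hkab hkac hkad hkbc hkbd hkcd hta htc htd hea hec hed ht pab pac pad pbc pbd pcd q1 q2 q3 q4 q5 q6 qs
      omega
    have vc : ec = 2 + tc := by
      clear hkab hkac hkad hkbc hkbd hkcd hta htb htc htd hea heb hec hed ht pab pac pad pbc pbd pcd q1 q2 q4 q5 q6 qs
      omega
    have wc : tc = -2 ∨ tc = 0 := by
      clear hkab hkac hkad hkbc hkbd hkcd hta htb htd hea heb hed ht pab pac pad pbc pbd pcd q1 q2 q3 q4 q5 q6 qs
      omega
    have vd : ed = 4 + td := by
      clear hkab hkac hkad hkbc hkbd hkcd hta htb htc htd hea heb hec hed ht pab pac pad pbc pbd pcd q1 q2 q3 q5 q6 qs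
      omega
    have wd : td = -2 ∨ td = -4 := by
      clear hkab hkac hkad hkbc hkbd hkcd hta htb htc hea heb hec ht pab pac pad pbc pbd pcd q1 q2 q3 q4 q5 q6 qs
      omega
    have u : td = -4 ∨ (ed = 2 ∧ ea = 2) ∨ (ed = 2 ∧ eb = 2) ∨ (ed = 2 ∧ ec = 2) := by
      clear hkab hkac hkad hkbc hkbd hkcd hta htb htc htd hea heb hec hed ht pab pac pad pbc pbd pcd q1 q2 q3 q4 q5 qs
      omega
    rcases u with h | ⟨h', h⟩ | ⟨h', h⟩ | ⟨h', h⟩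
    · have q := H.neg_all nδ nd (by rw [htd.1, h]; norm_num)
      have ra := int_neg q hkad.2.1 hta.1
      have rb := int_neg q hkbd.2.1 htb.1
      have rc := int_neg q hkcd.2.1 htc.1
      clear hkab hkac hkad hkbc hkbd hkcd hta htb htc htd hea heb hec hed ht pab pac pad pbc pbd pcd q1 q2 q3 q4 q6 qs
      omega
    · have q := H.eq_all nε na (by rw [hea.1, h]; norm_num)
      have rb := int_eq q hkab.1 heb.1
      have rc := int_eq q hkac.1 hec.1
      have rd := int_eq q hkad.1 hed.1
      clear hkab hkac hkad hkbc hkbd hkcd hta htb htc htd hea heb hec hed ht pab pac pad pbc pbd pcd q1 q2 q3 q4 q5 q6 qs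
      omega
    · have q := H.eq_all nε nb (by rw [heb.1, h]; norm_num)
      have ra := int_eq q hkab.2.1 hea.1
      have rc := int_eq q hkbc.1 hec.1
      have rd := int_eq q hkbd.1 hed.1
      clear hkab hkac hkad hkbc hkbd hkcd hta htb htc htd hea heb hec hed ht pab pac pad pbc pbd pcd q1 q2 q3 q4 q5 q6 qs
      omega
    · have q := H.eq_all nε nc (by rw [hec.1, h]; norm_num)
      have ra := int_eq q hkac.2.1 hea.1
      have rb := int_eq q hkbc.2.1 heb.1
      have rd := int_eq q hkcd.1 hed.1
      clear hkab hkac hkad hkbc hkbd hkcd hta htb htc htd hea heb hec hed ht pab pac pad pbc pbd pcd q1 q2 q3 q4 q5 q6 qs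
      omega
  · obtain ⟨kab, kac, kad, kbc, kbd, kcd, ta, tb, tc, td, ea, eb, ec, ed, t, ⟨q1, q2, q3, q4, q5, q6⟩, qs,
      ⟨pab, pac, pad, pbc, pbd, pcd⟩, hkab, hkac, hkad, hkbc, hkbd, hkcd, hta, htb, htc, htd, hea, heb, hec, hed, ht⟩ :=
      cdata H S ha hb hc hd hδ hε e na' nb' nc' nd' (cst4 nδ) (cst4 nε)
    norm_num [PR] at qs hkab hkac hkad hkbc hkbd hkcd hta htb htc htd hea heb hec hed ht
    have u : t = -2 ∨ t = -4 := by
      clear hkab hkac hkad hkbc hkbd hkcd hta htb htc htd hea heb hec hed q1 q2 q3 q4 q5 q6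
      omega
    rcases u with h | h
    · have sk : kab + kac + kad + kbc + kbd + kcd = 1 := by
        clear hkab hkac hkad hkbc hkbd hkcd hta htb htc htd hea heb hec hed ht pab pac pad pbc pbd pcd q1 q2 q3 q4 q5 q6
        omega
      have j1 : kad = 0 := by
        clear hkab hkac hkbc hkbd hkcd hta htb htc htd hea heb hec hed ht q1 q2 q3 q4 q5 q6 qs
        omega
      have j2 : kbd = 0 := by
        clear hkab hkac hkad hkbc hkcd hta htb htc htd hea heb hec hed ht q1 q2 q3 q4 q5 q6 qs
        omega
      have j3 : kcd = 0 := by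
        clear hkab hkac hkad hkbc hkbd hta htb htc htd hea heb hec hed ht q1 q2 q3 q4 q5 q6 qs
        omega
      have wa : (kab + kac + kad) % 2 = 0 := by
        clear hkab hkac hkad hkbc hkbd hkcd htb htc htd heb hec hed ht pab pac pad pbc pbd pcd q2 q3 q4 q5 q6 qs
        omega
      have wb : (kab + kbc + kbd) % 2 = 0 := by
        clear hkab hkac hkad hkbc hkbd hkcd hta htc htd hea hec hed ht pab pac pad pbc pbd pcd q1 q3 q4 q5 q6 qs
        omega
      have wc : (kac + kbc + kcd) % 2 = 0 := by
        clear hkab hkac hkad hkbc hkbd hkcd hta htb htd hea heb hed ht pab pac pad pbc pbd pcd q1 q2 q4 q5 q6 qs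
        omega
      clear hkab hkac hkad hkbc hkbd hkcd hta htb htc htd hea heb hec hed ht q1 q2 q3 q4 q5 q6 qs
      omega
    · have sk : kab + kac + kad + kbc + kbd + kcd = 3 := by
        clear hkab hkac hkad hkbc hkbd hkcd hta htb htc htd hea heb hec hed ht pab pac pad pbc pbd pcd q1 q2 q3 q4 q5 q6
        omega
      have q := H.neg_all nε nδ (by rw [ht.1, h]; norm_num)
      have ra := int_neg q hta.1 hea.1
      have rb := int_neg q htb.1 heb.1
      have rc := int_neg q htc.1 hec.1
      have rd := int_neg q htd.1 hed.1
      have hs := two_eps e q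
      have vd : ed = 2 := by
        clear hkab hkac hkad hkbc hkbd hkcd hta htb htc htd hea heb hec ht q1 q2 q3 q5 q6 qs
        omega
      have wd : kad + kbd + kcd = 0 := by
        clear hkab hkac hkad hkbc hkbd hkcd hta htb htc htd hea heb hec hed ht pab pac pad pbc pbd pcd q1 q2 q3 q5 q6 qs
        omega
      have ba : ea ≤ 2 := by
        clear hkab hkac hkad hkbc hkbd hkcd hta htb htc htd heb hec hed ht pab pac pad pbc pbd pcd q1 q2 q3 q4 q5 q6 qs
        omega
      have bb : eb ≤ 2 := by
        clear hkab hkac hkad hkbc hkbd hkcd hta htb htc htd hea hec hed ht pab pac pad pbc pbd pcd q1 q2 q3 q4 q5 q6 qs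
        omega
      have bc : ec ≤ 2 := by
        clear hkab hkac hkad hkbc hkbd hkcd hta htb htc htd hea heb hed ht pab pac pad pbc pbd pcd q1 q2 q3 q4 q5 q6 qs
        omega
      have va : ea = 2 := by
        clear hkab hkac hkad hkbc hkbd hkcd hta htb htc htd hea heb hec hed ht pab pac pad pbc pbd pcd q1 q2 q3 q4 q5 qs
        omega
      have vb : eb = 2 := by
        clear hkab hkac hkad hkbc hkbd hkcd hta htb htc htd hea heb hec hed ht pab pac pad pbc pbd pcd q1 q2 q3 q4 q5 qs
        omega
      have vc : ec = 2 := by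
        clear hkab hkac hkad hkbc hkbd hkcd hta htb htc htd hea heb hec hed ht pab pac pad pbc pbd pcd q1 q2 q3 q4 q5 qs
        omega
      obtain ⟨j1, j2, j3⟩ : kad = 0 ∧ kbd = 0 ∧ kcd = 0 := by
        clear hkab hkac hkad hkbc hkbd hkcd hta htb htc htd hea heb hec hed ht q1 q2 q3 q4 q5 q6 qs
        omega
      have wa : kab + kac + kad = 2 := by
        clear hkab hkac hkad hkbc hkbd hkcd hta htb htc htd hea heb hec hed ht pab pac pad pbc pbd pcd q2 q3 q4 q5 q6 qs
        omega
      have wb : kab + kbc + kbd = 2 := by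
        clear hkab hkac hkad hkbc hkbd hkcd hta htb htc htd hea heb hec hed ht pab pac pad pbc pbd pcd q1 q3 q4 q5 q6 qs
        omega
      have wc : kac + kbc + kcd = 2 := by
        clear hkab hkac hkad hkbc hkbd hkcd hta htb htc htd hea heb hec hed ht pab pac pad pbc pbd pcd q1 q2 q4 q5 q6 qs
        omega
      obtain ⟨j4, j5, j6⟩ : kab = 1 ∧ kac = 1 ∧ kbc = 1 := by
        clear hkab hkac hkad hkbc hkbd hkcd hta htb htc htd hea heb hec hed ht pab pac pad pbc pbd pcd q1 q2 q3 q4 q5 q6 qs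
        omega
      refine S.excl3 H hε hd ha hb hc hs nd na nb nc ?_ ?_ ?_ ?_ ?_ ?_ <;>
        (simp only [hkab.1, hkac.1, hkad.1, hkbc.1, hkbd.1, hkcd.1, hta.1, htb.1, htc.1, htd.1, hea.1, heb.1, hec.1, hed.1, hkab.2.1, hkac.2.1, hkad.2.1, hkbc.2.1, hkbd.2.1, hkcd.2.1]; norm_cast)

lemma core_ssll (H : KForm D.roots K) (S : Sgn D.roots K Ψ C) {a b c d δ ε : V}
    (ha : a ∈ Ψ) (hb : b ∈ Ψ) (hc : c ∈ Ψ) (hd : d ∈ Ψ) (hδ : δ ∈ D.roots) (hε : ε ∈ D.roots)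
    (e : ε = a + b + c + d + δ) (na : K a a = 2) (nb : K b b = 2) (nc : K c c = 4) (nd : K d d = 4) :
    False := by
  have na' := cst2 na
  have nb' := cst2 nb
  have nc' := cst4 nc
  have nd' := cst4 nd
  rcases H.norm δ hδ with nδ | nδ <;> rcases H.norm ε hε with nε | nε
  · obtain ⟨kab, kac, kad, kbc, kbd, kcd, ta, tb, tc, td, ea, eb, ec, ed, t, ⟨q1, q2, q3, q4, q5, q6⟩, qs,
      ⟨pab, pac, pad, pbc, pbd, pcd⟩, hkab, hkac, hkad, hkbc, hkbd, hkcd, hta, htb, htc, htd, hea, heb, hec, hed, ht⟩ :=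
      cdata H S ha hb hc hd hδ hε e na' nb' nc' nd' (cst2 nδ) (cst2 nε)
    norm_num [PR] at qs hkab hkac hkad hkbc hkbd hkcd hta htb htc htd hea heb hec hed ht
    clear hkab hkac hkad hkbc hkbd hkcd hta htb htc htd hea heb hec hed q1 q2 q3 q4 q5 q6
    omega
  · obtain ⟨kab, kac, kad, kbc, kbd, kcd, ta, tb, tc, td, ea, eb, ec, ed, t, ⟨q1, q2, q3, q4, q5, q6⟩, qs,
      ⟨pab, pac, pad, pbc, pbd, pcd⟩, hkab, hkac, hkad, hkbc, hkbd, hkcd, hta, htb, htc, htd, hea, heb, hec, hed, ht⟩ :=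
      cdata H S ha hb hc hd hδ hε e na' nb' nc' nd' (cst2 nδ) (cst4 nε)
    norm_num [PR] at qs hkab hkac hkad hkbc hkbd hkcd hta htb htc htd hea heb hec hed ht
    clear hkab hkac hkad hkbc hkbd hkcd hta htb htc htd hea heb hec hed q1 q2 q3 q4 q5 q6
    omega
  · obtain ⟨kab, kac, kad, kbc, kbd, kcd, ta, tb, tc, td, ea, eb, ec, ed, t, ⟨q1, q2, q3, q4, q5, q6⟩, qs,
      ⟨pab, pac, pad, pbc, pbd, pcd⟩, hkab, hkac, hkad, hkbc, hkbd, hkcd, hta, htb, htc, htd, hea, heb, hec, hed, ht⟩ :=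
      cdata H S ha hb hc hd hδ hε e na' nb' nc' nd' (cst4 nδ) (cst2 nε)
    norm_num [PR] at qs hkab hkac hkad hkbc hkbd hkcd hta htb htc htd hea heb hec hed ht
    clear hkab hkac hkad hkbc hkbd hkcd hta htb htc htd hea heb hec hed q1 q2 q3 q4 q5 q6
    omega
  · obtain ⟨kab, kac, kad, kbc, kbd, kcd, ta, tb, tc, td, ea, eb, ec, ed, t, ⟨q1, q2, q3, q4, q5, q6⟩, qs,
      ⟨pab, pac, pad, pbc, pbd, pcd⟩, hkab, hkac, hkad, hkbc, hkbd, hkcd, hta, htb, htc, htd, hea, heb, hec, hed, ht⟩ :=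
      cdata H S ha hb hc hd hδ hε e na' nb' nc' nd' (cst4 nδ) (cst4 nε)
    norm_num [PR] at qs hkab hkac hkad hkbc hkbd hkcd hta htb htc htd hea heb hec hed ht
    have u : t = -2 ∨ t = -4 := by
      clear hkab hkac hkad hkbc hkbd hkcd hta htb htc htd hea heb hec hed q1 q2 q3 q4 q5 q6
      omega
    rcases u with h | h
    · obtain ⟨k1, k2, k3, k4, k5, k6⟩ : kab = 0 ∧ kac = 0 ∧ kad = 0 ∧ kbc = 0 ∧ kbd = 0 ∧ kcd = 0 := by
        clear hkab hkac hkad hkbc hkbd hkcd hta htb htc htd hea heb hec hed ht q1 q2 q3 q4 q5 q6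
        omega
      have va : ea = 0 ∨ ea = 2 := by
        clear hkab hkac hkad hkbc hkbd hkcd htb htc htd heb hec hed ht pab pac pad pbc pbd pcd q2 q3 q4 q5 q6 qs
        omega
      have vb : eb = 0 ∨ eb = 2 := by
        clear hkab hkac hkad hkbc hkbd hkcd hta htc htd hea hec hed ht pab pac pad pbc pbd pcd q1 q3 q4 q5 q6 qs
        omega
      have vc : ec = 0 ∨ ec = 2 ∨ ec = 4 := by
        clear hkab hkac hkad hkbc hkbd hkcd hta htb htd hea heb hed ht pab pac pad pbc pbd pcd q1 q2 q4 q5 q6 qs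
        omega
      have vd : ed = 0 ∨ ed = 2 ∨ ed = 4 := by
        clear hkab hkac hkad hkbc hkbd hkcd hta htb htc hea heb hec ht pab pac pad pbc pbd pcd q1 q2 q3 q5 q6 qs
        omega
      have wc : tc = ec - 4 := by
        clear hkab hkac hkad hkbc hkbd hkcd hta htb htc htd hea heb hec hed ht pab pac pad pbc pbd pcd q1 q2 q4 q5 q6 qs
        omega
      have wd : td = ed - 4 := by
        clear hkab hkac hkad hkbc hkbd hkcd hta htb htc htd hea heb hec hed ht pab pac pad pbc pbd pcd q1 q2 q3 q5 q6 qs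
        omega
      have u : ec = 4 ∨ ed = 4 ∨ tc = -4 ∨ td = -4 ∨ (ec = 2 ∧ ed = 2 ∧ ea = 2) ∨ (ec = 2 ∧ ed = 2 ∧ eb = 2) := by
        clear hkab hkac hkad hkbc hkbd hkcd hta htb htc htd hea heb hec hed ht pab pac pad pbc pbd pcd q1 q2 q3 q4 q5 qs
        omega
      rcases u with h' | h' | h' | h' | ⟨v1, v2, v3⟩ | ⟨v1, v2, v3⟩
      · have q := H.eq_all nε nc (by rw [hec.1, h']; norm_num)
        have ra := int_eq q hkac.2.1 hea.1
        have rb := int_eq q hkbc.2.1 heb.1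
        have rd := int_eq q hkcd.1 hed.1
        clear hkab hkac hkad hkbc hkbd hkcd hta htb htc htd hea heb hec hed ht pab pac pad pbc pbd pcd q1 q2 q3 q4 q5 qs
        omega
      · have q := H.eq_all nε nd (by rw [hed.1, h']; norm_num)
        have ra := int_eq q hkad.2.1 hea.1
        have rb := int_eq q hkbd.2.1 heb.1
        have rc := int_eq q hkcd.2.1 hec.1
        clear hkab hkac hkad hkbc hkbd hkcd hta htb htc htd hea heb hec hed ht pab pac pad pbc pbd pcd q1 q2 q3 q4 q5 qs
        omega
      · have q := H.neg_all nδ nc (by rw [htc.1, h']; norm_num)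
        have ra := int_neg q hkac.2.1 hta.1
        have rb := int_neg q hkbc.2.1 htb.1
        have rd := int_neg q hkcd.1 htd.1
        clear hkab hkac hkad hkbc hkbd hkcd hta htb htc htd hea heb hec hed ht pab pac pad pbc pbd pcd q1 q2 q3 q4 q6 qs
        omega
      · have q := H.neg_all nδ nd (by rw [htd.1, h']; norm_num)
        have ra := int_neg q hkad.2.1 hta.1
        have rb := int_neg q hkbd.2.1 htb.1
        have rc := int_neg q hkcd.2.1 htc.1
        clear hkab hkac hkad hkbc hkbd hkcd hta htb htc htd hea heb hec hed ht pab pac pad pbc pbd pcd q1 q2 q3 q4 q6 qs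
        omega
      · have hs : (2:ℝ) • ε = c + d + a + a := by
          apply H.eq_of
          simp only [map_add, map_smul, LinearMap.add_apply, LinearMap.smul_apply, smul_eq_mul,
            hec.1, hed.1, hea.1, hec.2.1, hed.2.1, hea.2.1, nε, na, nc, nd, hkcd.1, hkcd.2.1,
            hkac.1, hkad.1, hkac.2.1, hkad.2.1]
          rw [k2, k3, k6, v1, v2, v3]; norm_num
        refine S.excl1 H hε hc hd ha ha hs ?_ ?_ ?_ ?_ ?_ <;>
          (simp only [hkab.1, hkac.1, hkad.1, hkbc.1, hkbd.1, hkcd.1, hta.1, htb.1, htc.1, htd.1, hea.1, heb.1, hec.1, hed.1, hkab.2.1, hkac.2.1, hkad.2.1, hkbc.2.1, hkbd.2.1, hkcd.2.1]; norm_cast)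
      · have hs : (2:ℝ) • ε = c + d + b + b := by
          apply H.eq_of
          simp only [map_add, map_smul, LinearMap.add_apply, LinearMap.smul_apply, smul_eq_mul,
            hec.1, hed.1, heb.1, hec.2.1, hed.2.1, heb.2.1, nε, nb, nc, nd, hkcd.1, hkcd.2.1,
            hkbc.1, hkbd.1, hkbc.2.1, hkbd.2.1]
          rw [k4, k5, k6, v1, v2, v3]; norm_num
        refine S.excl1 H hε hc hd hb hb hs ?_ ?_ ?_ ?_ ?_ <;>
          (simp only [hkab.1, hkac.1, hkad.1, hkbc.1, hkbd.1, hkcd.1, hta.1, htb.1, htc.1, htd.1, hea.1, heb.1, hec.1, hed.1, hkab.2.1, hkac.2.1, hkad.2.1, hkbc.2.1, hkbd.2.1, hkcd.2.1]; norm_cast)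
    · have sk : kab + kac + kad + kbc + kbd + kcd = 2 := by
        clear hkab hkac hkad hkbc hkbd hkcd hta htb htc htd hea heb hec hed ht pab pac pad pbc pbd pcd q1 q2 q3 q4 q5 q6
        omega
      have q := H.neg_all nε nδ (by rw [ht.1, h]; norm_num)
      have ra := int_neg q hta.1 hea.1
      have rb := int_neg q htb.1 heb.1
      have rc := int_neg q htc.1 hec.1
      have rd := int_neg q htd.1 hed.1
      have hs := two_eps e q
      have wa : kab + kac + kad = 2 := by
        clear hkab hkac hkad hkbc hkbd hkcd hta htb htc htd heb hec hed ht q2 q3 q4 q5 q6 qs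
        omega
      have wb : kab + kbc + kbd = 2 := by
        clear hkab hkac hkad hkbc hkbd hkcd hta htb htc htd hea hec hed ht q1 q3 q4 q5 q6 qs
        omega
      have wc : kac + kbc + kcd = 0 := by
        clear hkab hkac hkad hkbc hkbd hkcd hta htb htc htd hea heb hed ht q1 q2 q4 q5 q6 qs
        omega
      have wd : kad + kbd + kcd = 0 := by
        clear hkab hkac hkad hkbc hkbd hkcd hta htb htc htd hea heb hec ht q1 q2 q3 q5 q6 qs
        omega
      obtain ⟨j1, j2, j3, j4, j5⟩ : kac = 0 ∧ kad = 0 ∧ kbc = 0 ∧ kbd = 0 ∧ kcd = 0 := by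
        clear hkab hkac hkad hkbc hkbd hkcd hta htb htc htd hea heb hec hed ht q1 q2 q3 q4 q5 q6 qs
        omega
      refine S.excl1 H hε hc hd ha hb (by rw [hs]; abel) ?_ ?_ ?_ ?_ ?_ <;>
        (simp only [hkab.1, hkac.1, hkad.1, hkbc.1, hkbd.1, hkcd.1, hta.1, htb.1, htc.1, htd.1, hea.1, heb.1, hec.1, hed.1, hkab.2.1, hkac.2.1, hkad.2.1, hkbc.2.1, hkbd.2.1, hkcd.2.1]; norm_cast)

lemma core_slll (H : KForm D.roots K) (S : Sgn D.roots K Ψ C) {a b c d δ ε : V}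
    (ha : a ∈ Ψ) (hb : b ∈ Ψ) (hc : c ∈ Ψ) (hd : d ∈ Ψ) (hδ : δ ∈ D.roots) (hε : ε ∈ D.roots)
    (e : ε = a + b + c + d + δ) (na : K a a = 2) (nb : K b b = 4) (nc : K c c = 4) (nd : K d d = 4) :
    False := by
  have na' := cst2 na
  have nb' := cst4 nb
  have nc' := cst4 nc
  have nd' := cst4 nd
  rcases H.norm δ hδ with nδ | nδ <;> rcases H.norm ε hε with nε | nε
  · obtain ⟨kab, kac, kad, kbc, kbd, kcd, ta, tb, tc, td, ea, eb, ec, ed, t, ⟨q1, q2, q3, q4, q5, q6⟩, qs,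
      ⟨pab, pac, pad, pbc, pbd, pcd⟩, hkab, hkac, hkad, hkbc, hkbd, hkcd, hta, htb, htc, htd, hea, heb, hec, hed, ht⟩ :=
      cdata H S ha hb hc hd hδ hε e na' nb' nc' nd' (cst2 nδ) (cst2 nε)
    norm_num [PR] at qs hkab hkac hkad hkbc hkbd hkcd hta htb htc htd hea heb hec hed ht
    clear hkab hkac hkad hkbc hkbd hkcd hta htb htc htd hea heb hec hed q1 q2 q3 q4 q5 q6
    omega
  · obtain ⟨kab, kac, kad, kbc, kbd, kcd, ta, tb, tc, td, ea, eb, ec, ed, t, ⟨q1, q2, q3, q4, q5, q6⟩, qs,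
      ⟨pab, pac, pad, pbc, pbd, pcd⟩, hkab, hkac, hkad, hkbc, hkbd, hkcd, hta, htb, htc, htd, hea, heb, hec, hed, ht⟩ :=
      cdata H S ha hb hc hd hδ hε e na' nb' nc' nd' (cst2 nδ) (cst4 nε)
    norm_num [PR] at qs hkab hkac hkad hkbc hkbd hkcd hta htb htc htd hea heb hec hed ht
    clear hkab hkac hkad hkbc hkbd hkcd hta htb htc htd hea heb hec hed q1 q2 q3 q4 q5 q6
    omega
  · obtain ⟨kab, kac, kad, kbc, kbd, kcd, ta, tb, tc, td, ea, eb, ec, ed, t, ⟨q1, q2, q3, q4, q5, q6⟩, qs,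
      ⟨pab, pac, pad, pbc, pbd, pcd⟩, hkab, hkac, hkad, hkbc, hkbd, hkcd, hta, htb, htc, htd, hea, heb, hec, hed, ht⟩ :=
      cdata H S ha hb hc hd hδ hε e na' nb' nc' nd' (cst4 nδ) (cst2 nε)
    norm_num [PR] at qs hkab hkac hkad hkbc hkbd hkcd hta htb htc htd hea heb hec hed ht
    clear hkab hkac hkad hkbc hkbd hkcd hta htb htc htd hea heb hec hed q1 q2 q3 q4 q5 q6
    omega
  · obtain ⟨kab, kac, kad, kbc, kbd, kcd, ta, tb, tc, td, ea, eb, ec, ed, t, ⟨q1, q2, q3, q4, q5, q6⟩, qs,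
      ⟨pab, pac, pad, pbc, pbd, pcd⟩, hkab, hkac, hkad, hkbc, hkbd, hkcd, hta, htb, htc, htd, hea, heb, hec, hed, ht⟩ :=
      cdata H S ha hb hc hd hδ hε e na' nb' nc' nd' (cst4 nδ) (cst4 nε)
    norm_num [PR] at qs hkab hkac hkad hkbc hkbd hkcd hta htb htc htd hea heb hec hed ht
    have h : t = -4 := by
      clear hkab hkac hkad hkbc hkbd hkcd hta htb htc htd hea heb hec hed q1 q2 q3 q4 q5 q6
      omega
    have sk : kab + kac + kad + kbc + kbd + kcd = 1 := by
      clear hkab hkac hkad hkbc hkbd hkcd hta htb htc htd hea heb hec hed ht pab pac pad pbc pbd pcd q1 q2 q3 q4 q5 q6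
      omega
    have j0 : kab % 2 = 0 := by
      clear hkac hkad hkbc hkbd hkcd hta htb htc htd hea heb hec hed ht pab pac pad pbc pbd pcd q1 q2 q3 q4 q5 q6 qs
      omega
    have j1 : kac % 2 = 0 := by
      clear hkab hkad hkbc hkbd hkcd hta htb htc htd hea heb hec hed ht pab pac pad pbc pbd pcd q1 q2 q3 q4 q5 q6 qs
      omega
    have j2 : kad % 2 = 0 := by
      clear hkab hkac hkbc hkbd hkcd hta htb htc htd hea heb hec hed ht pab pac pad pbc pbd pcd q1 q2 q3 q4 q5 q6 qs
      omega
    have j3 : kbc % 2 = 0 := by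
      clear hkab hkac hkad hkbd hkcd hta htb htc htd hea heb hec hed ht pab pac pad pbc pbd pcd q1 q2 q3 q4 q5 q6 qs
      omega
    have j4 : kbd % 2 = 0 := by
      clear hkab hkac hkad hkbc hkcd hta htb htc htd hea heb hec hed ht pab pac pad pbc pbd pcd q1 q2 q3 q4 q5 q6 qs
      omega
    have j5 : kcd % 2 = 0 := by
      clear hkab hkac hkad hkbc hkbd hta htb htc htd hea heb hec hed ht pab pac pad pbc pbd pcd q1 q2 q3 q4 q5 q6 qs
      omega
    clear hkab hkac hkad hkbc hkbd hkcd hta htb htc htd hea heb hec hed ht pab pac pad pbc pbd pcd q1 q2 q3 q4 q5 q6 qs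
    omega

lemma core_llll (H : KForm D.roots K) (S : Sgn D.roots K Ψ C) {a b c d δ ε : V}
    (ha : a ∈ Ψ) (hb : b ∈ Ψ) (hc : c ∈ Ψ) (hd : d ∈ Ψ) (hδ : δ ∈ D.roots) (hε : ε ∈ D.roots)
    (e : ε = a + b + c + d + δ) (na : K a a = 4) (nb : K b b = 4) (nc : K c c = 4) (nd : K d d = 4) :
    False := by
  have na' := cst4 na
  have nb' := cst4 nb
  have nc' := cst4 nc
  have nd' := cst4 nd
  rcases H.norm δ hδ with nδ | nδ <;> rcases H.norm ε hε with nε | nε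
  · obtain ⟨kab, kac, kad, kbc, kbd, kcd, ta, tb, tc, td, ea, eb, ec, ed, t, ⟨q1, q2, q3, q4, q5, q6⟩, qs,
      ⟨pab, pac, pad, pbc, pbd, pcd⟩, hkab, hkac, hkad, hkbc, hkbd, hkcd, hta, htb, htc, htd, hea, heb, hec, hed, ht⟩ :=
      cdata H S ha hb hc hd hδ hε e na' nb' nc' nd' (cst2 nδ) (cst2 nε)
    norm_num [PR] at qs hkab hkac hkad hkbc hkbd hkcd hta htb htc htd hea heb hec hed ht
    clear hkab hkac hkad hkbc hkbd hkcd hta htb htc htd hea heb hec hed q1 q2 q3 q4 q5 q6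
    omega
  · obtain ⟨kab, kac, kad, kbc, kbd, kcd, ta, tb, tc, td, ea, eb, ec, ed, t, ⟨q1, q2, q3, q4, q5, q6⟩, qs,
      ⟨pab, pac, pad, pbc, pbd, pcd⟩, hkab, hkac, hkad, hkbc, hkbd, hkcd, hta, htb, htc, htd, hea, heb, hec, hed, ht⟩ :=
      cdata H S ha hb hc hd hδ hε e na' nb' nc' nd' (cst2 nδ) (cst4 nε)
    norm_num [PR] at qs hkab hkac hkad hkbc hkbd hkcd hta htb htc htd hea heb hec hed ht
    clear hkab hkac hkad hkbc hkbd hkcd hta htb htc htd hea heb hec hed q1 q2 q3 q4 q5 q6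
    omega
  · obtain ⟨kab, kac, kad, kbc, kbd, kcd, ta, tb, tc, td, ea, eb, ec, ed, t, ⟨q1, q2, q3, q4, q5, q6⟩, qs,
      ⟨pab, pac, pad, pbc, pbd, pcd⟩, hkab, hkac, hkad, hkbc, hkbd, hkcd, hta, htb, htc, htd, hea, heb, hec, hed, ht⟩ :=
      cdata H S ha hb hc hd hδ hε e na' nb' nc' nd' (cst4 nδ) (cst2 nε)
    norm_num [PR] at qs hkab hkac hkad hkbc hkbd hkcd hta htb htc htd hea heb hec hed ht
    clear hkab hkac hkad hkbc hkbd hkcd hta htb htc htd hea heb hec hed q1 q2 q3 q4 q5 q6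
    omega
  · obtain ⟨kab, kac, kad, kbc, kbd, kcd, ta, tb, tc, td, ea, eb, ec, ed, t, ⟨q1, q2, q3, q4, q5, q6⟩, qs,
      ⟨pab, pac, pad, pbc, pbd, pcd⟩, hkab, hkac, hkad, hkbc, hkbd, hkcd, hta, htb, htc, htd, hea, heb, hec, hed, ht⟩ :=
      cdata H S ha hb hc hd hδ hε e na' nb' nc' nd' (cst4 nδ) (cst4 nε)
    norm_num [PR] at qs hkab hkac hkad hkbc hkbd hkcd hta htb htc htd hea heb hec hed ht
    have h : t = -4 := by
      clear hkab hkac hkad hkbc hkbd hkcd hta htb htc htd hea heb hec hed q1 q2 q3 q4 q5 q6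
      omega
    obtain ⟨k1, k2, k3, k4, k5, k6⟩ : kab = 0 ∧ kac = 0 ∧ kad = 0 ∧ kbc = 0 ∧ kbd = 0 ∧ kcd = 0 := by
      clear hkab hkac hkad hkbc hkbd hkcd hta htb htc htd hea heb hec hed ht q1 q2 q3 q4 q5 q6
      omega
    have q := H.neg_all nε nδ (by rw [ht.1, h]; norm_num)
    have ra := int_neg q hta.1 hea.1
    have rb := int_neg q htb.1 heb.1
    have rc := int_neg q htc.1 hec.1
    have rd := int_neg q htd.1 hed.1
    have hs := two_eps e q
    refine S.excl1 H hε ha hb hc hd hs ?_ ?_ ?_ ?_ ?_ <;>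
      (simp only [hkab.1, hkac.1, hkad.1, hkbc.1, hkbd.1, hkcd.1, hta.1, htb.1, htc.1, htd.1, hea.1, heb.1, hec.1, hed.1, hkab.2.1, hkac.2.1, hkad.2.1, hkbc.2.1, hkbd.2.1, hkcd.2.1]; norm_cast)

end Core

end BSP

namespace BSP

section Final

variable {L : Type*} [LieRing L] [LieAlgebra ℂ L] (D : LieRootData V L)
variable {K : V →ₗ[ℝ] V →ₗ[ℝ] ℝ} {Ψ C : Set V}

lemma core (H : KForm D.roots K) (S : Sgn D.roots K Ψ C) {a b c d δ ε : V}
    (ha : a ∈ Ψ) (hb : b ∈ Ψ) (hc : c ∈ Ψ) (hd : d ∈ Ψ) (hδ : δ ∈ D.roots) (hε : ε ∈ D.roots)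
    (e : ε = a + b + c + d + δ) : VanAt D δ a b c d := by
  rcases H.norm a (S.psub ha) with na | na <;> rcases H.norm b (S.psub hb) with nb | nb <;>
    rcases H.norm c (S.psub hc) with nc | nc <;> rcases H.norm d (S.psub hd) with nd | nd
  · exact core_ssss D H S ha hb hc hd hδ hε e na nb nc nd
  · exact (core_sssl D H S ha hb hc hd hδ hε (by rw [e] <;> abel) na nb nc nd).elim
  · exact (core_sssl D H S ha hb hd hc hδ hε (by rw [e] <;> abel) na nb nd nc).elim
  · exact (core_ssll D H S ha hb hc hd hδ hε (by rw [e] <;> abel) na nb nc nd).elim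
  · exact (core_sssl D H S ha hc hd hb hδ hε (by rw [e] <;> abel) na nc nd nb).elim
  · exact (core_ssll D H S ha hc hb hd hδ hε (by rw [e] <;> abel) na nc nb nd).elim
  · exact (core_ssll D H S ha hd hb hc hδ hε (by rw [e] <;> abel) na nd nb nc).elim
  · exact (core_slll D H S ha hb hc hd hδ hε (by rw [e] <;> abel) na nb nc nd).elim
  · exact (core_sssl D H S hb hc hd ha hδ hε (by rw [e] <;> abel) nb nc nd na).elim
  · exact (core_ssll D H S hb hc ha hd hδ hε (by rw [e] <;> abel) nb nc na nd).elim
  · exact (core_ssll D H S hb hd ha hc hδ hε (by rw [e] <;> abel) nb nd na nc).elim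
  · exact (core_slll D H S hb ha hc hd hδ hε (by rw [e] <;> abel) nb na nc nd).elim
  · exact (core_ssll D H S hc hd ha hb hδ hε (by rw [e] <;> abel) nc nd na nb).elim
  · exact (core_slll D H S hc ha hb hd hδ hε (by rw [e] <;> abel) nc na nb nd).elim
  · exact (core_slll D H S hd ha hb hc hδ hε (by rw [e] <;> abel) nd na nb nc).elim
  · exact (core_llll D H S ha hb hc hd hδ hε (by rw [e] <;> abel) na nb nc nd).elim

lemma van_root (H : KForm D.roots K) (S : Sgn D.roots K Ψ C) {a b c d : V}
    (ha : a ∈ Ψ) (hb : b ∈ Ψ) (hc : c ∈ Ψ) (hd : d ∈ Ψ) : Van D a b c d := by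
  intro x1 h1 x2 h2 x3 h3 x4 h4
  have hN : 4 < K (a + b + c + d) (a + b + c + d) := by
    have two : ∀ x ∈ Ψ, 2 ≤ K x x := fun x hx => by
      rcases H.norm x (S.psub hx) with h | h <;> rw [h] <;> norm_num
    have := two a ha
    have := two b hb
    have := two c hc
    have := two d hd
    have := S.nn a ha b hb
    have := S.nn a ha c hc
    have := S.nn a ha d hd
    have := S.nn b hb c hc
    have := S.nn b hb d hd
    have := S.nn c hc d hd
    simp only [map_add, LinearMap.add_apply]
    rw [H.symm b a, H.symm c a, H.symm d a, H.symm c b, H.symm d b, H.symm d c]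
    linarith
  have mem : ∀ δ : V, ∀ y ∈ Gr D δ, S4 x1 x2 x3 x4 y ∈ Gr D (a + b + c + d + δ) := fun δ y hy =>
    S4_mem_Gr D (S.psub ha) (S.psub hb) (S.psub hc) (S.psub hd) h1 h2 h3 h4 hy
  refine op_zero D ?_ ?_
  · intro y hy
    have := mem 0 y (by rw [Gr_zero]; exact hy)
    rwa [add_zero, Gr_bot' D H hN, Submodule.mem_bot] at this
  · intro δ hδ y hy
    by_cases hε : a + b + c + d + δ ∈ D.roots
    · exact core D H S ha hb hc hd hδ hε rfl x1 h1 x2 h2 x3 h3 x4 h4 y hy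
    · have := mem δ y (by rw [Gr_root D hδ]; exact hy)
      rwa [Gr_bot D ?_ hε, Submodule.mem_bot] at this
      intro h0
      have h5 : a + b + c + d = -δ := eq_neg_of_add_eq_zero_left h0
      exact H.not_mem_of_gt hN (h5 ▸ H.neg_mem hδ)

lemma backward (H : KForm D.roots K) (S : Sgn D.roots K Ψ C) :
    IsSphericalSubspace (D.aSubspace Ψ) := by
  intro x hx
  have key : ∀ x1 ∈ D.aSubspace Ψ, ∀ x2 ∈ D.aSubspace Ψ, ∀ x3 ∈ D.aSubspace Ψ,
      ∀ x4 ∈ D.aSubspace Ψ, S4 x1 x2 x3 x4 = 0 := by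
    have ext : ∀ y z w : L, (∀ α ∈ Ψ, ∀ x ∈ D.rs α, S4 x y z w = 0) →
        ∀ x ∈ D.aSubspace Ψ, S4 x y z w = 0 := by
      intro y z w h x hx
      refine a_ind D (p := fun x => S4 x y z w = 0) ?_ ?_ ?_ h hx
      · intro u v hu hv; rw [S4_add, hu, hv, add_zero]
      · exact S4_zero y z w
      · intro k u hu; rw [S4_smul, hu, smul_zero]
    intro x1 h1 x2 h2 x3 h3 x4 h4
    refine ext _ _ _ ?_ x1 h1
    intro a ha y1 g1
    rw [S4_12]
    refine ext _ _ _ ?_ x2 h2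
    intro b hb y2 g2
    rw [S4_23, S4_12]
    refine ext _ _ _ ?_ x3 h3
    intro c hc y3 g3
    rw [S4_34, S4_23, S4_12]
    refine ext _ _ _ ?_ x4 h4
    intro d hd y4 g4
    exact van_root D H S hd hc hb ha y4 g4 y3 g3 y2 g2 y1 g1
  have h := key x hx x hx x hx x hx
  rw [S4_self] at h
  apply half 24 (by norm_num)
  rw [← h, Nat.cast_smul_eq_nsmul]

end Final

end BSP

/-- If `Φ` is irreducible and not of type `G₂` and `Ψ ⊆ Φ⁺` is
biconvex, then `𝔞_Ψ = ⊕_{α ∈ Ψ} 𝔤_α` is a spherical subspace of `𝔫` if and only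
if `⟨α, β⟩ ≥ 0` for all `α, β ∈ Ψ`. -/
theorem biconvex_spherical_iff_pairing_nonneg
    {V : Type*} [NormedAddCommGroup V] [InnerProductSpace ℝ V]
    {L : Type*} [LieRing L] [LieAlgebra ℂ L]
    (D : LieRootData V L)
    (hirr : D.toRootSystemData.IsIrreducible)
    (hG2 : D.toRootSystemData.NotG2)
    (Ψ : Set V) (hΨ : D.toRootSystemData.Biconvex Ψ) :
    IsSphericalSubspace (D.aSubspace Ψ) ↔ ∀ α ∈ Ψ, ∀ β ∈ Ψ, 0 ≤ cpair α β := by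
  obtain ⟨K, H, c, hc, hK⟩ := BSP.exists_kform D.toRootSystemData hirr hG2
  have hsub : Ψ ⊆ D.roots := hΨ.1.trans D.pos_subset
  have iff1 : ∀ α ∈ Ψ, ∀ β ∈ Ψ, (0 ≤ cpair α β ↔ 0 ≤ K α β) := by
    intro α _ β hβ
    have hp := BSP.norm_pos D.toRootSystemData (hsub hβ)
    rw [hK, cpair]
    constructor
    · intro h
      have h2 := mul_nonneg h hp.le
      rw [div_mul_cancel₀ _ hp.ne'] at h2
      exact mul_nonneg hc.le (by linarith)
    · intro h
      have h2 : 0 ≤ ⟪α, β⟫ := nonneg_of_mul_nonneg_right h hc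
      exact div_nonneg (by linarith) hp.le
  constructor
  · intro hs α hα β hβ
    exact (iff1 α hα β hβ).2 (BSP.forward D H hΨ.1 hs α hα β hβ)
  · intro h
    exact BSP.backward D H (BSP.sgn_of_biconvex D.toRootSystemData H hΨ
      fun α hα β hβ => (iff1 α hα β hβ).1 (h α hα β hβ))
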